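/- For every (u,η) with u_l ≠ 0, 0 < |η| < π and U|η| ≥ 1 (equivalently, Ψ(u,η) lies outside the Carnot–Carathéodory unit ball, up to a set of measure zero), one has ∫_1^{π/|η|} p(u,vη) J(u,vη) dv ≲ (|u|² η²)^{-1} p(u,η) J(u,η), where |u| is the Euclidean norm of u and the implied constant depends only on (𝒦,𝒜). -/

import Mathlib

open MeasureTheory Real Complex Finset Filter Topology

noncomputable section

/-- The underlying space of the nonisotropic Heisenberg group `ℍ(𝒦,𝒜)`, where the number of
blocks is `l + 1`, the block dimensions are `k 0, …, k l` and the parameters are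
`a 0 < ⋯ < a l`. A point is a pair `(z, t)` with `z i : Fin (k i) → ℂ` and `t : ℝ`. -/
abbrev Heis (l : ℕ) (k : Fin (l + 1) → ℕ) : Type :=
  ((i : Fin (l + 1)) → (Fin (k i) → ℂ)) × ℝ

variable (l : ℕ) (k : Fin (l + 1) → ℕ) (a : Fin (l + 1) → ℝ)

/-- The group multiplication of `ℍ(𝒦,𝒜)`:
`(z,t)·(z′,t′) = (z + z′, t + t′ + 2 ∑ᵢ aᵢ Im⟨zᵢ, zᵢ′⟩)`. -/
def hmul (g g' : Heis l k) : Heis l k :=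
  (g.1 + g'.1,
    g.2 + g'.2 + 2 * ∑ i, a i * (∑ j, (starRingEnd ℂ) (g.1 i j) * g'.1 i j).im)

/-- The group inversion of `ℍ(𝒦,𝒜)`: `(z,t)⁻¹ = (-z,-t)`. -/
def hinv (g : Heis l k) : Heis l k := (-g.1, -g.2)

/-- `|z i|²`, the squared Euclidean norm of the `i`-th block of `z`. -/
def zNormSq (z : (i : Fin (l + 1)) → Fin (k i) → ℂ) (i : Fin (l + 1)) : ℝ :=
  ∑ j, Complex.normSq (z i j)

/-- The left-invariant vector field `X_{i,j} = ∂_{x_{i,j}} + 2 aᵢ y_{i,j} ∂_t`, applied to a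
function `f` at a point `g`, realized as a directional (line) derivative. -/
def Xvf (i : Fin (l + 1)) (j : Fin (k i)) (f : Heis l k → ℝ) (g : Heis l k) : ℝ :=
  lineDeriv ℝ f g (Pi.single i (Pi.single j (1 : ℂ)), 2 * a i * (g.1 i j).im)

/-- The left-invariant vector field `Y_{i,j} = ∂_{y_{i,j}} - 2 aᵢ x_{i,j} ∂_t`. -/
def Yvf (i : Fin (l + 1)) (j : Fin (k i)) (f : Heis l k → ℝ) (g : Heis l k) : ℝ :=
  lineDeriv ℝ f g (Pi.single i (Pi.single j (Complex.I)), -(2 * a i * (g.1 i j).re))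

/-- The right-invariant vector field `X̂_{i,j} = ∂_{x_{i,j}} - 2 aᵢ y_{i,j} ∂_t`. -/
def XvfR (i : Fin (l + 1)) (j : Fin (k i)) (f : Heis l k → ℝ) (g : Heis l k) : ℝ :=
  lineDeriv ℝ f g (Pi.single i (Pi.single j (1 : ℂ)), -(2 * a i * (g.1 i j).im))

/-- The right-invariant vector field `Ŷ_{i,j} = ∂_{y_{i,j}} + 2 aᵢ x_{i,j} ∂_t`. -/
def YvfR (i : Fin (l + 1)) (j : Fin (k i)) (f : Heis l k → ℝ) (g : Heis l k) : ℝ :=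
  lineDeriv ℝ f g (Pi.single i (Pi.single j (Complex.I)), 2 * a i * (g.1 i j).re)

/-- `|∇f|(g)`, the Euclidean length of the horizontal (left-invariant) gradient of `f` at `g`. -/
def gradNorm (f : Heis l k → ℝ) (g : Heis l k) : ℝ :=
  Real.sqrt (∑ i, ∑ j, ((Xvf l k a i j f g) ^ 2 + (Yvf l k a i j f g) ^ 2))

/-- The heat kernel `p_h(z,t)` at time `h` of `ℍ(𝒦,𝒜)`, as a complex integral:
`p_h(z,t) = (2(4πh)^{n+1})⁻¹ ∫_ℝ ∏ⱼ (aⱼλ/sinh(aⱼλ))^{kⱼ}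
  exp((4h)⁻¹(iλt − ∑ⱼ |zⱼ|² aⱼλ coth(aⱼλ))) dλ`. -/
def heatKernelC (h : ℝ) (g : Heis l k) : ℂ :=
  (2 * (4 * Real.pi * h) ^ ((∑ i, k i) + 1) : ℂ)⁻¹ *
    ∫ lam : ℝ,
      ((∏ j, ((a j * lam) / Real.sinh (a j * lam)) ^ (k j) : ℝ) : ℂ) *
        Complex.exp ((4 * (h : ℂ))⁻¹ *
          (Complex.I * (lam : ℂ) * (g.2 : ℂ) -
            ∑ j, ((zNormSq l k g.1 j : ℝ) : ℂ) *
              ((a j * lam * (Real.cosh (a j * lam) / Real.sinh (a j * lam)) : ℝ) : ℂ)))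

/-- The (real-valued) heat kernel `p_h` of `ℍ(𝒦,𝒜)`. -/
def heatKernel (h : ℝ) (g : Heis l k) : ℝ := (heatKernelC l k a h g).re

/-- The heat semigroup: `e^{hΔ} f (g) = ∫_ℍ f(g·g′) p_h(g′) dm(g′)`, with `m` the Lebesgue
(Haar) measure on `ℍ(𝒦,𝒜)`. -/
def heatSemigroup (h : ℝ) (f : Heis l k → ℝ) (g : Heis l k) : ℝ :=
  ∫ g' : Heis l k, f (hmul l k a g g') * heatKernel l k a h g'

/-- `μ(ω) = (2ω − sin 2ω)/(2 sin²ω)`; note that at `ω = 0` Lean's convention `0/0 = 0`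
gives exactly the continuous extension `μ(0) = 0`. -/
def muF (ω : ℝ) : ℝ := (2 * ω - Real.sin (2 * ω)) / (2 * Real.sin ω ^ 2)

/-- `x / sin x`, extended continuously by `1` at `x = 0`. -/
def sdiv (x : ℝ) : ℝ := if x = 0 then 1 else x / Real.sin x

/-- The angle `θ(z,t) ∈ (−π,π)` solving `t = ∑ⱼ aⱼ μ(aⱼθ)|zⱼ|²`, chosen by the epsilon
operator (whenever a solution exists it is unique, and `thetaOf` is that solution). -/
def thetaOf (g : Heis l k) : ℝ :=
  Classical.epsilon fun θ : ℝ => θ ∈ Set.Ioo (-Real.pi) Real.pi ∧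
    g.2 = ∑ j, a j * muF (a j * θ) * zNormSq l k g.1 j

/-- The squared Carnot–Carathéodory distance from `g = (z,t)` to the origin:
if `z_l ≠ 0`, or `z_l = 0` and `|t| < ∑_{j<l} aⱼ μ(aⱼπ)|zⱼ|²`, it is
`∑ⱼ (aⱼθ/sin(aⱼθ))² |zⱼ|²` with `θ = θ(z,t)`; otherwise it is
`π(|t| + ∑_{j<l} aⱼ cot(aⱼπ)|zⱼ|²)`. -/
def ccDistSq (g : Heis l k) : ℝ :=
  if g.1 (Fin.last l) ≠ 0 ∨
      |g.2| < ∑ j ∈ Finset.univ.erase (Fin.last l),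
        a j * muF (a j * Real.pi) * zNormSq l k g.1 j then
    ∑ j, (sdiv (a j * thetaOf l k a g)) ^ 2 * zNormSq l k g.1 j
  else
    Real.pi * (|g.2| + ∑ j ∈ Finset.univ.erase (Fin.last l),
      a j * (Real.cos (a j * Real.pi) / Real.sin (a j * Real.pi)) * zNormSq l k g.1 j)

/-- The Carnot–Carathéodory distance from `g` to the origin. -/
def ccDist (g : Heis l k) : ℝ := Real.sqrt (ccDistSq l k a g)

/-- The Carnot–Carathéodory unit ball `B` of `ℍ(𝒦,𝒜)`. -/
def ballCC : Set (Heis l k) := {g | ccDist l k a g < 1}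

/-- `m_f`, the mean of `f` over the Carnot–Carathéodory unit ball. -/
def meanB (f : Heis l k → ℝ) : ℝ :=
  (∫ g in ballCC l k a, f g) / (volume (ballCC l k a)).toReal

/-- The polar coordinates map
`Ψ(u,η) = ((1−e^{−2ia₁η})u₁, …, (1−e^{−2ia_lη})u_l, ∑ⱼ 2aⱼ|uⱼ|²(2aⱼη − sin(2aⱼη)))`. -/
def Psi (u : (i : Fin (l + 1)) → Fin (k i) → ℂ) (η : ℝ) : Heis l k :=
  (fun i => fun j => (1 - Complex.exp (-(2 * Complex.I * (a i : ℂ) * (η : ℂ)))) * u i j,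
    ∑ j, 2 * a j * zNormSq l k u j * (2 * a j * η - Real.sin (2 * a j * η)))

/-- `U = (4 ∑ⱼ aⱼ²|uⱼ|²)^{1/2}`. -/
def Ufun (u : (i : Fin (l + 1)) → Fin (k i) → ℂ) : ℝ :=
  Real.sqrt (4 * ∑ j, (a j) ^ 2 * zNormSq l k u j)

/-- The Jacobian determinant `J(u,η)` of `Ψ` at `(u,η)` (the determinant of the total
derivative of `Ψ` as a map of the real vector space `ℍ ≅ ℝ^{2n+1}`). -/
def jacPsi (u : (i : Fin (l + 1)) → Fin (k i) → ℂ) (η : ℝ) : ℝ :=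
  LinearMap.det
    ((fderiv ℝ (fun q : Heis l k => Psi l k a q.1 q.2) (u, η)) : Heis l k →ₗ[ℝ] Heis l k)


/-- Multiplicative form of log-concavity (Polya frequency of order two). -/
def PF2 (f : ℝ → ℝ) : Prop :=
  (∀ x, 0 ≤ f x) ∧ ∀ x y d : ℝ, 0 ≤ d → d ≤ y - x → f x * f y ≤ f (x + d) * f (y - d)

lemma integral_cauchy_binet (α β γ κ : ℝ → ℝ)
    (h1 : Integrable (fun s => α s * γ s)) (h2 : Integrable (fun s => β s * κ s))
    (h3 : Integrable (fun s => α s * κ s)) (h4 : Integrable (fun s => β s * γ s))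
    (hp : ∀ s r, 0 ≤ (α s * β r - α r * β s) * (γ s * κ r - γ r * κ s)) :
    (∫ s, α s * κ s) * (∫ s, β s * γ s) ≤ (∫ s, α s * γ s) * (∫ s, β s * κ s) := by
  have i1 := h1.mul_prod h2
  have i2 := h3.mul_prod h4
  have i3 := h4.mul_prod h3
  have i4 := h2.mul_prod h1
  have key : 0 ≤ ∫ z : ℝ × ℝ, (((α z.1 * γ z.1) * (β z.2 * κ z.2)
      - (α z.1 * κ z.1) * (β z.2 * γ z.2)) - (β z.1 * γ z.1) * (α z.2 * κ z.2))
      + (β z.1 * κ z.1) * (α z.2 * γ z.2) ∂(volume.prod volume) := by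
    apply integral_nonneg
    intro z
    have := hp z.1 z.2
    simp only [Pi.zero_apply]
    nlinarith [this]
  rw [integral_add (by exact (i1.sub i2).sub i3) i4, integral_sub (by exact i1.sub i2) i3,
    integral_sub i1 i2] at key
  have e1 := integral_prod_mul (μ := volume) (ν := volume) (fun s => α s * γ s) (fun s => β s * κ s)
  have e2 := integral_prod_mul (μ := volume) (ν := volume) (fun s => α s * κ s) (fun s => β s * γ s)
  have e3 := integral_prod_mul (μ := volume) (ν := volume) (fun s => β s * γ s) (fun s => α s * κ s)
  have e4 := integral_prod_mul (μ := volume) (ν := volume) (fun s => β s * κ s) (fun s => α s * γ s)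
  rw [e1, e2, e3, e4] at key
  nlinarith [key]

lemma PF2.four {f : ℝ → ℝ} (hf : PF2 f) {p q r s : ℝ} (h1 : p ≤ q) (h2 : q ≤ s)
    (h : p + s = q + r) : f p * f s ≤ f q * f r := by
  have := hf.2 p s (q - p) (by linarith) (by linarith)
  rwa [show p + (q - p) = q by ring, show s - (q - p) = r by linarith] at this

/-- Convolution of real functions on the line. -/
def cv (f g : ℝ → ℝ) (x : ℝ) : ℝ := ∫ s, f (x - s) * g s

lemma cv_shift (f g : ℝ → ℝ) (x d : ℝ) : cv f g (x - d) = ∫ s, f (x - s) * g (s - d) := by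
  unfold cv
  rw [← integral_sub_right_eq_self (fun s => f (x - d - s) * g s) d]
  congr 1; ext s; congr 2; ring

lemma PF2.cv {f g : ℝ → ℝ} (hf : PF2 f) (hg : PF2 g)
    (hIntg : ∀ x d, Integrable (fun s => f (x - s) * g (s - d))) : PF2 (cv f g) := by
  refine ⟨fun x => integral_nonneg fun s => mul_nonneg (hf.1 _) (hg.1 _), ?_⟩
  intro x y d hd hdy
  have e1 : _root_.cv f g x = ∫ s, f (x + d - s) * g (s - d) := by
    rw [← cv_shift]; congr 1; ring
  have e2 : _root_.cv f g (y - d) = ∫ s, f (y - s) * g (s - d) := cv_shift f g y d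
  rw [e1, e2]
  have h0 : ∀ x, Integrable (fun s => f (x - s) * g s) := fun x => by simpa using hIntg x 0
  refine integral_cauchy_binet (fun s => f (x + d - s)) (fun s => f (y - s)) g (fun s => g (s - d))
    (h0 _) (hIntg _ _) (hIntg _ _) (h0 _) ?_
  intro s r
  rcases le_total s r with h | h
  · refine mul_nonneg ?_ ?_
    · have := hf.four (p := x + d - r) (q := x + d - s) (r := y - r) (s := y - s)
        (by linarith) (by linarith) (by ring)
      linarith
    · have := hg.four (p := s - d) (q := s) (r := r - d) (s := r)
        (by linarith) (by linarith) (by ring)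
      linarith
  · refine mul_nonneg_of_nonpos_of_nonpos ?_ ?_
    · have := hf.four (p := x + d - s) (q := x + d - r) (r := y - s) (s := y - r)
        (by linarith) (by linarith) (by ring)
      linarith
    · have := hg.four (p := r - d) (q := r) (r := s - d) (s := s)
        (by linarith) (by linarith) (by ring)
      linarith

lemma PF2.tilt {f : ℝ → ℝ} (hf : PF2 f) (θ : ℝ) : PF2 (fun x => f x * Real.exp (θ * x)) := by
  refine ⟨fun x => mul_nonneg (hf.1 x) (Real.exp_pos _).le, fun x y d hd hdy => ?_⟩
  have e : Real.exp (θ * (x + d)) * Real.exp (θ * (y - d)) = Real.exp (θ * x) * Real.exp (θ * y) := by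
    rw [← Real.exp_add, ← Real.exp_add]; congr 1; ring
  have := mul_le_mul_of_nonneg_right (hf.2 x y d hd hdy)
    (mul_pos (Real.exp_pos (θ * x)) (Real.exp_pos (θ * y))).le
  calc _ = f x * f y * (Real.exp (θ * x) * Real.exp (θ * y)) := by ring
    _ ≤ _ := this
    _ = f (x + d) * f (y - d) * (Real.exp (θ * (x + d)) * Real.exp (θ * (y - d))) := by rw [e]
    _ = _ := by ring

lemma PF2.refl {f : ℝ → ℝ} (hf : PF2 f) : PF2 (fun x => f (-x)) := by
  refine ⟨fun x => hf.1 _, fun x y d hd hdy => ?_⟩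
  have := hf.2 (-y) (-x) d hd (by linarith)
  rw [show -y + d = -(y - d) by ring, show -x - d = -(x + d) by ring] at this
  simp only; linarith

lemma PF2.shift {f : ℝ → ℝ} (hf : PF2 f) (m : ℝ) : PF2 (fun x => f (m + x)) := by
  refine ⟨fun x => hf.1 _, fun x y d hd hdy => ?_⟩
  have := hf.2 (m + x) (m + y) d hd (by linarith)
  rw [show m + x + d = m + (x + d) by ring, show m + y - d = m + (y - d) by ring] at this
  exact this

lemma PF2.smul {f : ℝ → ℝ} (hf : PF2 f) {c : ℝ} (hc : 0 ≤ c) : PF2 (fun x => c * f x) := by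
  refine ⟨fun x => mul_nonneg hc (hf.1 _), fun x y d hd hdy => ?_⟩
  have := mul_le_mul_of_nonneg_left (hf.2 x y d hd hdy) (mul_nonneg hc hc)
  simp only; nlinarith

lemma setIntegral_Ioi_shift (f : ℝ → ℝ) (E : ℝ) :
    ∫ x in Set.Ioi (0:ℝ), f (x - E) = ∫ x in Set.Ioi (-E), f x := by
  have := (measurePreserving_sub_right volume E).setIntegral_preimage_emb
    (measurableEmbedding_subRight E) f (Set.Ioi (-E))
  rw [← this]
  congr 2
  ext x; simp

/-- On a bounded-below window the ratio argument: if `g(-D) ≥ g` on `[-D,0]`, `g` is antitone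
on `[-D,0]`. -/
lemma PF2.anti {g : ℝ → ℝ} (hg : PF2 g) {D : ℝ} (hpos : 0 < g (-D))
    (hmax : ∀ x ∈ Set.Icc (-D) 0, g x ≤ g (-D)) {x y : ℝ} (hx : -D ≤ x) (hxy : x ≤ y)
    (hy : y ≤ 0) : g y ≤ g x := by
  have h := hg.four (p := -D) (q := -D + (y - x)) (r := x) (s := y) (by linarith) (by linarith)
    (by ring)
  have h2 := hmax (-D + (y - x)) ⟨by linarith, by linarith⟩
  have h3 : g (-D + (y - x)) * g x ≤ g (-D) * g x := mul_le_mul_of_nonneg_right h2 (hg.1 x)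
  exact le_of_mul_le_mul_left (h.trans h3) hpos

lemma PF2.le_four_left {g : ℝ → ℝ} (hg : PF2 g) (hc : Continuous g) (hi : Integrable g)
    (hi1 : Integrable (fun x => x * g x)) (h1 : ∫ x, x * g x = 0)
    {D : ℝ} (hD : 0 ≤ D) : g (-D) ≤ 4 * g 0 := by
  by_contra hcon
  push Not at hcon
  -- maximum over the compact window
  obtain ⟨x0, hx0, hmax⟩ := isCompact_Icc.exists_isMaxOn (s := Set.Icc (-D) 0)
    ⟨0, by simp [hD]⟩ hc.continuousOn
  obtain ⟨E, rfl⟩ : ∃ E, x0 = -E := ⟨-x0, by ring⟩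
  have hE0 : 0 ≤ E := by have := hx0.2; linarith
  have hK : 4 * g 0 < g (-E) := hcon.trans_le (hmax ⟨le_rfl, by linarith⟩)
  have hpos : 0 < g (-E) := lt_of_le_of_lt (by have := hg.1 0; positivity) hK
  have hEpos : 0 < E := by
    rcases hE0.lt_or_eq with h | h
    · exact h
    · rw [← h, neg_zero] at hK hpos; linarith
  have hmaxE : ∀ x ∈ Set.Icc (-E) 0, g x ≤ g (-E) := fun x hx =>
    hmax ⟨hx0.1.trans hx.1, hx.2⟩
  have hanti : ∀ x y, -E ≤ x → x ≤ y → y ≤ 0 → g y ≤ g x := fun x y h1 h2 h3 =>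
    hg.anti hpos hmaxE h1 h2 h3
  -- decay on the right
  have hdec : ∀ s, 0 ≤ s → 4 * g s ≤ g (s - E) := by
    intro s hs
    have h := hg.four (p := -E) (q := 0) (r := s - E) (s := s) (by linarith) hs (by ring)
    rcases (hg.1 0).lt_or_eq with h0 | h0
    · have : 4 * g 0 * g s ≤ g (-E) * g s := mul_le_mul_of_nonneg_right hK.le (hg.1 s)
      have : g 0 * (4 * g s) ≤ g 0 * g (s - E) := by linarith
      exact le_of_mul_le_mul_left this h0
    · rw [← h0, zero_mul] at h
      have hs0 : g s = 0 := le_antisymm (by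
        by_contra hh; push Not at hh; have := mul_pos hpos hh; linarith) (hg.1 s)
      rw [hs0]; simpa using hg.1 (s - E)
  -- integrals
  set A := ∫ x in Set.Ioi (0:ℝ), x * g x with hA
  set P := ∫ x in Set.Ioi (0:ℝ), g x with hP
  set Q := ∫ x in Set.Ioc (-E) 0, g x with hQ
  have hQpos : 0 < Q := by
    have : 0 < ∫ x in (-E)..0, g x := by
      apply intervalIntegral.integral_pos (by linarith) hc.continuousOn (fun x _ => hg.1 x)
      exact ⟨-E, ⟨le_rfl, by linarith⟩, hpos⟩
    rwa [intervalIntegral.integral_of_le (by linarith)] at this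
  have hsplit : ∀ f : ℝ → ℝ, Integrable f → ∫ x in Set.Ioi (-E), f x
      = (∫ x in Set.Ioc (-E) 0, f x) + ∫ x in Set.Ioi (0:ℝ), f x := by
    intro f hf
    rw [← setIntegral_union (Set.Ioc_disjoint_Ioi le_rfl) measurableSet_Ioi hf.integrableOn
      hf.integrableOn, Set.Ioc_union_Ioi_eq_Ioi (by linarith)]
  have hsh : ∀ f : ℝ → ℝ, ∫ x in Set.Ioi (0:ℝ), f (x - E) = ∫ x in Set.Ioi (-E), f x := by
    intro f
    exact setIntegral_Ioi_shift f E
  have hshi : Integrable (fun x => g (x - E)) := hi.comp_sub_right E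
  have hshi1 : Integrable (fun x => x * g (x - E)) := by
    have := (hi1.comp_sub_right E).add (hshi.const_mul E)
    refine this.congr (ae_of_all _ fun x => ?_)
    simp only [Pi.add_apply]; ring
  have hP1 : 4 * P ≤ Q + P := by
    have : ∫ x in Set.Ioi (0:ℝ), 4 * g x ≤ ∫ x in Set.Ioi (0:ℝ), g (x - E) :=
      setIntegral_mono_on (hi.const_mul 4).integrableOn hshi.integrableOn measurableSet_Ioi
        (fun s hs => hdec s (le_of_lt hs))
    rw [integral_const_mul, hsh g, hsplit g hi] at this
    exact this
  have hx1 : ∫ x in Set.Ioc (-E) 0, x * g x ≤ -(E / 2) * Q := by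
    have : ∫ x in Set.Ioc (-E) 0, (x * g x + (E / 2) * g x) ≤
        ∫ x in Set.Ioc (-E) 0, (x + E / 2) * g (-(E / 2)) := by
      apply setIntegral_mono_on (hi1.add (hi.const_mul _)).integrableOn _ measurableSet_Ioc
      · intro x hx
        rcases le_total x (-(E / 2)) with h | h
        · have := hanti x (-(E / 2)) hx.1.le h (by linarith)
          simp only [Pi.add_apply]; nlinarith
        · have := hanti (-(E / 2)) x (by linarith) h hx.2
          simp only [Pi.add_apply]; nlinarith
      · apply Continuous.integrableOn_Ioc; fun_prop
    rw [integral_add hi1.integrableOn (hi.const_mul _).integrableOn, integral_const_mul] at this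
    have e : ∫ x in Set.Ioc (-E) 0, (x + E / 2) * g (-(E / 2)) = 0 := by
      rw [← intervalIntegral.integral_of_le (by linarith), intervalIntegral.integral_mul_const,
        intervalIntegral.integral_add (by simp) (by simp)]
      simp
      left; ring
    rw [e] at this
    linarith
  have hA1 : 4 * A ≤ A + E * P + E * Q := by
    have : ∫ x in Set.Ioi (0:ℝ), 4 * (x * g x) ≤ ∫ x in Set.Ioi (0:ℝ), x * g (x - E) :=
      setIntegral_mono_on (hi1.const_mul 4).integrableOn hshi1.integrableOn measurableSet_Ioi
        (fun s hs => by
          have := mul_le_mul_of_nonneg_left (hdec s (le_of_lt hs)) (le_of_lt hs); linarith)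
    have e2 : ∫ x in Set.Ioi (0:ℝ), x * g (x - E) = ∫ x in Set.Ioi (-E), (x * g x + E * g x) := by
      rw [← hsh (fun x => x * g x + E * g x)]
      congr 1; ext x; ring
    rw [integral_const_mul, e2, hsplit _ (by exact hi1.add (hi.const_mul E)),
      integral_add hi1.integrableOn (hi.const_mul E).integrableOn,
      integral_add hi1.integrableOn (hi.const_mul E).integrableOn,
      integral_const_mul, integral_const_mul] at this
    have h3 : ∫ x in Set.Ioc (-E) 0, x * g x ≤ 0 := by nlinarith
    linarith
  have hA2 : E / 2 * Q ≤ A := by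
    have e : (∫ x in Set.Iic (-E), x * g x) + ∫ x in Set.Ioi (-E), x * g x = 0 := by
      rw [← h1]
      exact intervalIntegral.integral_Iic_add_Ioi hi1.integrableOn hi1.integrableOn
    rw [hsplit _ hi1] at e
    have h3 : ∫ x in Set.Iic (-E), x * g x ≤ 0 := by
      apply setIntegral_nonpos measurableSet_Iic
      intro x hx
      exact mul_nonpos_of_nonpos_of_nonneg (by have : x ≤ -E := hx; linarith) (hg.1 x)
    linarith
  nlinarith [mul_pos hEpos hQpos]

lemma PF2.le_four {g : ℝ → ℝ} (hg : PF2 g) (hc : Continuous g) (hi : Integrable g)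
    (hi1 : Integrable (fun x => x * g x)) (h1 : ∫ x, x * g x = 0) (x : ℝ) : g x ≤ 4 * g 0 := by
  rcases le_total x 0 with h | h
  · have := hg.le_four_left hc hi hi1 h1 (D := -x) (by linarith)
    rwa [neg_neg] at this
  · have hi1' : Integrable (fun x => x * g (-x)) := by
      refine (hi1.comp_neg.neg).congr (ae_of_all _ fun x => ?_)
      simp
    have := hg.refl.le_four_left (by fun_prop) hi.comp_neg hi1' (by
      have := integral_neg_eq_self (fun x => x * g x) volume
      rw [h1] at this
      rw [← neg_eq_zero, ← integral_neg, ← this]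
      congr 1; ext x; ring) (D := x) h
    simpa using this

/-- Lower and upper bounds at the mean for a centred log-concave density. -/
lemma PF2.bounds {g : ℝ → ℝ} (hg : PF2 g) (hc : Continuous g) (hi : Integrable g)
    (hi1 : Integrable (fun x => x * g x)) (hi2 : Integrable (fun x => x ^ 2 * g x))
    (h0 : ∫ x, g x = 1) (h1 : ∫ x, x * g x = 0) {V : ℝ} (hV : 0 < V)
    (h2 : ∫ x, x ^ 2 * g x = V) :
    1 ≤ 32 * Real.sqrt V * g 0 ∧ g 0 * Real.sqrt V ≤ 36 := by
  have h4 := hg.le_four hc hi hi1 h1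
  set σ := Real.sqrt V with hσ
  have hσ0 : 0 < σ := Real.sqrt_pos.2 hV
  have hσ2 : σ ^ 2 = V := Real.sq_sqrt hV.le
  have hlow : 1 ≤ 32 * σ * g 0 := by
    have e : (1:ℝ) = ∫ x, g x := h0.symm
    have : ∫ x, g x ≤ ∫ x, ((Set.Icc (-(2 * σ)) (2 * σ)).indicator (fun _ => 4 * g 0) x
        + (4 * V)⁻¹ * (x ^ 2 * g x)) := by
      apply integral_mono hi
      · refine Integrable.add ?_ (hi2.const_mul _)
        rw [integrable_indicator_iff measurableSet_Icc]
        exact integrableOn_const (by simp)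
      · intro x
        simp only
        by_cases hx : x ∈ Set.Icc (-(2 * σ)) (2 * σ)
        · rw [Set.indicator_of_mem hx]
          have : 0 ≤ (4 * V)⁻¹ * (x ^ 2 * g x) := by have := hg.1 x; positivity
          linarith [h4 x]
        · rw [Set.indicator_of_notMem hx, zero_add]
          have hx2 : 4 * V ≤ x ^ 2 := by
            have : 2 * σ ≤ |x| := by
              by_contra hh; push Not at hh
              exact hx ⟨by linarith [(abs_lt.1 hh).1], by linarith [(abs_lt.1 hh).2]⟩
            rw [← hσ2, ← sq_abs x]; nlinarith
          rw [inv_mul_eq_div, le_div_iff₀ (by positivity)]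
          nlinarith [hg.1 x]
    rw [h0, integral_add _ (hi2.const_mul _), integral_const_mul, h2,
      integral_indicator measurableSet_Icc, setIntegral_const] at this
    · have e3 : (4 * V)⁻¹ * V = 1 / 4 := by field_simp
      rw [e3] at this
      simp only [measureReal_def, Real.volume_Icc, smul_eq_mul] at this
      rw [ENNReal.toReal_ofReal (by linarith)] at this
      have := hg.1 0
      nlinarith
    · rw [integrable_indicator_iff measurableSet_Icc]
      exact integrableOn_const (by simp)
  refine ⟨hlow, ?_⟩
  set h := g 0 with hh
  have hpos : 0 < h := by
    by_contra hcon; push Not at hcon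
    nlinarith [hg.1 0]
  -- g r ≤ 4 / r
  have hle1 : ∀ s : Set ℝ, ∫ x in s, g x ≤ 1 := fun s => by
    rw [← h0]; exact setIntegral_le_integral hi (ae_of_all _ hg.1)
  have key : ∀ g' : ℝ → ℝ, PF2 g' → Continuous g' → Integrable g' →
      Integrable (fun x => x ^ 2 * g' x) → (∀ x, g' x ≤ 4 * h) → g' 0 = h →
      (∀ s : Set ℝ, ∫ x in s, g' x ≤ 1) → ∫ x in Set.Ioi (0:ℝ), x ^ 2 * g' x ≤ 10 * (8 / h) ^ 2 := by
    intro g' hg' hc' hi' hi2' hb hz hm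
    set r := 8 / h with hr
    have hrpos : 0 < r := by positivity
    have hgr : g' r ≤ h / 2 := by
      have : ∫ x in Set.Ioc 0 r, (h * g' r) ≤ ∫ x in Set.Ioc 0 r, (4 * h) * g' x := by
        apply setIntegral_mono_on (integrableOn_const (by simp)) (hi'.const_mul _).integrableOn
          measurableSet_Ioc
        intro x hx
        have := hg'.four (p := 0) (q := x) (r := r - x) (s := r) hx.1.le hx.2 (by ring)
        rw [hz] at this
        refine this.trans ?_
        have := mul_le_mul_of_nonneg_left (hb (r - x)) (hg'.1 x)
        linarith
      rw [setIntegral_const, integral_const_mul] at this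
      simp only [measureReal_def, Real.volume_Ioc, smul_eq_mul, sub_zero] at this
      rw [ENNReal.toReal_ofReal hrpos.le] at this
      have h5 := mul_le_mul_of_nonneg_left (hm (Set.Ioc 0 r)) (by positivity : 0 ≤ 4 * h)
      have e : r * (h * g' r) = 8 * g' r := by rw [hr]; field_simp
      rw [e] at this
      linarith
    have hdec : ∀ s, 0 ≤ s → g' (s + r) ≤ 1 / 2 * g' s := by
      intro s hs
      have := hg'.four (p := 0) (q := r) (r := s) (s := s + r) hrpos.le (by linarith) (by ring)
      rw [hz] at this
      have h6 := mul_le_mul_of_nonneg_right hgr (hg'.1 s)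
      have : h * g' (s + r) ≤ h * (1 / 2 * g' s) := by linarith
      exact le_of_mul_le_mul_left this hpos
    set M := ∫ x in Set.Ioi (0:ℝ), x ^ 2 * g' x with hM
    have e1 : M = (∫ x in Set.Ioc 0 r, x ^ 2 * g' x) + ∫ x in Set.Ioi r, x ^ 2 * g' x := by
      rw [← setIntegral_union (Set.Ioc_disjoint_Ioi le_rfl) measurableSet_Ioi hi2'.integrableOn
        hi2'.integrableOn, Set.Ioc_union_Ioi_eq_Ioi hrpos.le]
    have e2 : ∫ x in Set.Ioc 0 r, x ^ 2 * g' x ≤ r ^ 2 := by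
      have : ∫ x in Set.Ioc 0 r, x ^ 2 * g' x ≤ ∫ x in Set.Ioc 0 r, r ^ 2 * g' x := by
        apply setIntegral_mono_on hi2'.integrableOn (hi'.const_mul _).integrableOn measurableSet_Ioc
        intro x hx
        have : x ^ 2 ≤ r ^ 2 := by nlinarith [hx.1, hx.2]
        exact mul_le_mul_of_nonneg_right this (hg'.1 x)
      rw [integral_const_mul] at this
      nlinarith [hm (Set.Ioc 0 r)]
    have e3 : ∫ x in Set.Ioi r, x ^ 2 * g' x ≤ 3 / 4 * M + 3 / 2 * r ^ 2 := by
      have e4 : ∫ x in Set.Ioi r, x ^ 2 * g' x = ∫ x in Set.Ioi (0:ℝ), (x + r) ^ 2 * g' (x + r) := by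
        have := setIntegral_Ioi_shift (fun x => x ^ 2 * g' x) (-r)
        rw [neg_neg] at this
        rw [← this]; simp only [sub_neg_eq_add]
      rw [e4]
      have : ∫ x in Set.Ioi (0:ℝ), (x + r) ^ 2 * g' (x + r) ≤
          ∫ x in Set.Ioi (0:ℝ), (3 / 4 * (x ^ 2 * g' x) + 3 / 2 * r ^ 2 * g' x) := by
        apply setIntegral_mono_on (hi2'.comp_add_right r).integrableOn _ measurableSet_Ioi
        · intro x hx
          have h7 := hdec x (le_of_lt hx)
          have h8 : (x + r) ^ 2 ≤ 3 / 2 * x ^ 2 + 3 * r ^ 2 := by nlinarith [sq_nonneg (x - 2 * r)]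
          have h9 := hg'.1 (x + r)
          have h10 := hg'.1 x
          calc (x + r) ^ 2 * g' (x + r) ≤ (3 / 2 * x ^ 2 + 3 * r ^ 2) * (1 / 2 * g' x) := by
                apply mul_le_mul h8 h7 h9 (by positivity)
            _ = _ := by ring
        · exact ((hi2'.const_mul _).add (hi'.const_mul _)).integrableOn
      rw [integral_add (hi2'.const_mul _).integrableOn (hi'.const_mul _).integrableOn,
        integral_const_mul, integral_const_mul] at this
      have h11 := mul_le_mul_of_nonneg_left (hm (Set.Ioi 0)) (by positivity : 0 ≤ 3 / 2 * r ^ 2)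
      linarith
    linarith
  have k1 := key g hg hc hi hi2 h4 rfl hle1
  have hi2n : Integrable (fun x => x ^ 2 * g (-x)) := by
    have := hi2.comp_neg
    simpa using this
  have k2 := key (fun x => g (-x)) hg.refl (by fun_prop) hi.comp_neg hi2n (fun x => h4 _)
    (by simp [hh]) (fun s => by
      have e : ∫ x, g (-x) = 1 := by rw [integral_neg_eq_self g volume, h0]
      rw [← e]; exact setIntegral_le_integral hi.comp_neg (ae_of_all _ fun x => hg.1 _))
  have e5 : ∫ x in Set.Ioi (0:ℝ), x ^ 2 * g (-x) = ∫ x in Set.Iic (0:ℝ), x ^ 2 * g x := by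
    have := integral_comp_neg_Ioi (0:ℝ) (fun x => x ^ 2 * g x)
    simpa using this
  rw [e5] at k2
  have e6 : (∫ x in Set.Iic (0:ℝ), x ^ 2 * g x) + ∫ x in Set.Ioi (0:ℝ), x ^ 2 * g x = V := by
    rw [← h2]; exact intervalIntegral.integral_Iic_add_Ioi hi2.integrableOn hi2.integrableOn
  have hfin : V ≤ 20 * (8 / h) ^ 2 := by linarith
  have : (h * σ) ^ 2 ≤ 36 ^ 2 := by
    rw [mul_pow, hσ2]
    have : h ^ 2 * V ≤ h ^ 2 * (20 * (8 / h) ^ 2) := by gcongr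
    have e : h ^ 2 * (20 * (8 / h) ^ 2) = 1280 := by field_simp; norm_num
    linarith
  exact abs_le_of_sq_le_sq' this (by norm_num) |>.2

/-- coefficients of the Bessel type series. -/
def bc (i : ℕ) : ℝ := ((Nat.factorial i : ℝ) ^ 2)⁻¹

lemma bc_pos (i : ℕ) : 0 < bc i := by unfold bc; positivity

/-- partial sums -/
def BN (N : ℕ) (x : ℝ) : ℝ := ∑ i ∈ range N, bc i * x ^ i

/-- derivative weights -/
def ew (N i : ℕ) : ℝ := if i + 1 < N then ((i : ℝ) + 1)⁻¹ else 0

lemma ew_anti (N : ℕ) {i j : ℕ} (h : i ≤ j) : ew N j ≤ ew N i := by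
  unfold ew
  split_ifs with h1 h2
  · gcongr
  · omega
  · positivity
  · exact le_rfl

lemma BN_hasDeriv (N : ℕ) (x : ℝ) :
    HasDerivAt (BN N) (∑ i ∈ range N, bc i * ew N i * x ^ i) x := by
  have h : HasDerivAt (BN N) (∑ i ∈ range N, bc i * ((i:ℝ) * x ^ (i - 1))) x := by
    unfold BN
    apply HasDerivAt.fun_sum
    intro i _
    exact (hasDerivAt_pow i x).const_mul _
  convert h using 1
  cases N with
  | zero => simp
  | succ N =>
    rw [sum_range_succ, sum_range_succ']
    simp only [ew]
    simp
    apply sum_congr rfl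
    intro i hi
    rw [if_pos (mem_range.mp hi)]
    unfold bc
    rw [Nat.factorial_succ]
    have : (Nat.factorial i : ℝ) ≠ 0 := by positivity
    push_cast
    field_simp

lemma BN_wr (N : ℕ) {x y : ℝ} (hx : 0 ≤ x) (hxy : x ≤ y) :
    (∑ i ∈ range N, bc i * ew N i * y ^ i) * BN N x ≤
      (∑ i ∈ range N, bc i * ew N i * x ^ i) * BN N y := by
  unfold BN
  rw [sum_mul_sum, sum_mul_sum, ← sub_nonneg, ← sum_sub_distrib]
  simp_rw [← sum_sub_distrib]
  set S := ∑ i ∈ range N, ∑ j ∈ range N, (bc i * ew N i * x ^ i * (bc j * y ^ j)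
    - bc i * ew N i * y ^ i * (bc j * x ^ j)) with hS
  have h2 : S = ∑ i ∈ range N, ∑ j ∈ range N, (bc j * ew N j * x ^ j * (bc i * y ^ i)
    - bc j * ew N j * y ^ j * (bc i * x ^ i)) := by rw [hS, sum_comm]
  have h3 : 0 ≤ S + S := by
    nth_rewrite 2 [h2]
    rw [hS, ← sum_add_distrib]
    apply sum_nonneg; intro i _
    rw [← sum_add_distrib]
    apply sum_nonneg; intro j _
    have e : (bc i * ew N i * x ^ i * (bc j * y ^ j) - bc i * ew N i * y ^ i * (bc j * x ^ j))
      + (bc j * ew N j * x ^ j * (bc i * y ^ i) - bc j * ew N j * y ^ j * (bc i * x ^ i))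
      = bc i * bc j * ((ew N i - ew N j) * (x ^ i * y ^ j - x ^ j * y ^ i)) := by ring
    rw [e]
    apply mul_nonneg (mul_pos (bc_pos i) (bc_pos j)).le
    have hp : ∀ i j : ℕ, i ≤ j → 0 ≤ x ^ i * y ^ j - x ^ j * y ^ i := by
      intro i j hij
      obtain ⟨d, rfl⟩ := Nat.exists_eq_add_of_le hij
      have : x ^ i * y ^ (i + d) - x ^ (i + d) * y ^ i = x ^ i * y ^ i * (y ^ d - x ^ d) := by ring
      rw [this]
      have := pow_le_pow_left₀ hx hxy d
      have hy : 0 ≤ y := hx.trans hxy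
      have := sub_nonneg.mpr this
      positivity
    rcases le_total i j with hij | hij
    · exact mul_nonneg (sub_nonneg.mpr (ew_anti N hij)) (hp i j hij)
    · have h1 := hp j i hij
      have h2 := ew_anti N hij
      nlinarith
  linarith

lemma BN_mono4 (N : ℕ) {x y d : ℝ} (hx : 0 ≤ x) (hd : 0 ≤ d) (hdy : x + d ≤ y - d) :
    BN N x * BN N y ≤ BN N (x + d) * BN N (y - d) := by
  have hderiv : ∀ h : ℝ, HasDerivAt (fun h => BN N (x + h) * BN N (y - h))
      ((∑ i ∈ range N, bc i * ew N i * (x + h) ^ i) * BN N (y - h)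
       + BN N (x + h) * (-(∑ i ∈ range N, bc i * ew N i * (y - h) ^ i))) h := by
    intro h
    have h1 : HasDerivAt (fun h => BN N (x + h)) (∑ i ∈ range N, bc i * ew N i * (x + h) ^ i) h := (BN_hasDeriv N (x + h)).comp_const_add x h
    have h2 : HasDerivAt (fun h => BN N (y - h)) (-(∑ i ∈ range N, bc i * ew N i * (y - h) ^ i)) h := (BN_hasDeriv N (y - h)).comp_const_sub y h
    exact h1.mul h2
  have hm : MonotoneOn (fun h => BN N (x + h) * BN N (y - h)) (Set.Icc 0 d) := by
    apply monotoneOn_of_deriv_nonneg (convex_Icc 0 d)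
    · exact fun h _ => (hderiv h).continuousAt.continuousWithinAt
    · exact fun h _ => (hderiv h).differentiableAt.differentiableWithinAt
    · intro h hh
      rw [interior_Icc] at hh
      rw [(hderiv h).deriv]
      have := BN_wr N (x := x + h) (y := y - h) (by linarith [hh.1]) (by linarith [hh.2])
      linarith
  have := hm (Set.left_mem_Icc.mpr hd) (Set.right_mem_Icc.mpr hd) hd
  simpa using this

/-- The Bessel type series. -/
def BB (x : ℝ) : ℝ := ∑' i, bc i * x ^ i

lemma BB_term_le {δ : ℝ} (hδ : 0 < δ) {x : ℝ} (hx : 0 ≤ x) (i : ℕ) :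
    bc i * x ^ i ≤ Real.exp (δ⁻¹) * ((δ * x) ^ i / (Nat.factorial i : ℝ)) := by
  have h1 : (δ⁻¹) ^ i / (Nat.factorial i : ℝ) ≤ Real.exp (δ⁻¹) :=
    Real.pow_div_factorial_le_exp _ (by positivity) i
  have h2 : bc i * x ^ i = (δ⁻¹) ^ i / (Nat.factorial i : ℝ) * ((δ * x) ^ i / (Nat.factorial i : ℝ)) := by
    unfold bc
    rw [mul_pow, inv_pow]; field_simp
  rw [h2]
  gcongr

lemma BB_summable {x : ℝ} (hx : 0 ≤ x) : Summable (fun i => bc i * x ^ i) := by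
  refine Summable.of_nonneg_of_le (fun i => ?_) (fun i => BB_term_le one_pos hx i) ?_
  · have := bc_pos i; positivity
  · exact (Real.summable_pow_div_factorial _).mul_left _

lemma BB_le {δ : ℝ} (hδ : 0 < δ) {x : ℝ} (hx : 0 ≤ x) :
    BB x ≤ Real.exp (δ⁻¹) * Real.exp (δ * x) := by
  unfold BB
  have h : Real.exp (δ * x) = ∑' i, (δ * x) ^ i / (Nat.factorial i : ℝ) := by
    rw [Real.exp_eq_exp_ℝ, NormedSpace.exp_eq_tsum_div]
  rw [h, ← tsum_mul_left]
  exact (BB_summable hx).tsum_le_tsum (fun i => BB_term_le hδ hx i)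
    ((Real.summable_pow_div_factorial _).mul_left _)

lemma BB_nonneg {x : ℝ} (hx : 0 ≤ x) : 0 ≤ BB x :=
  tsum_nonneg fun i => by have := bc_pos i; positivity

lemma BN_tendsto {x : ℝ} (hx : 0 ≤ x) : Tendsto (fun N => BN N x) atTop (𝓝 (BB x)) :=
  (BB_summable hx).hasSum.tendsto_sum_nat

lemma BB_mono4 {x y d : ℝ} (hx : 0 ≤ x) (hd : 0 ≤ d) (hdy : x + d ≤ y - d) :
    BB x * BB y ≤ BB (x + d) * BB (y - d) := by
  have := le_of_tendsto_of_tendsto'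
    ((BN_tendsto hx).mul (BN_tendsto (x := y) (by linarith)))
    ((BN_tendsto (x := x + d) (by linarith)).mul (BN_tendsto (x := y - d) (by linarith)))
    (fun N => BN_mono4 N hx hd hdy)
  exact this

/-- one sided piece -/
def pc (b c : ℝ) (s : ℝ) : ℝ := if 0 < s then b * Real.exp (-b * s - c) * BB (b * c * s) else 0

lemma pc_PF2 {b c : ℝ} (hb : 0 < b) (hc : 0 ≤ c) : PF2 (pc b c) := by
  have hnn : ∀ x, 0 ≤ pc b c x := by
    intro x; unfold pc
    split_ifs with h
    · have := BB_nonneg (x := b * c * x) (by positivity)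
      positivity
    · exact le_rfl
  refine ⟨hnn, ?_⟩
  have key : ∀ x y d : ℝ, 0 ≤ d → x + d ≤ y - d → pc b c x * pc b c y ≤ pc b c (x + d) * pc b c (y - d) := by
    intro x y d hd hdy
    by_cases hx : 0 < x
    · have h1 : 0 < y := by linarith
      have h2 : 0 < x + d := by linarith
      have h3 : 0 < y - d := by linarith
      unfold pc
      rw [if_pos hx, if_pos h1, if_pos h2, if_pos h3]
      have hm := BB_mono4 (x := b * c * x) (y := b * c * y) (d := b * c * d) (by positivity)
        (by positivity) (by nlinarith [mul_nonneg hb.le hc])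
      rw [show b * c * x + b * c * d = b * c * (x + d) by ring,
        show b * c * y - b * c * d = b * c * (y - d) by ring] at hm
      have e : Real.exp (-b * x - c) * Real.exp (-b * y - c)
        = Real.exp (-b * (x + d) - c) * Real.exp (-b * (y - d) - c) := by
        rw [← Real.exp_add, ← Real.exp_add]; congr 1; ring
      calc _ = b ^ 2 * (Real.exp (-b * x - c) * Real.exp (-b * y - c)) * (BB (b * c * x) * BB (b * c * y)) := by ring
        _ ≤ b ^ 2 * (Real.exp (-b * x - c) * Real.exp (-b * y - c)) * (BB (b * c * (x + d)) * BB (b * c * (y - d))) := by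
          gcongr
        _ = _ := by rw [e]; ring
    · have : pc b c x = 0 := by unfold pc; rw [if_neg hx]
      rw [this, zero_mul]
      exact mul_nonneg (hnn _) (hnn _)
  intro x y d hd hdy
  rcases le_total (x + d) (y - d) with h | h
  · exact key x y d hd h
  · have := key x y (y - x - d) (by linarith) (by linarith)
    rw [show x + (y - x - d) = y - d by ring, show y - (y - x - d) = x + d by ring] at this
    linarith

lemma pc_meas (b c : ℝ) (hb : 0 < b) (hc : 0 ≤ c) : Measurable (pc b c) := by
  have : ∀ N : ℕ, Measurable (fun s => if 0 < s then b * Real.exp (-b * s - c) * BN N (b * c * s) else 0) := by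
    intro N
    refine Measurable.ite measurableSet_Ioi ?_ measurable_const
    unfold BN
    fun_prop
  refine measurable_of_tendsto_metrizable this ?_
  rw [tendsto_pi_nhds]
  intro s
  unfold pc
  by_cases hs : 0 < s
  · simp only [if_pos hs]
    exact (BN_tendsto (by positivity)).const_mul _
  · simp only [if_neg hs]; exact tendsto_const_nhds

lemma pc_int {b c : ℝ} (hb : 0 < b) (hc : 0 ≤ c) {θ : ℝ} (hθ : θ < b) :
    Integrable (fun s => pc b c s * Real.exp (θ * s)) := by
  obtain ⟨δ, hδ, hδ2⟩ : ∃ δ : ℝ, 0 < δ ∧ δ * (b * c) < (b - θ) := by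
    refine ⟨(b - θ) / (b * c + 1), div_pos (by linarith) (by positivity), ?_⟩
    rw [div_mul_eq_mul_div, div_lt_iff₀ (by positivity)]
    nlinarith
  have h1 : IntegrableOn (fun s => b * Real.exp (δ⁻¹) * Real.exp (-(b - θ - δ * (b * c)) * s)) (Set.Ioi 0) :=
    (integrableOn_exp_mul_Ioi (by linarith) 0).const_mul _
  rw [← integrable_indicator_iff measurableSet_Ioi] at h1
  refine h1.mono' ((pc_meas b c hb hc).mul (by fun_prop)).aestronglyMeasurable ?_
  refine Eventually.of_forall fun s => ?_
  rw [Real.norm_of_nonneg (mul_nonneg ((pc_PF2 hb hc).1 s) (Real.exp_pos _).le)]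
  unfold pc Set.indicator
  by_cases hs : 0 < s
  · rw [if_pos hs, if_pos (by exact hs)]
    have hB := BB_le hδ (x := b * c * s) (by positivity)
    calc _ ≤ b * Real.exp (-b * s - c) * (Real.exp (δ⁻¹) * Real.exp (δ * (b * c * s))) * Real.exp (θ * s) := by gcongr
      _ = b * Real.exp (δ⁻¹) * Real.exp (-(b - θ - δ * (b * c)) * s) * Real.exp (-c) := by
        have : Real.exp (-b * s - c) * Real.exp (δ * (b * c * s)) * Real.exp (θ * s) =
          Real.exp (-(b - θ - δ * (b * c)) * s) * Real.exp (-c) := by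
          simp only [← Real.exp_add]; congr 1; ring
        linear_combination b * Real.exp (δ⁻¹) * this
      _ ≤ _ := by
        apply mul_le_of_le_one_right (by positivity)
        rw [Real.exp_le_one_iff]; linarith
  · rw [if_neg hs, if_neg (by exact hs)]; simp

lemma intOn_pow_mul_exp (m : ℕ) {r : ℝ} (hr : 0 < r) :
    IntegrableOn (fun s : ℝ => s ^ m * Real.exp (-r * s)) (Set.Ioi 0) := by
  have := integrableOn_rpow_mul_exp_neg_mul_rpow (s := m) (p := 1) (b := r)
    (by linarith [Nat.cast_nonneg (α := ℝ) m]) one_pos hr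
  simpa [Real.rpow_natCast] using this

lemma intOn_pow_mul_cexp (m : ℕ) {r : ℂ} (hr : 0 < r.re) :
    IntegrableOn (fun s : ℝ => (s:ℂ) ^ m * cexp (-r * s)) (Set.Ioi 0) := by
  refine (intOn_pow_mul_exp m hr).mono' (by fun_prop) ?_
  refine (ae_restrict_iff' measurableSet_Ioi).mpr (Eventually.of_forall fun s hs => ?_)
  have hs : 0 < s := hs
  rw [norm_mul, norm_pow, Complex.norm_real, Complex.norm_exp, Real.norm_of_nonneg hs.le]
  simp

lemma int_pow_mul_cexp (m : ℕ) {r : ℂ} (hr : 0 < r.re) :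
    ∫ s in Set.Ioi (0:ℝ), (s:ℂ) ^ m * cexp (-r * s) = (Nat.factorial m : ℂ) / r ^ (m + 1) := by
  have hr0 : r ≠ 0 := by rintro rfl; simp at hr
  induction m with
  | zero =>
    have := integral_exp_mul_complex_Ioi (a := -r) (by simpa using hr) 0
    simp only [pow_zero, one_mul]
    rw [this]; simp
  | succ m ih =>
    have h := integral_Ioi_of_hasDerivAt_of_tendsto (a := 0) (m := 0)
      (f := fun s : ℝ => (s:ℂ) ^ (m + 1) * cexp (-r * s))
      (f' := fun s : ℝ => ((m:ℂ) + 1) * ((s:ℂ) ^ m * cexp (-r * s)) - r * ((s:ℂ) ^ (m + 1) * cexp (-r * s)))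
      (by fun_prop) ?_ ?_ ?_
    · rw [integral_sub ((intOn_pow_mul_cexp m hr).const_mul _) ((intOn_pow_mul_cexp (m+1) hr).const_mul _),
        integral_const_mul, integral_const_mul, ih] at h
      simp at h
      rw [Nat.factorial_succ, eq_div_iff (by positivity)]
      rw [sub_eq_zero] at h
      simp only [neg_mul]
      push_cast
      rw [pow_succ r (m+1)]
      calc _ = (r * ∫ (a : ℝ) in Set.Ioi 0, (a:ℂ) ^ (m + 1) * cexp (-(r * ↑a))) * r ^ (m + 1) := by ring
        _ = _ := by rw [← h]; field_simp
    · intro s _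
      have h1 : HasDerivAt (fun s : ℝ => (s:ℂ) ^ (m + 1)) (((m:ℂ) + 1) * (s:ℂ) ^ m) s := by
        have := ((hasDerivAt_id (s:ℂ)).pow (m + 1)).comp_ofReal
        simpa using this
      have h2 : HasDerivAt (fun s : ℝ => cexp (-r * s)) (cexp (-r * s) * (-r)) s := by
        have : HasDerivAt (fun s : ℝ => -r * (s:ℂ)) (-r) s := by
          have := ((hasDerivAt_id (s:ℂ)).const_mul (-r)).comp_ofReal
          simpa using this
        exact this.cexp
      have h3 := h1.mul h2
      have e : ((m:ℂ) + 1) * (s:ℂ) ^ m * cexp (-r * s) + (s:ℂ) ^ (m + 1) * (cexp (-r * s) * (-r))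
        = ((m:ℂ) + 1) * ((s:ℂ) ^ m * cexp (-r * s)) - r * ((s:ℂ) ^ (m + 1) * cexp (-r * s)) := by ring
      rw [e] at h3
      exact h3
    · exact ((intOn_pow_mul_cexp m hr).const_mul _).sub ((intOn_pow_mul_cexp (m+1) hr).const_mul _)
    · rw [tendsto_zero_iff_norm_tendsto_zero]
      have := tendsto_rpow_mul_exp_neg_mul_atTop_nhds_zero (m + 1 : ℕ) r.re hr
      refine this.congr' ?_
      filter_upwards [eventually_gt_atTop 0] with s hs
      rw [norm_mul, norm_pow, Complex.norm_real, Complex.norm_exp, Real.norm_of_nonneg hs.le,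
        Real.rpow_natCast]
      simp

lemma int_pow_mul_exp (m : ℕ) {r : ℝ} (hr : 0 < r) :
    ∫ s in Set.Ioi (0:ℝ), s ^ m * Real.exp (-r * s) = (Nat.factorial m : ℝ) / r ^ (m + 1) := by
  have := int_pow_mul_cexp m (r := (r:ℂ)) (by simpa using hr)
  have h2 : ∫ s in Set.Ioi (0:ℝ), (s:ℂ) ^ m * cexp (-(r:ℂ) * s)
     = ((∫ s in Set.Ioi (0:ℝ), s ^ m * Real.exp (-r * s) : ℝ) : ℂ) := by
    rw [← integral_complex_ofReal]
    congr 1; ext s; push_cast; rfl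
  rw [h2] at this
  exact_mod_cast this

lemma pc_tr {b c : ℝ} (hb : 0 < b) (hc : 0 ≤ c) {ζ : ℂ} (hζ : ζ.re < b) :
    ∫ s, (pc b c s : ℂ) * cexp (ζ * s) = b / (b - ζ) * cexp (c * ζ / (b - ζ)) := by
  have hr : 0 < ((b:ℂ) - ζ).re := by simpa using hζ
  have hr0 : (b:ℂ) - ζ ≠ 0 := by intro h; rw [h] at hr; simp at hr
  set F : ℕ → ℝ → ℂ := fun i s => ((b * Real.exp (-c) * bc i * (b * c) ^ i : ℝ) : ℂ)
    * ((s:ℂ) ^ i * cexp (-((b:ℂ) - ζ) * s)) with hF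
  have hFi : ∀ i, Integrable (F i) (volume.restrict (Set.Ioi 0)) :=
    fun i => (intOn_pow_mul_cexp i hr).const_mul _
  have hFn : ∀ i, ∫ s in Set.Ioi (0:ℝ), ‖F i s‖
      = b * Real.exp (-c) * (b - ζ.re)⁻¹ * ((b * c / (b - ζ.re)) ^ i / (Nat.factorial i : ℝ)) := by
    intro i
    have hr' : 0 < b - ζ.re := by linarith
    have : ∫ s in Set.Ioi (0:ℝ), ‖F i s‖ = ∫ s in Set.Ioi (0:ℝ), (b * Real.exp (-c) * bc i * (b * c) ^ i) *
        (s ^ i * Real.exp (-(b - ζ.re) * s)) := by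
      apply setIntegral_congr_fun measurableSet_Ioi
      intro s hs
      have hs : 0 < s := hs
      simp only [hF]
      rw [norm_mul, norm_mul, norm_pow, Complex.norm_real, Complex.norm_real, Complex.norm_exp,
        Real.norm_of_nonneg hs.le, Real.norm_of_nonneg (by have := bc_pos i; positivity)]
      simp
    rw [this, integral_const_mul, int_pow_mul_exp i hr']
    unfold bc
    rw [div_pow]
    field_simp
    try ring
  have hsum := hasSum_integral_of_summable_integral_norm hFi (by
    simp_rw [hFn]
    exact (Real.summable_pow_div_factorial _).mul_left _)
  have e1 : ∫ s, (pc b c s : ℂ) * cexp (ζ * s) = ∫ s in Set.Ioi (0:ℝ), ∑' i, F i s := by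
    rw [← integral_indicator measurableSet_Ioi]
    congr 1; ext s
    by_cases hs : 0 < s
    · rw [Set.indicator_of_mem (by exact hs)]
      simp only [hF, pc, if_pos hs]
      unfold BB
      push_cast
      rw [← tsum_mul_left, ← tsum_mul_right]
      congr 1; ext i
      have : cexp (-((b:ℂ) - ζ) * s) = cexp (-b * s) * cexp (ζ * s) := by
        rw [← Complex.exp_add]; congr 1; ring
      rw [this, Complex.exp_sub, Complex.exp_neg, mul_pow]
      field_simp
    · rw [Set.indicator_of_notMem (by exact hs)]
      simp [pc, hs]
  have e2 : ∀ i, ∫ s in Set.Ioi (0:ℝ), F i s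
      = b * cexp (-c) / (b - ζ) * ((b * c / (b - ζ)) ^ i / (Nat.factorial i : ℂ)) := by
    intro i
    simp only [hF]
    rw [integral_const_mul, int_pow_mul_cexp i hr]
    unfold bc
    have hf : (Nat.factorial i : ℂ) ≠ 0 := by exact_mod_cast Nat.factorial_ne_zero i
    push_cast
    rw [div_pow]
    field_simp
    try ring
  rw [e1]
  simp_rw [e2] at hsum
  have hsum2 : HasSum (fun i => b * cexp (-c) / (b - ζ) * ((b * c / (b - ζ)) ^ i / (Nat.factorial i : ℂ)))
     (b * cexp (-c) / (b - ζ) * cexp (b * c / (b - ζ))) := by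
    apply HasSum.mul_left
    rw [Complex.exp_eq_exp_ℂ]
    exact NormedSpace.expSeries_div_hasSum_exp _
  rw [hsum.unique hsum2]
  have : cexp (-c) * cexp (b * c / (b - ζ)) = cexp (c * ζ / (b - ζ)) := by
    rw [← Complex.exp_add]; congr 1; field_simp; ring
  rw [← this]; ring

/-- A log-concave piece with bilateral Laplace transform `Ψ` on the strip. -/
structure Pc (g : ℝ → ℝ) (Ψ : ℂ → ℂ) : Prop where
  pf : PF2 g
  int : ∀ θ : ℝ, |θ| < π → Integrable (fun x => g x * Real.exp (θ * x))
  tr : ∀ ζ : ℂ, |ζ.re| < π → ∫ x, (g x : ℂ) * cexp (ζ * x) = Ψ ζ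

/-- A piece that is moreover continuous and bounded. -/
structure Good (f : ℝ → ℝ) (Φ : ℂ → ℂ) : Prop extends Pc f Φ where
  cont : Continuous f
  bdd : ∃ M, ∀ x, f x ≤ M

lemma Pc.integrable {g Ψ} (h : Pc g Ψ) : Integrable g := by
  have := h.int 0 (by simpa using Real.pi_pos); simpa using this

lemma Pc.cint {g Ψ} (h : Pc g Ψ) {ζ : ℂ} (hζ : |ζ.re| < π) :
    Integrable (fun x : ℝ => (g x : ℂ) * cexp (ζ * x)) := by
  refine (h.int _ hζ).mono' (h.integrable.ofReal.aestronglyMeasurable.mul (by fun_prop)) ?_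
  refine Eventually.of_forall fun x => ?_
  rw [norm_mul, Complex.norm_real, Complex.norm_exp, Real.norm_of_nonneg (h.pf.1 x)]
  simp

lemma pc_Pc {b c : ℝ} (hb : π ≤ b) (hc : 0 ≤ c) :
    Pc (pc b c) (fun ζ => b / (b - ζ) * cexp (c * ζ / (b - ζ))) :=
  ⟨pc_PF2 (Real.pi_pos.trans_le hb) hc,
   fun θ hθ => pc_int (Real.pi_pos.trans_le hb) hc ((abs_lt.mp hθ).2.trans_le hb),
   fun ζ hζ => pc_tr (Real.pi_pos.trans_le hb) hc ((abs_lt.mp hζ).2.trans_le hb)⟩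

lemma Pc.refl {g Ψ} (h : Pc g Ψ) : Pc (fun x => g (-x)) (fun ζ => Ψ (-ζ)) := by
  refine ⟨h.pf.refl, fun θ hθ => ?_, fun ζ hζ => ?_⟩
  · have := (h.int (-θ) (by simpa using hθ)).comp_neg
    simpa using this
  · rw [← h.tr (-ζ) (by simpa using hζ), ← integral_neg_eq_self]
    simp

lemma Good.mul {f g Φ Ψ} (hf : Good f Φ) (hg : Pc g Ψ) : Good (cv f g) (fun ζ => Φ ζ * Ψ ζ) := by
  obtain ⟨M, hM⟩ := hf.bdd
  have hMn : ∀ x, ‖f x‖ ≤ M := fun x => by rw [Real.norm_of_nonneg (hf.pf.1 x)]; exact hM x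
  have hcv : cv f g = MeasureTheory.convolution g f (ContinuousLinearMap.lsmul ℝ ℝ) volume := by
    ext x; unfold cv MeasureTheory.convolution
    congr 1; ext s; simp [mul_comm]
  have hIntg : ∀ x d, Integrable (fun s => f (x - s) * g (s - d)) := by
    intro x d
    refine (hg.integrable.comp_sub_right d).bdd_mul (c := M) ?_ ?_
    · exact (hf.cont.comp (by fun_prop)).aestronglyMeasurable
    · exact Eventually.of_forall fun s => hMn _
  have hint0 : ∀ x, Integrable (fun s => f (x - s) * g s) := by
    intro x; simpa using hIntg x 0
  refine ⟨⟨hf.pf.cv hg.pf hIntg, ?_, ?_⟩, ?_, ⟨M * ∫ s, g s, ?_⟩⟩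
  · intro θ hθ
    have := (hg.int θ hθ).integrable_convolution (ContinuousLinearMap.lsmul ℝ ℝ) (hf.int θ hθ)
    convert this using 1
    ext x; unfold cv MeasureTheory.convolution
    rw [← integral_mul_const]
    congr 1; ext s
    simp only [ContinuousLinearMap.lsmul_apply, smul_eq_mul]
    have : Real.exp (θ * x) = Real.exp (θ * s) * Real.exp (θ * (x - s)) := by
      rw [← Real.exp_add]; congr 1; ring
    rw [this]; ring
  · intro ζ hζ
    have := integral_convolution (ContinuousLinearMap.mul ℝ ℂ) (hg.cint hζ) (hf.cint hζ)
    rw [hf.tr ζ hζ, hg.tr ζ hζ] at this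
    rw [mul_comm (Φ ζ)]
    refine Eq.trans ?_ this
    congr 1; ext x; unfold cv MeasureTheory.convolution
    rw [← integral_complex_ofReal, ← integral_mul_const]
    congr 1; ext s
    simp only [ContinuousLinearMap.mul_apply']
    have : cexp (ζ * x) = cexp (ζ * s) * cexp (ζ * ((x - s : ℝ) : ℂ)) := by
      rw [← Complex.exp_add]; congr 1; push_cast; ring
    rw [this]; push_cast; ring
  · rw [hcv]
    refine BddAbove.continuous_convolution_right_of_integrable _ ?_ hg.integrable hf.cont
    exact ⟨M, by rintro _ ⟨x, rfl⟩; exact hMn x⟩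
  · intro x
    unfold cv
    rw [← integral_const_mul]
    exact integral_mono (hint0 x) (hg.integrable.const_mul _)
      (fun s => mul_le_mul_of_nonneg_right (hM _) (hg.pf.1 _))

/-- multipliers that preserve the class -/
def Mult (Ψ : ℂ → ℂ) : Prop := ∀ f Φ, Good f Φ → ∃ f', Good f' (fun ζ => Φ ζ * Ψ ζ)

lemma Mult.mul {Ψ Ψ'} (h : Mult Ψ) (h' : Mult Ψ') : Mult (Ψ * Ψ') := by
  intro f Φ hf
  obtain ⟨f1, h1⟩ := h f Φ hf
  obtain ⟨f2, h2⟩ := h' f1 _ h1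
  refine ⟨f2, ?_⟩
  convert h2 using 2
  simp [mul_assoc]

lemma Mult.one : Mult 1 := fun f Φ hf => ⟨f, by simpa using hf⟩

lemma Mult.pow {Ψ} (h : Mult Ψ) (n : ℕ) : Mult (Ψ ^ n) := by
  induction n with
  | zero => simpa using Mult.one
  | succ n ih => rw [pow_succ]; exact ih.mul h

lemma Mult.prod {ι : Type*} (s : Finset ι) (Ψ : ι → ℂ → ℂ) (h : ∀ i ∈ s, Mult (Ψ i)) :
    Mult (∏ i ∈ s, Ψ i) :=
  Finset.prod_induction _ _ (fun _ _ h h' => h.mul h') Mult.one h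

/-- the two sided factor -/
def hfac (b c : ℝ) (ζ : ℂ) : ℂ := (b:ℂ) ^ 2 / ((b:ℂ) ^ 2 - ζ ^ 2) * cexp (2 * c * ζ ^ 2 / ((b:ℂ) ^ 2 - ζ ^ 2))

lemma hfac_eq {b c : ℝ} {ζ : ℂ} (h1 : (b:ℂ) - ζ ≠ 0) (h2 : (b:ℂ) + ζ ≠ 0) :
    hfac b c ζ = (b / (b - ζ) * cexp (c * ζ / (b - ζ))) * (b / (b - (-ζ)) * cexp (c * (-ζ) / (b - (-ζ)))) := by
  unfold hfac
  have h3 : (b:ℂ)^2 - ζ^2 = (b - ζ) * (b + ζ) := by ring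
  rw [sub_neg_eq_add, h3]
  have : cexp (c * ζ / (b - ζ)) * cexp (c * (-ζ) / (b + ζ)) = cexp (2 * c * ζ ^ 2 / ((b - ζ) * (b + ζ))) := by
    rw [← Complex.exp_add]; congr 1; field_simp; ring
  rw [← this]; field_simp

lemma Good.congr {f Φ Φ'} (h : Good f Φ) (he : ∀ ζ : ℂ, |ζ.re| < π → Φ ζ = Φ' ζ) : Good f Φ' :=
  ⟨⟨h.pf, h.int, fun ζ hζ => by rw [h.tr ζ hζ, he ζ hζ]⟩, h.cont, h.bdd⟩

lemma hfac_Mult {b c : ℝ} (hb : π ≤ b) (hc : 0 ≤ c) : Mult (hfac b c) := by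
  intro f Φ hf
  have hp := pc_Pc hb hc
  refine ⟨_, ((hf.mul hp).mul hp.refl).congr ?_⟩
  intro ζ hζ
  rw [hfac_eq, mul_assoc]
  · intro h
    have := congrArg Complex.re h
    simp at this
    linarith [(abs_lt.mp hζ).2]
  · intro h
    have := congrArg Complex.re h
    simp at this
    linarith [(abs_lt.mp hζ).1]

lemma gauss_Good {v : ℝ} (hv : 0 < v) :
    Good (fun x => (√(2 * π * v))⁻¹ * Real.exp (-(2 * v)⁻¹ * x ^ 2)) (fun ζ => cexp (v * ζ ^ 2 / 2)) := by
  have hA : 0 < (√(2 * π * v))⁻¹ := by positivity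
  refine ⟨⟨?_, ?_, ?_⟩, by fun_prop, ⟨(√(2 * π * v))⁻¹, ?_⟩⟩
  · apply PF2.smul _ hA.le
    refine ⟨fun x => (Real.exp_pos _).le, fun x y d hd hdy => ?_⟩
    simp only
    rw [← Real.exp_add, ← Real.exp_add, Real.exp_le_exp]
    have : 0 < (2 * v)⁻¹ := by positivity
    have h2 : 0 ≤ d * (y - x - d) := mul_nonneg hd (by linarith)
    nlinarith [mul_nonneg this.le h2]
  · intro θ _
    have h := integrable_cexp_quadratic' (b := ((-(2 * v)⁻¹ : ℝ) : ℂ)) (by rw [Complex.ofReal_re]; simpa using hv) θ 0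
    have h2 := h.norm.const_mul ((√(2 * π * v))⁻¹)
    refine h2.congr (Eventually.of_forall fun x => ?_)
    simp only
    rw [Complex.norm_exp, mul_assoc (√(2 * π * v))⁻¹, ← Real.exp_add]
    congr 2
    norm_cast
    simp
  · intro ζ _
    have h := integral_cexp_quadratic (b := ((-(2 * v)⁻¹ : ℝ) : ℂ)) (by rw [Complex.ofReal_re]; simpa using hv) ζ 0
    have e : ∀ x : ℝ, (((√(2 * π * v))⁻¹ * Real.exp (-(2 * v)⁻¹ * x ^ 2) : ℝ) : ℂ) * cexp (ζ * x)
       = ((√(2 * π * v))⁻¹ : ℝ) * cexp (((-(2 * v)⁻¹ : ℝ) : ℂ) * x ^ 2 + ζ * x + 0) := by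
      intro x; push_cast
      rw [add_zero, Complex.exp_add]; push_cast; ring
    simp_rw [e]
    rw [integral_const_mul, h]
    have e2 : (π : ℂ) / -((-(2 * v)⁻¹ : ℝ) : ℂ) = ((2 * π * v : ℝ) : ℂ) := by
      push_cast; field_simp
    rw [e2, show ((1:ℂ)/2) = ((1/2 : ℝ) : ℂ) by norm_num, ← Complex.ofReal_cpow (by positivity), ← Real.sqrt_eq_rpow, ← mul_assoc,
      ← Complex.ofReal_mul, inv_mul_cancel₀ (by positivity)]
    have hv' : (v:ℂ) ≠ 0 := by exact_mod_cast hv.ne'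
    simp only [Complex.ofReal_one, one_mul]
    congr 1
    push_cast
    field_simp
    ring
  · intro x
    apply mul_le_of_le_one_right hA.le
    rw [Real.exp_le_one_iff]
    have : 0 < (2 * v)⁻¹ := by positivity
    nlinarith [mul_nonneg this.le (sq_nonneg x)]

lemma Pc.moments {f Φ} (h : Pc f Φ) (hm : Measurable f) {θ : ℝ} (hθ : |θ| < π) (n : ℕ) :
    Integrable (fun x => x ^ n * (f x * Real.exp (θ * x))) ∧
    HasDerivAt (fun θ : ℝ => ∫ x, x ^ n * (f x * Real.exp (θ * x)))
      (∫ x, x ^ (n + 1) * (f x * Real.exp (θ * x))) θ := by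
  set μ : Measure ℝ := volume.withDensity (fun x => ENNReal.ofReal (f x)) with hμ
  have hmm : Measurable (fun x => ENNReal.ofReal (f x)) := hm.ennreal_ofReal
  have hlt : ∀ᵐ x : ℝ, ENNReal.ofReal (f x) < ⊤ := Eventually.of_forall fun x => ENNReal.ofReal_lt_top
  have htr : ∀ x, (ENNReal.ofReal (f x)).toReal = f x := fun x => ENNReal.toReal_ofReal (h.pf.1 x)
  have hIntg : ∀ g : ℝ → ℝ, Integrable g μ ↔ Integrable (fun x => g x * f x) := by
    intro g
    rw [hμ, integrable_withDensity_iff hmm hlt]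
    simp_rw [htr]
  have hval : ∀ g : ℝ → ℝ, ∫ x, g x ∂μ = ∫ x, f x * g x := by
    intro g
    rw [hμ, integral_withDensity_eq_integral_toReal_smul hmm hlt]
    simp_rw [htr, smul_eq_mul]
  have hmem : θ ∈ interior (ProbabilityTheory.integrableExpSet id μ) := by
    rw [mem_interior]
    refine ⟨Set.Ioo (-π) π, ?_, isOpen_Ioo, abs_lt.mp hθ⟩
    intro t ht
    rw [ProbabilityTheory.integrableExpSet, Set.mem_setOf_eq, hIntg]
    refine (h.int t (abs_lt.mpr ht)).congr (Eventually.of_forall fun x => ?_)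
    simp [mul_comm]
  constructor
  · have := ProbabilityTheory.integrable_pow_mul_exp_of_mem_interior_integrableExpSet hmem n
    rw [hIntg] at this
    refine this.congr (Eventually.of_forall fun x => ?_)
    simp only [id]; ring
  · have := ProbabilityTheory.hasDerivAt_integral_pow_mul_exp_real hmem n
    simp_rw [hval] at this
    convert this using 1
    · ext t; congr 1; ext x; simp only [id]; ring
    · congr 1; ext x; simp only [id]; ring

lemma Good.saddle {f Φ} (hf : Good f Φ) {L L1 : ℝ → ℝ} {V : ℝ}
    (hL : ∀ θ : ℝ, |θ| < π → Φ θ = (Real.exp (L θ) : ℝ))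
    (hL1 : ∀ θ : ℝ, |θ| < π → HasDerivAt L (L1 θ) θ)
    {θ : ℝ} (hθ : |θ| < π) (hL2 : HasDerivAt L1 V θ) (hV : 0 < V) :
    (∀ τ, f τ ≤ 144 * Real.exp (L θ - θ * τ) / √V) ∧
      Real.exp (L θ - θ * L1 θ) ≤ 32 * √V * f (L1 θ) := by
  have hmeas : Measurable f := hf.cont.measurable
  have hnear : ∀ t : ℝ, |t| < π → ∀ᶠ s in 𝓝 t, |s| < π := fun t ht =>
    (continuous_abs.tendsto t).eventually (gt_mem_nhds ht)
  have E0 : ∀ t : ℝ, |t| < π → ∫ x, f x * Real.exp (t * x) = Real.exp (L t) := by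
    intro t ht
    have h1 := hf.tr t (by simpa using ht)
    rw [hL t ht] at h1
    have h2 : ∫ x : ℝ, (f x : ℂ) * cexp ((t:ℂ) * x) = ((∫ x, f x * Real.exp (t * x) : ℝ) : ℂ) := by
      rw [← integral_complex_ofReal]; congr 1; ext x; push_cast; rfl
    rw [h2] at h1
    exact_mod_cast h1
  have E1 : ∀ t : ℝ, |t| < π → ∫ x, x * (f x * Real.exp (t * x)) = Real.exp (L t) * L1 t := by
    intro t ht
    have h1 := (hf.moments hmeas ht 0).2
    have h2 : HasDerivAt (fun t => Real.exp (L t)) (Real.exp (L t) * L1 t) t := (hL1 t ht).exp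
    have h3 : (fun θ : ℝ => ∫ x, x ^ 0 * (f x * Real.exp (θ * x))) =ᶠ[𝓝 t] fun t => Real.exp (L t) := by
      filter_upwards [hnear t ht] with s hs
      rw [← E0 s hs]; simp
    have := (h1.congr_of_eventuallyEq h3.symm).unique h2
    simpa using this
  have E2 : ∫ x, x ^ 2 * (f x * Real.exp (θ * x)) = Real.exp (L θ) * (L1 θ ^ 2 + V) := by
    have h1 := (hf.moments hmeas hθ 1).2
    have h2 : HasDerivAt (fun t => Real.exp (L t) * L1 t) (Real.exp (L θ) * L1 θ * L1 θ + Real.exp (L θ) * V) θ :=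
      ((hL1 θ hθ).exp).mul hL2
    have h3 : (fun θ : ℝ => ∫ x, x ^ 1 * (f x * Real.exp (θ * x))) =ᶠ[𝓝 θ] fun t => Real.exp (L t) * L1 t := by
      filter_upwards [hnear θ hθ] with s hs
      rw [← E1 s hs]; simp
    have := (h1.congr_of_eventuallyEq h3.symm).unique h2
    rw [this]; ring
  set m := L1 θ with hm
  set q : ℝ → ℝ := fun y => f y * Real.exp (θ * y) with hq
  have I0 : Integrable q := hf.int θ hθ
  have I1 : Integrable (fun y => y * q y) := by simpa using (hf.moments hmeas hθ 1).1
  have I2 : Integrable (fun y => y ^ 2 * q y) := (hf.moments hmeas hθ 2).1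
  have Q0 : ∫ y, q y = Real.exp (L θ) := E0 θ hθ
  have Q1 : ∫ y, y * q y = Real.exp (L θ) * m := E1 θ hθ
  have Q2 : ∫ y, y ^ 2 * q y = Real.exp (L θ) * (m ^ 2 + V) := E2
  set e := Real.exp (- L θ) with he
  have hee : e * Real.exp (L θ) = 1 := by rw [he, ← Real.exp_add]; simp
  have he0 : 0 < e := Real.exp_pos _
  set g : ℝ → ℝ := fun x => e * q (m + x) with hg
  have gPF : PF2 g := ((hf.pf.tilt θ).shift m).smul he0.le
  have gc : Continuous g := by
    have := hf.cont
    simp only [hg, hq]; fun_prop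
  have gi : Integrable g := (I0.comp_add_left m).const_mul e
  have J1 : Integrable (fun y => (y - m) * q y) := by
    have := I1.sub (I0.const_mul m)
    refine this.congr (Eventually.of_forall fun y => ?_)
    simp only [Pi.sub_apply]; ring
  have J2 : Integrable (fun y => (y - m) ^ 2 * q y) := by
    have := (I2.sub (I1.const_mul (2 * m))).add (I0.const_mul (m ^ 2))
    refine this.congr (Eventually.of_forall fun y => ?_)
    simp only [Pi.sub_apply, Pi.add_apply]; ring
  have gi1 : Integrable (fun x => x * g x) := by
    have := (J1.comp_add_left m).const_mul e
    refine this.congr (Eventually.of_forall fun y => ?_)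
    simp only [hg]; ring
  have gi2 : Integrable (fun x => x ^ 2 * g x) := by
    have := (J2.comp_add_left m).const_mul e
    refine this.congr (Eventually.of_forall fun y => ?_)
    simp only [hg]; ring
  have h0 : ∫ x, g x = 1 := by
    simp only [hg]
    rw [integral_const_mul, integral_add_left_eq_self q m, Q0, hee]
  have h1 : ∫ x, x * g x = 0 := by
    have e1 : ∫ x, x * g x = ∫ x, e * ((fun y => (y - m) * q y) (m + x)) := by
      congr 1; ext x; simp only [hg]; ring
    rw [e1, integral_const_mul, integral_add_left_eq_self (fun y => (y - m) * q y) m]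
    have e2 : ∫ y, (y - m) * q y = ∫ y, (y * q y - m * q y) := by
      congr 1; ext y; ring
    rw [e2, integral_sub I1 (I0.const_mul m), integral_const_mul, Q0, Q1]; ring
  have h2 : ∫ x, x ^ 2 * g x = V := by
    have e1 : ∫ x, x ^ 2 * g x = ∫ x, e * ((fun y => (y - m) ^ 2 * q y) (m + x)) := by
      congr 1; ext x; simp only [hg]; ring
    rw [e1, integral_const_mul, integral_add_left_eq_self (fun y => (y - m) ^ 2 * q y) m]
    have e2 : ∫ y, (y - m) ^ 2 * q y = ∫ y, ((y ^ 2 * q y - (2 * m) * (y * q y)) + m ^ 2 * q y) := by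
      congr 1; ext y; ring
    rw [e2, integral_add (by exact I2.sub (I1.const_mul (2 * m))) (I0.const_mul _),
      integral_sub I2 (I1.const_mul (2 * m)), integral_const_mul, integral_const_mul, Q0, Q1, Q2]
    linear_combination V * hee
  obtain ⟨b1, b2⟩ := gPF.bounds gc gi gi1 gi2 h0 h1 hV h2
  have b3 := gPF.le_four gc gi gi1 h1
  have hsV : 0 < √V := Real.sqrt_pos.mpr hV
  have hg0 : g 0 = f m * Real.exp (θ * m - L θ) := by
    simp only [hg, hq, he, add_zero]
    rw [sub_eq_add_neg, Real.exp_add]; ring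
  constructor
  · intro τ
    have b4 := b3 (τ - m)
    have hgt : g (τ - m) = f τ * Real.exp (θ * τ - L θ) := by
      simp only [hg, hq, he]
      rw [sub_eq_add_neg (θ * τ), Real.exp_add]
      rw [show m + (τ - m) = τ by ring]; ring
    rw [hgt] at b4
    have : f τ = (f τ * Real.exp (θ * τ - L θ)) * Real.exp (L θ - θ * τ) := by
      rw [mul_assoc, ← Real.exp_add]; simp
    rw [this, le_div_iff₀ hsV]
    calc _ ≤ 4 * g 0 * Real.exp (L θ - θ * τ) * √V := by gcongr
      _ = 4 * (g 0 * √V) * Real.exp (L θ - θ * τ) := by ring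
      _ ≤ 4 * 36 * Real.exp (L θ - θ * τ) := by gcongr
      _ = _ := by ring
  · rw [hg0] at b1
    have := mul_le_mul_of_nonneg_right b1 (Real.exp_pos (L θ - θ * m)).le
    rw [one_mul] at this
    refine this.trans (le_of_eq ?_)
    rw [show 32 * √V * (f m * Real.exp (θ * m - L θ)) * Real.exp (L θ - θ * m)
      = 32 * √V * f m * (Real.exp (θ * m - L θ) * Real.exp (L θ - θ * m)) by ring, ← Real.exp_add]
    simp

/-- the poles -/
def bb (a : ℝ) (m : ℕ) : ℝ := π * ((m : ℝ) + 1) / a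

lemma bb_pos {a : ℝ} (ha : 0 < a) (m : ℕ) : 0 < bb a m := by
  have := Real.pi_pos
  unfold bb; positivity

lemma bb_ge {a : ℝ} (ha : 0 < a) (ha1 : a ≤ 1) (m : ℕ) : π * ((m:ℝ) + 1) ≤ bb a m := by
  have := Real.pi_pos
  unfold bb; rw [le_div_iff₀ ha]
  exact mul_le_of_le_one_right (by positivity) ha1

lemma bb_ge_pi {a : ℝ} (ha : 0 < a) (ha1 : a ≤ 1) (m : ℕ) : π ≤ bb a m := by
  refine le_trans ?_ (bb_ge ha ha1 m)
  have := Real.pi_pos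
  nlinarith [Nat.cast_nonneg (α := ℝ) m]

lemma bbsub_ne {a : ℝ} (ha : 0 < a) {ζ : ℂ} (h : (a * ζ / π : ℂ) ∈ Complex.integerComplement) (m : ℕ) :
    (bb a m : ℂ) ^ 2 - ζ ^ 2 ≠ 0 := by
  have hpi : (π : ℂ) ≠ 0 := by exact_mod_cast Real.pi_ne_zero
  have ha' : (a : ℂ) ≠ 0 := by exact_mod_cast ha.ne'
  have := integerComplement_pow_two_ne_pow_two h (m + 1 : ℤ)
  intro h2
  apply this
  unfold bb at h2
  push_cast at h2 ⊢
  field_simp at h2 ⊢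
  linear_combination -h2

lemma lim_prod {a : ℝ} (ha : 0 < a) {ζ : ℂ} (h : (a * ζ / π : ℂ) ∈ Complex.integerComplement) :
    Tendsto (fun N => ∏ m ∈ range N, (bb a m : ℂ) ^ 2 / ((bb a m : ℂ) ^ 2 - ζ ^ 2)) atTop
      (𝓝 (a * ζ / Complex.sin (a * ζ))) := by
  have hpi : (π : ℂ) ≠ 0 := by exact_mod_cast Real.pi_ne_zero
  have ha' : (a : ℂ) ≠ 0 := by exact_mod_cast ha.ne'
  have h0 : (a * ζ / π : ℂ) ≠ 0 := integerComplement.ne_zero h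
  have hz : ζ ≠ 0 := by rintro rfl; simp at h0
  have e : (π:ℂ) * (a * ζ / π) = a * ζ := by field_simp
  have hs : Complex.sin (a * ζ) ≠ 0 := by have := sin_pi_mul_ne_zero h; rwa [e] at this
  have := tendsto_euler_sin_prod' h0
  rw [e] at this
  have h2 := this.inv₀ (by positivity)
  rw [inv_div] at h2
  refine h2.congr fun N => ?_
  rw [← Finset.prod_inv_distrib]
  apply prod_congr rfl
  intro m _
  have h3 := bbsub_ne ha h m
  have h4 : (1 + sineTerm (a * ζ / π) m) = ((bb a m : ℂ) ^ 2 - ζ ^ 2) / (bb a m : ℂ) ^ 2 := by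
    have hm : ((m:ℂ) + 1) ≠ 0 := Nat.cast_add_one_ne_zero m
    unfold sineTerm bb
    push_cast
    field_simp
    ring
  rw [h4, inv_div]

lemma lim_sum {a : ℝ} (ha : 0 < a) {ζ : ℂ} (h : (a * ζ / π : ℂ) ∈ Complex.integerComplement) :
    Tendsto (fun N => ∑ m ∈ range N, 2 * ζ ^ 2 / ((bb a m : ℂ) ^ 2 - ζ ^ 2)) atTop
      (𝓝 (1 - a * ζ * (Complex.cos (a * ζ) / Complex.sin (a * ζ)))) := by
  have hpi : (π : ℂ) ≠ 0 := by exact_mod_cast Real.pi_ne_zero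
  have ha' : (a : ℂ) ≠ 0 := by exact_mod_cast ha.ne'
  have h0 : (a * ζ / π : ℂ) ≠ 0 := integerComplement.ne_zero h
  have hz : ζ ≠ 0 := by rintro rfl; simp at h0
  have e : (π:ℂ) * (a * ζ / π) = a * ζ := by field_simp
  have h1 := (tendsto_logDeriv_euler_cot_sub h).const_mul (-(a * ζ / π : ℂ))
  rw [e] at h1
  have e2 : -(a * ζ / π : ℂ) * (π * Complex.cot (a * ζ) - 1 / (a * ζ / π))
     = 1 - a * ζ * (Complex.cos (a * ζ) / Complex.sin (a * ζ)) := by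
    unfold Complex.cot; field_simp; ring
  rw [e2] at h1
  refine h1.congr fun N => ?_
  rw [Finset.mul_sum]
  apply sum_congr rfl
  intro m _
  rw [cotTerm_identity h]
  have h3 := bbsub_ne ha h m
  have h5 : (a * ζ / π + ((m:ℂ) + 1)) * (a * ζ / π - ((m:ℂ) + 1)) = -(((bb a m : ℂ) ^ 2 - ζ ^ 2) * (a / π) ^ 2) := by
    unfold bb; push_cast; field_simp; ring
  rw [h5]
  field_simp

lemma mem_ic_real {a θ : ℝ} (ha : 0 < a) (ha1 : a ≤ 1) (h0 : 0 < θ) (h1 : θ < π) :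
    (a * (θ:ℂ) / π : ℂ) ∈ Complex.integerComplement := by
  rintro ⟨n, hn⟩
  have : (n : ℝ) = a * θ / π := by exact_mod_cast hn
  have hp : 0 < a * θ / π := by have := Real.pi_pos; positivity
  have hp1 : a * θ / π < 1 := by
    rw [div_lt_one Real.pi_pos]; nlinarith
  rw [← this] at hp hp1
  have h2 : (0:ℤ) < n := by exact_mod_cast hp
  have h3 : n < (1:ℤ) := by exact_mod_cast hp1
  omega

lemma mem_ic_imag {a t : ℝ} (ha : 0 < a) (ht : t ≠ 0) :
    (a * (Complex.I * (t:ℂ)) / π : ℂ) ∈ Complex.integerComplement := by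
  rintro ⟨n, hn⟩
  have h := congrArg Complex.im hn
  have e : (a * (Complex.I * (t:ℂ)) / π : ℂ) = ((a * t / π : ℝ) : ℂ) * Complex.I := by push_cast; ring
  rw [e] at h
  rw [Complex.mul_im] at h
  simp only [Complex.intCast_im, Complex.ofReal_re, Complex.I_im, Complex.ofReal_im] at h
  have hp := Real.pi_ne_zero
  have : a * t / π ≠ 0 := div_ne_zero (mul_ne_zero ha.ne' ht) hp
  apply this
  linarith

lemma lim_sum_real {a θ : ℝ} (ha : 0 < a) (ha1 : a ≤ 1) (h0 : 0 < θ) (h1 : θ < π) :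
    Tendsto (fun N => ∑ m ∈ range N, 2 * θ ^ 2 / ((bb a m) ^ 2 - θ ^ 2)) atTop
      (𝓝 (1 - a * θ * (Real.cos (a * θ) / Real.sin (a * θ)))) := by
  have h := lim_sum ha (mem_ic_real ha ha1 h0 h1)
  have h2 := (Complex.continuous_re.tendsto _).comp h
  convert h2 using 1
  · ext N; simp only [Function.comp]
    rw [← Complex.ofReal_re (∑ m ∈ range N, 2 * θ ^ 2 / ((bb a m) ^ 2 - θ ^ 2))]
    push_cast; rfl
  · congr 1
    rw [← Complex.ofReal_re (1 - a * θ * (Real.cos (a * θ) / Real.sin (a * θ)))]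
    push_cast; rfl

lemma lim_prod_real {a θ : ℝ} (ha : 0 < a) (ha1 : a ≤ 1) (h0 : 0 < θ) (h1 : θ < π) :
    Tendsto (fun N => ∏ m ∈ range N, (bb a m) ^ 2 / ((bb a m) ^ 2 - θ ^ 2)) atTop
      (𝓝 (a * θ / Real.sin (a * θ))) := by
  have h := lim_prod ha (mem_ic_real ha ha1 h0 h1)
  have h2 := (Complex.continuous_re.tendsto _).comp h
  convert h2 using 1
  · ext N; simp only [Function.comp]
    rw [← Complex.ofReal_re (∏ m ∈ range N, (bb a m) ^ 2 / ((bb a m) ^ 2 - θ ^ 2))]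
    push_cast; rfl
  · congr 1
    rw [← Complex.ofReal_re (a * θ / Real.sin (a * θ))]
    push_cast; rfl

lemma lim_k1 {a θ : ℝ} (ha : 0 < a) (ha1 : a ≤ 1) (h0 : 0 < θ) (h1 : θ < π) :
    Tendsto (fun N => ∑ m ∈ range N, (1 / (bb a m - θ) - 1 / (bb a m + θ))) atTop
      (𝓝 (1 / θ - a * (Real.cos (a * θ) / Real.sin (a * θ)))) := by
  have h := (lim_sum_real ha ha1 h0 h1).const_mul (1 / θ)
  have e : 1 / θ * (1 - a * θ * (Real.cos (a * θ) / Real.sin (a * θ)))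
    = 1 / θ - a * (Real.cos (a * θ) / Real.sin (a * θ)) := by field_simp
  rw [e] at h
  refine h.congr fun N => ?_
  rw [Finset.mul_sum]
  apply sum_congr rfl
  intro m _
  have hb := bb_ge_pi ha ha1 m
  have h2 : bb a m - θ ≠ 0 := by linarith
  have h3 : bb a m + θ ≠ 0 := by linarith
  have h4 : bb a m ^ 2 - θ ^ 2 = (bb a m - θ) * (bb a m + θ) := by ring
  rw [h4]; field_simp; ring

lemma summable_inv_succ_sq : Summable (fun m : ℕ => 1 / ((m:ℝ) + 1) ^ 2) := by
  have := (summable_nat_add_iff 1).mpr (Real.summable_one_div_nat_pow.mpr (one_lt_two))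
  simpa using this

/-- the function `m(x)` from the distance computation -/
def mm (x : ℝ) : ℝ := (x - Real.sin x * Real.cos x) / Real.sin x ^ 2

lemma lim_c1 {a θ : ℝ} (ha : 0 < a) (ha1 : a ≤ 1) (h0 : 0 < θ) (h1 : θ < π) :
    Tendsto (fun N => ∑ m ∈ range N, (bb a m / (bb a m - θ) ^ 2 - bb a m / (bb a m + θ) ^ 2)) atTop
      (𝓝 (a * mm (a * θ))) := by
  have hpi := Real.pi_pos
  obtain ⟨R, hR1, hR2⟩ := exists_between h1
  have hR0 : 0 < R := h0.trans hR1
  set u : ℕ → ℝ := fun m => (2 * π / (π - R) ^ 2) * (π * (1 / ((m:ℝ) + 1) ^ 2)) with hu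
  have hus : Summable u := (summable_inv_succ_sq.mul_left _).mul_left _
  have hd : ∀ m : ℕ, ∀ y ∈ Set.Ioo 0 R, HasDerivAt (fun y => 2 * y ^ 2 / ((bb a m) ^ 2 - y ^ 2))
      (bb a m / (bb a m - y) ^ 2 - bb a m / (bb a m + y) ^ 2) y := by
    intro m y hy
    have hb := bb_ge_pi ha ha1 m
    have h2 : bb a m - y ≠ 0 := by linarith [hy.2]
    have h3 : bb a m + y ≠ 0 := by linarith [hy.1]
    have h4 : bb a m ^ 2 - y ^ 2 = (bb a m - y) * (bb a m + y) := by ring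
    have h5 : bb a m ^ 2 - y ^ 2 ≠ 0 := by rw [h4]; positivity
    have := (((hasDerivAt_pow 2 y).const_mul 2).div ((hasDerivAt_pow 2 y).const_sub (bb a m ^ 2)) h5)
    refine HasDerivAt.congr_deriv this ?_
    rw [h4]; field_simp; push_cast; ring
  have hbd : ∀ m : ℕ, ∀ y ∈ Set.Ioo 0 R, ‖bb a m / (bb a m - y) ^ 2 - bb a m / (bb a m + y) ^ 2‖ ≤ u m := by
    intro m y hy
    have hb := bb_ge_pi ha ha1 m
    have hb2 := bb_ge ha ha1 m
    have hbp := bb_pos ha m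
    have h2 : 0 < bb a m - y := by linarith [hy.2]
    have h3 : 0 < bb a m + y := by linarith [hy.1]
    have e : bb a m / (bb a m - y) ^ 2 - bb a m / (bb a m + y) ^ 2
       = 4 * bb a m ^ 2 * y / ((bb a m - y) ^ 2 * (bb a m + y) ^ 2) := by
      field_simp; ring
    rw [e, Real.norm_of_nonneg (by have := hy.1; positivity)]
    have h6 : bb a m * (π - R) / π ≤ bb a m - y := by
      rw [div_le_iff₀ hpi]; nlinarith [hy.2, mul_le_mul_of_nonneg_left hb hR0.le]
    have h7 : 0 < π - R := by linarith
    calc 4 * bb a m ^ 2 * y / ((bb a m - y) ^ 2 * (bb a m + y) ^ 2)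
        ≤ 4 * bb a m ^ 2 * R / ((bb a m * (π - R) / π) ^ 2 * (bb a m) ^ 2) := by
          gcongr
          · exact hy.2.le
          · linarith [hy.1]
      _ = 4 * R * π ^ 2 / (π - R) ^ 2 * (1 / (bb a m) ^ 2) := by field_simp
      _ ≤ 4 * R * π ^ 2 / (π - R) ^ 2 * (1 / (π * ((m:ℝ) + 1)) ^ 2) := by gcongr
      _ = 4 * R / (π - R) ^ 2 * (1 / ((m:ℝ) + 1) ^ 2) := by field_simp
      _ ≤ u m := by
        simp only [hu]
        rw [← mul_assoc, div_mul_eq_mul_div (2 * π)]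
        have : 4 * R ≤ 2 * π * π := by nlinarith [Real.pi_gt_three]
        gcongr
  have hmem : θ ∈ Set.Ioo 0 R := ⟨h0, hR1⟩
  have hsum : ∀ y ∈ Set.Ioo 0 R, HasSum (fun m => 2 * y ^ 2 / ((bb a m) ^ 2 - y ^ 2))
      (1 - a * y * (Real.cos (a * y) / Real.sin (a * y))) := by
    intro y hy
    rw [hasSum_iff_tendsto_nat_of_nonneg]
    · exact lim_sum_real ha ha1 hy.1 (hy.2.trans hR2)
    · intro m
      have hb := bb_ge_pi ha ha1 m
      have : 0 < bb a m ^ 2 - y ^ 2 := by nlinarith [hy.1, hy.2]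
      positivity
  have hD := hasDerivAt_tsum_of_isPreconnected hus isOpen_Ioo isPreconnected_Ioo hd hbd hmem
    (hsum θ hmem).summable hmem
  have hs : 0 < Real.sin (a * θ) := Real.sin_pos_of_pos_of_lt_pi (by positivity) (by nlinarith)
  have hD2 : HasDerivAt (fun y => 1 - a * y * (Real.cos (a * y) / Real.sin (a * y))) (a * mm (a * θ)) θ := by
    have hx : HasDerivAt (fun y : ℝ => a * y) a θ := by simpa using (hasDerivAt_id θ).const_mul a
    have := (hx.mul (hx.cos.div hx.sin hs.ne')).const_sub 1
    refine HasDerivAt.congr_deriv this ?_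
    unfold mm
    simp only [Pi.div_apply]
    field_simp
    linear_combination (a * θ) * Real.sin_sq_add_cos_sq (a * θ)
  have heq : (fun y => 1 - a * y * (Real.cos (a * y) / Real.sin (a * y))) =ᶠ[𝓝 θ]
      fun y => ∑' m, 2 * y ^ 2 / ((bb a m) ^ 2 - y ^ 2) := by
    filter_upwards [isOpen_Ioo.mem_nhds hmem] with y hy
    exact (hsum y hy).tsum_eq.symm
  have huniq := (hD.congr_of_eventuallyEq heq).unique hD2
  rw [← huniq]
  exact (Summable.of_norm_bounded hus (fun m => hbd m θ hmem)).hasSum.tendsto_sum_nat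

/-- logarithm of a single factor -/
def lf (k c b θ : ℝ) : ℝ :=
  k * (2 * Real.log b - Real.log (b - θ) - Real.log (b + θ)) + c * (b / (b - θ) + b / (b + θ) - 2)

def lf1 (k c b θ : ℝ) : ℝ :=
  k * (1 / (b - θ) - 1 / (b + θ)) + c * (b / (b - θ) ^ 2 - b / (b + θ) ^ 2)

def lf2 (k c b θ : ℝ) : ℝ :=
  k * (1 / (b - θ) ^ 2 + 1 / (b + θ) ^ 2) + c * (2 * b / (b - θ) ^ 3 + 2 * b / (b + θ) ^ 3)

lemma lf_deriv {k c b θ : ℝ} (h1 : 0 < b - θ) (h2 : 0 < b + θ) :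
    HasDerivAt (lf k c b) (lf1 k c b θ) θ := by
  have d1 : HasDerivAt (fun x : ℝ => b - x) (-1) θ := by simpa using (hasDerivAt_id θ).const_sub b
  have d2 : HasDerivAt (fun x : ℝ => b + x) 1 θ := by simpa using (hasDerivAt_id θ).const_add b
  have l1 := d1.log h1.ne'
  have l2 := d2.log h2.ne'
  have q1 := (hasDerivAt_const θ b).div d1 h1.ne'
  have q2 := (hasDerivAt_const θ b).div d2 h2.ne'
  have := (((l1.const_sub (2 * Real.log b)).sub l2).const_mul k).add
    (((q1.add q2).sub_const 2).const_mul c)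
  refine HasDerivAt.congr_deriv this ?_
  unfold lf1
  have := h1.ne'
  have := h2.ne'
  field_simp
  ring

lemma lf1_deriv {k c b θ : ℝ} (h1 : 0 < b - θ) (h2 : 0 < b + θ) :
    HasDerivAt (lf1 k c b) (lf2 k c b θ) θ := by
  have d1 : HasDerivAt (fun x : ℝ => b - x) (-1) θ := by simpa using (hasDerivAt_id θ).const_sub b
  have d2 : HasDerivAt (fun x : ℝ => b + x) 1 θ := by simpa using (hasDerivAt_id θ).const_add b
  have l1 := (hasDerivAt_const θ (1:ℝ)).div d1 h1.ne'
  have l2 := (hasDerivAt_const θ (1:ℝ)).div d2 h2.ne'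
  have q1 := (hasDerivAt_const θ b).div (d1.pow 2) (pow_ne_zero 2 h1.ne')
  have q2 := (hasDerivAt_const θ b).div (d2.pow 2) (pow_ne_zero 2 h2.ne')
  have := ((l1.sub l2).const_mul k).add ((q1.sub q2).const_mul c)
  refine HasDerivAt.congr_deriv this ?_
  unfold lf2
  have := h1.ne'
  have := h2.ne'
  simp only [Pi.pow_apply]
  field_simp
  ring

lemma exp_lf {k : ℕ} {c b θ : ℝ} (hb : 0 < b) (h1 : 0 < b - θ) (h2 : 0 < b + θ) :
    Real.exp (lf k c b θ) = (b ^ 2 / (b ^ 2 - θ ^ 2)) ^ k * Real.exp (c * (2 * θ ^ 2 / (b ^ 2 - θ ^ 2))) := by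
  unfold lf
  rw [Real.exp_add, Real.exp_nat_mul]
  have hp : b ^ 2 - θ ^ 2 = (b - θ) * (b + θ) := by ring
  congr 2
  · rw [Real.exp_sub, Real.exp_sub, Real.exp_log h1, Real.exp_log h2, two_mul, Real.exp_add,
      Real.exp_log hb, hp]
    field_simp
  · rw [hp]
    have := h1.ne'
    have := h2.ne'
    field_simp
    ring

lemma hfac_pow {k : ℕ} (hk : 0 < k) (b c : ℝ) (ζ : ℂ) :
    (hfac b (c / k) ζ) ^ k = (b ^ 2 / (b ^ 2 - ζ ^ 2)) ^ k * cexp (c * (2 * ζ ^ 2 / (b ^ 2 - ζ ^ 2))) := by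
  unfold hfac
  rw [mul_pow, ← Complex.exp_nat_mul]
  congr 2
  have : (k : ℂ) ≠ 0 := by exact_mod_cast hk.ne'
  push_cast
  field_simp

lemma hfac_pow_real {k : ℕ} (hk : 0 < k) {b c θ : ℝ} (hb : 0 < b) (h1 : 0 < b - θ) (h2 : 0 < b + θ) :
    (hfac b (c / k) θ) ^ k = ((Real.exp (lf k c b θ) : ℝ) : ℂ) := by
  rw [hfac_pow hk, exp_lf hb h1 h2]
  push_cast
  ring_nf

section abs
variable {ι : Type*} [Fintype ι]

def PhiN (a : ι → ℝ) (k : ι → ℕ) (c : ι → ℝ) (N : ℕ) (ζ : ℂ) : ℂ :=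
  cexp ((1 / (N + 1) : ℝ) * ζ ^ 2 / 2) *
    ∏ i, ∏ m ∈ range N, (hfac (bb (a i) m) (c i / k i) ζ) ^ k i

def LN (a : ι → ℝ) (k : ι → ℕ) (c : ι → ℝ) (N : ℕ) (θ : ℝ) : ℝ :=
  (1 / (N + 1) : ℝ) * θ ^ 2 / 2 + ∑ i, ∑ m ∈ range N, lf (k i) (c i) (bb (a i) m) θ

def LN1 (a : ι → ℝ) (k : ι → ℕ) (c : ι → ℝ) (N : ℕ) (θ : ℝ) : ℝ :=
  (1 / (N + 1) : ℝ) * θ + ∑ i, ∑ m ∈ range N, lf1 (k i) (c i) (bb (a i) m) θ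

def LN2 (a : ι → ℝ) (k : ι → ℕ) (c : ι → ℝ) (N : ℕ) (θ : ℝ) : ℝ :=
  (1 / (N + 1) : ℝ) + ∑ i, ∑ m ∈ range N, lf2 (k i) (c i) (bb (a i) m) θ

def Vb (a : ι → ℝ) (c : ι → ℝ) (θ : ℝ) : ℝ :=
  ∑ i, (1 / (π / a i - θ) ^ 2 + c i / (π / a i - θ) ^ 3)

lemma bb_sub_pos {a θ : ℝ} (h0 : 0 < a) (h1 : a ≤ 1) (m : ℕ) (hθ : |θ| < π) : 0 < bb a m - θ := by
  have := bb_ge_pi h0 h1 m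
  have := abs_lt.1 hθ
  linarith

lemma bb_add_pos {a θ : ℝ} (h0 : 0 < a) (h1 : a ≤ 1) (m : ℕ) (hθ : |θ| < π) : 0 < bb a m + θ := by
  have := bb_ge_pi h0 h1 m
  have := abs_lt.1 hθ
  linarith

lemma PhiN_real {a : ι → ℝ} {k : ι → ℕ} (ha : ∀ i, 0 < a i ∧ a i ≤ 1) (hk : ∀ i, 0 < k i)
    (c : ι → ℝ) (N : ℕ) {θ : ℝ} (hθ : |θ| < π) :
    PhiN a k c N θ = ((Real.exp (LN a k c N θ) : ℝ) : ℂ) := by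
  unfold PhiN LN
  rw [Real.exp_add, Real.exp_sum]
  push_cast
  congr 1
  refine Finset.prod_congr rfl fun i _ => ?_
  rw [Complex.exp_sum]
  refine Finset.prod_congr rfl fun m _ => ?_
  rw [← Complex.ofReal_exp]
  exact hfac_pow_real (hk i) (bb_pos (ha i).1 m) (bb_sub_pos (ha i).1 (ha i).2 m hθ)
    (bb_add_pos (ha i).1 (ha i).2 m hθ)

lemma exists_good {a : ι → ℝ} {k : ι → ℕ} (ha : ∀ i, 0 < a i ∧ a i ≤ 1)
    {c : ι → ℝ} (hc : ∀ i, 0 ≤ c i) (N : ℕ) : ∃ f, Good f (PhiN a k c N) := by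
  have hM : Mult (∏ i, ∏ m ∈ range N, (hfac (bb (a i) m) (c i / k i)) ^ k i) := by
    refine Mult.prod _ _ fun i _ => Mult.prod _ _ fun m _ => Mult.pow (hfac_Mult (bb_ge_pi (ha i).1 (ha i).2 m) ?_) _
    have := hc i
    positivity
  obtain ⟨f, hf⟩ := hM _ _ (gauss_Good (v := 1 / ((N:ℝ) + 1)) (by positivity))
  refine ⟨f, hf.congr fun ζ _ => ?_⟩
  simp [PhiN, Finset.prod_apply]

lemma LN_deriv {a : ι → ℝ} {k : ι → ℕ} (ha : ∀ i, 0 < a i ∧ a i ≤ 1)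
    (c : ι → ℝ) (N : ℕ) {θ : ℝ} (hθ : |θ| < π) :
    HasDerivAt (LN a k c N) (LN1 a k c N θ) θ := by
  unfold LN LN1
  have h1 : HasDerivAt (fun θ : ℝ => (1 / (N + 1) : ℝ) * θ ^ 2 / 2) ((1 / (N + 1) : ℝ) * θ) θ := by
    have := (((hasDerivAt_id θ).pow 2).const_mul (1 / (N + 1) : ℝ)).div_const 2
    refine HasDerivAt.congr_deriv this ?_
    simp
    ring
  refine h1.add ?_
  refine HasDerivAt.fun_sum fun i _ => HasDerivAt.fun_sum fun m _ => ?_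
  exact lf_deriv (bb_sub_pos (ha i).1 (ha i).2 m hθ) (bb_add_pos (ha i).1 (ha i).2 m hθ)

lemma LN1_deriv {a : ι → ℝ} {k : ι → ℕ} (ha : ∀ i, 0 < a i ∧ a i ≤ 1)
    (c : ι → ℝ) (N : ℕ) {θ : ℝ} (hθ : |θ| < π) :
    HasDerivAt (LN1 a k c N) (LN2 a k c N θ) θ := by
  unfold LN1 LN2
  have h1 : HasDerivAt (fun θ : ℝ => (1 / (N + 1) : ℝ) * θ) (1 / (N + 1) : ℝ) θ := by
    simpa using (hasDerivAt_id θ).const_mul (1 / (N + 1) : ℝ)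
  refine h1.add ?_
  refine HasDerivAt.fun_sum fun i _ => HasDerivAt.fun_sum fun m _ => ?_
  exact lf1_deriv (bb_sub_pos (ha i).1 (ha i).2 m hθ) (bb_add_pos (ha i).1 (ha i).2 m hθ)

lemma lf2_upper {a c θ : ℝ} {k : ℕ} (h0 : 0 < a) (h1 : a ≤ 1) (hc : 0 ≤ c) (hθ0 : 0 ≤ θ) (hθ : θ < π)
    (m : ℕ) : lf2 k c (bb a m) θ ≤
      ((2 * k + 4 * (π / a)) * (1 / (π / a - θ) ^ 2 + c / (π / a - θ) ^ 3)) * (1 / ((m:ℝ) + 1) ^ 2) := by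
  have hb0 : π ≤ π / a := by rw [le_div_iff₀ h0]; nlinarith [Real.pi_pos]
  have hε : 0 < π / a - θ := by linarith
  have hm : (0:ℝ) < (m:ℝ) + 1 := by positivity
  have hbm : bb a m = (m + 1) * (π / a) := by unfold bb; ring
  have h2 : (m + 1) * (π / a - θ) ≤ bb a m - θ := by
    rw [hbm]; nlinarith [mul_nonneg (Nat.cast_nonneg (α := ℝ) m) hθ0]
  have h3 : (m + 1) * (π / a - θ) ≤ bb a m + θ := by linarith
  have hP : 0 < (m + 1) * (π / a - θ) := by positivity
  have hb := bb_pos h0 m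
  have A : ∀ y, (m + 1) * (π / a - θ) ≤ y → 1 / y ^ 2 ≤ 1 / ((m + 1) * (π / a - θ)) ^ 2 := fun y hy => by
    gcongr
  have B : ∀ y, (m + 1) * (π / a - θ) ≤ y → 2 * bb a m / y ^ 3 ≤ 2 * bb a m / ((m + 1) * (π / a - θ)) ^ 3 :=
    fun y hy => by gcongr
  unfold lf2
  calc _ ≤ (k:ℝ) * (1 / ((m + 1) * (π / a - θ)) ^ 2 + 1 / ((m + 1) * (π / a - θ)) ^ 2)
        + c * (2 * bb a m / ((m + 1) * (π / a - θ)) ^ 3 + 2 * bb a m / ((m + 1) * (π / a - θ)) ^ 3) := by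
          gcongr ?_ * (?_ + ?_) + c * (?_ + ?_)
          · exact A _ h2
          · exact A _ h3
          · exact B _ h2
          · exact B _ h3
    _ = (2 * k * (1 / (π / a - θ) ^ 2) + 4 * (π / a) * (c / (π / a - θ) ^ 3)) * (1 / ((m:ℝ) + 1) ^ 2) := by
          rw [hbm]
          have := hε.ne'
          have := hm.ne'
          have := h0.ne'
          field_simp
          ring
    _ ≤ _ := by
          gcongr
          have : 0 ≤ 2 * (k:ℝ) * (c / (π / a - θ) ^ 3) := by positivity
          have : 0 ≤ 4 * (π / a) * (1 / (π / a - θ) ^ 2) := by positivity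
          nlinarith

lemma lf2_nonneg {a c θ : ℝ} {k : ℕ} (h0 : 0 < a) (h1 : a ≤ 1) (hc : 0 ≤ c) (hθ : |θ| < π)
    (m : ℕ) : 0 ≤ lf2 k c (bb a m) θ := by
  have := bb_sub_pos h0 h1 m hθ
  have := bb_add_pos h0 h1 m hθ
  have := bb_pos h0 m
  unfold lf2
  positivity

lemma LN2_lower {a : ι → ℝ} {k : ι → ℕ} (ha : ∀ i, 0 < a i ∧ a i ≤ 1) (hk : ∀ i, 0 < k i)
    {c : ι → ℝ} (hc : ∀ i, 0 ≤ c i) {N : ℕ} (hN : 1 ≤ N) {θ : ℝ} (hθ : |θ| < π) :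
    Vb a c θ ≤ LN2 a k c N θ := by
  unfold Vb LN2
  have : 0 ≤ (1 / (N + 1) : ℝ) := by positivity
  refine le_trans ?_ (le_add_of_nonneg_left this)
  refine Finset.sum_le_sum fun i _ => ?_
  refine le_trans ?_ (Finset.single_le_sum (f := fun m => lf2 (k i) (c i) (bb (a i) m) θ)
    (fun m _ => lf2_nonneg (ha i).1 (ha i).2 (hc i) hθ m) (Finset.mem_range.2 hN))
  have hb0 : bb (a i) 0 = π / a i := by unfold bb; simp
  have h1 := bb_sub_pos (ha i).1 (ha i).2 0 hθ
  have h2 := bb_add_pos (ha i).1 (ha i).2 0 hθ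
  have h3 := bb_ge_pi (ha i).1 (ha i).2 0
  have hci := hc i
  have hbp := bb_pos (ha i).1 0
  simp only [lf2]
  rw [← hb0]
  have hpi := Real.pi_gt_three
  have hk1 : (1:ℝ) ≤ k i := by exact_mod_cast hk i
  have e1 : 1 / (bb (a i) 0 - θ) ^ 2 ≤ (k i : ℝ) * (1 / (bb (a i) 0 - θ) ^ 2 + 1 / (bb (a i) 0 + θ) ^ 2) := by
    have : 0 ≤ 1 / (bb (a i) 0 - θ) ^ 2 := by positivity
    have : 0 ≤ 1 / (bb (a i) 0 + θ) ^ 2 := by positivity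
    nlinarith
  have e2 : c i / (bb (a i) 0 - θ) ^ 3 ≤ c i * (2 * bb (a i) 0 / (bb (a i) 0 - θ) ^ 3 + 2 * bb (a i) 0 / (bb (a i) 0 + θ) ^ 3) := by
    rw [div_eq_mul_one_div]
    gcongr
    have : 0 ≤ 2 * bb (a i) 0 / (bb (a i) 0 + θ) ^ 3 := by positivity
    have : 1 / (bb (a i) 0 - θ) ^ 3 ≤ 2 * bb (a i) 0 / (bb (a i) 0 - θ) ^ 3 := by
      gcongr
      linarith
    linarith
  linarith

lemma LN2_upper [Nonempty ι] {a : ι → ℝ} (k : ι → ℕ) (ha : ∀ i, 0 < a i ∧ a i ≤ 1) :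
    ∃ K > 0, ∀ (c : ι → ℝ), (∀ i, 0 ≤ c i) → ∀ (N : ℕ) (θ : ℝ), 0 ≤ θ → θ < π →
    LN2 a k c N θ ≤ K * Vb a c θ := by
  set S := ∑' m : ℕ, 1 / ((m:ℝ) + 1) ^ 2 with hS
  have hS0 : 0 ≤ S := tsum_nonneg fun m => by positivity
  have hai := fun i => (ha i).1
  have hT0 : ∀ i, 0 ≤ (2 * k i + 4 * (π / a i)) * S := fun i => by have := hai i; positivity
  obtain ⟨i0⟩ := ‹Nonempty ι›
  have hT : ∀ i, (2 * k i + 4 * (π / a i)) * S ≤ ∑ i, (2 * k i + 4 * (π / a i)) * S := fun i =>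
    Finset.single_le_sum (f := fun i => (2 * k i + 4 * (π / a i)) * S) (fun i _ => hT0 i) (Finset.mem_univ i)
  set T := ∑ i, (2 * k i + 4 * (π / a i)) * S
  have hTn : 0 ≤ T := (hT0 i0).trans (hT i0)
  have := hai i0
  refine ⟨T + (π / a i0) ^ 2, by positivity, fun c hc N θ h0 hθ => ?_⟩
  have hε : ∀ i, 0 < π / a i - θ := fun i => by
    have : π ≤ π / a i := by rw [le_div_iff₀ (hai i)]; nlinarith [Real.pi_pos, (ha i).2]
    linarith
  unfold LN2
  rw [add_mul, add_comm]
  have hterm : ∀ i, 0 ≤ 1 / (π / a i - θ) ^ 2 + c i / (π / a i - θ) ^ 3 := fun i => by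
    have := hε i
    have := hc i
    positivity
  refine add_le_add ?_ ?_
  · unfold Vb
    rw [Finset.mul_sum]
    refine Finset.sum_le_sum fun i _ => ?_
    calc _ ≤ ∑ m ∈ range N, ((2 * k i + 4 * (π / a i)) * (1 / (π / a i - θ) ^ 2 + c i / (π / a i - θ) ^ 3)) * (1 / ((m:ℝ) + 1) ^ 2) :=
          Finset.sum_le_sum fun m _ => lf2_upper (hai i) (ha i).2 (hc i) h0 hθ m
      _ = ((2 * k i + 4 * (π / a i)) * (1 / (π / a i - θ) ^ 2 + c i / (π / a i - θ) ^ 3)) * ∑ m ∈ range N, (1 / ((m:ℝ) + 1) ^ 2) := by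
          rw [Finset.mul_sum]
      _ ≤ ((2 * k i + 4 * (π / a i)) * (1 / (π / a i - θ) ^ 2 + c i / (π / a i - θ) ^ 3)) * S := by
          have := hai i
          have := hterm i
          refine mul_le_mul_of_nonneg_left ?_ (by positivity)
          exact summable_inv_succ_sq.sum_le_tsum _ fun m _ => by positivity
      _ = ((2 * k i + 4 * (π / a i)) * S) * (1 / (π / a i - θ) ^ 2 + c i / (π / a i - θ) ^ 3) := by ring
      _ ≤ _ := mul_le_mul_of_nonneg_right (hT i) (hterm i)
  · have h1 : 1 / (π / a i0 - θ) ^ 2 ≤ Vb a c θ := by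
      refine le_trans ?_ (Finset.single_le_sum (f := fun i => 1 / (π / a i - θ) ^ 2 + c i / (π / a i - θ) ^ 3) (fun i _ => hterm i) (Finset.mem_univ i0))
      have := hε i0
      have := hc i0
      simp only [le_add_iff_nonneg_right]
      positivity
    have h2 : (1:ℝ) ≤ (π / a i0) ^ 2 * (1 / (π / a i0 - θ) ^ 2) := by
      have := hε i0
      rw [mul_one_div, one_le_div (by positivity)]
      gcongr
      linarith
    have h3 : (1 / (N + 1) : ℝ) ≤ 1 := by
      rw [div_le_one (by positivity)]
      have : (0:ℝ) ≤ N := by positivity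
      linarith
    refine h3.trans (h2.trans ?_)
    gcongr

end abs

lemma fourier_pc {f : ℝ → ℝ} {Φ : ℂ → ℂ} (hf : Good f Φ)
    (hΦ : Integrable (fun x : ℝ => Φ (I * x))) (τ : ℝ) :
    (f τ : ℂ) = (1 / (2 * π) : ℝ) * ∫ x : ℝ, Φ (I * x) * cexp (-(I * x * τ)) := by
  have hF : FourierTransform.fourier (fun x : ℝ => (f x : ℂ)) = fun ξ : ℝ => Φ (I * ((-(2 * π) * ξ : ℝ) : ℂ)) := by
    funext ξ
    rw [Real.fourier_real_eq_integral_exp_smul, ← hf.tr _ (by simp [Real.pi_pos])]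
    refine integral_congr_ae (Eventually.of_forall fun x => ?_)
    simp only [smul_eq_mul]
    rw [mul_comm]
    congr 2
    push_cast
    ring
  have hne : (-(2 * π) : ℝ) ≠ 0 := by have := Real.pi_pos; simp [this.ne']
  have h := Continuous.fourierInv_fourier_eq (f := fun x : ℝ => (f x : ℂ))
    (Complex.continuous_ofReal.comp hf.cont) hf.integrable.ofReal (by
      rw [hF]
      exact hΦ.comp_mul_left' hne)
  have h2 := congrFun h τ
  rw [← h2, hF, Real.fourierInv_eq']
  have h3 := Measure.integral_comp_mul_left (fun x : ℝ => Φ (I * x) * cexp (-(I * x * τ))) (-(2 * π))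
  rw [abs_inv, abs_neg, abs_of_pos (by positivity : (0:ℝ) < 2 * π)] at h3
  rw [one_div, ← Complex.real_smul, ← h3]
  refine integral_congr_ae (Eventually.of_forall fun x => ?_)
  have hin : inner ℝ x τ = x * τ := by simp [mul_comm]
  simp only [smul_eq_mul, hin]
  rw [mul_comm]
  congr 2
  push_cast
  ring

section abs
variable {ι : Type*} [Fintype ι]

def FI (a : ι → ℝ) (k : ι → ℕ) (c : ι → ℝ) (x : ℝ) : ℝ :=
  (∏ i, ((a i * x) / Real.sinh (a i * x)) ^ k i) *
    Real.exp (∑ i, c i * (1 - a i * x * (Real.cosh (a i * x) / Real.sinh (a i * x))))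

def FF (a : ι → ℝ) (k : ι → ℕ) (c : ι → ℝ) (τ : ℝ) : ℝ :=
  (1 / (2 * π)) * (∫ x : ℝ, (FI a k c x : ℂ) * cexp (I * x * τ)).re

lemma FI_even (a : ι → ℝ) (k : ι → ℕ) (c : ι → ℝ) (x : ℝ) : FI a k c (-x) = FI a k c x := by
  unfold FI
  simp only [mul_neg, Real.sinh_neg, div_neg, neg_div, Real.cosh_neg, neg_mul, neg_neg]

lemma FF_even (a : ι → ℝ) (k : ι → ℕ) (c : ι → ℝ) (τ : ℝ) : FF a k c (-τ) = FF a k c τ := by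
  unfold FF
  rw [← integral_neg_eq_self]
  simp [FI_even]

lemma PhiN_eq {a : ι → ℝ} {k : ι → ℕ} (hk : ∀ i, 0 < k i) (c : ι → ℝ) (N : ℕ) (ζ : ℂ) :
    PhiN a k c N ζ = cexp ((1 / (N + 1) : ℝ) * ζ ^ 2 / 2) *
     ((∏ i, (∏ m ∈ range N, ((bb (a i) m : ℂ) ^ 2 / (bb (a i) m ^ 2 - ζ ^ 2))) ^ k i) *
      cexp (∑ i, c i * ∑ m ∈ range N, (2 * ζ ^ 2 / ((bb (a i) m : ℂ) ^ 2 - ζ ^ 2)))) := by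
  unfold PhiN
  congr 1
  rw [Complex.exp_sum, ← Finset.prod_mul_distrib]
  refine Finset.prod_congr rfl fun i _ => ?_
  rw [Finset.mul_sum, Complex.exp_sum, ← Finset.prod_pow, ← Finset.prod_mul_distrib]
  exact Finset.prod_congr rfl fun m _ => hfac_pow (hk i) _ _ _

lemma tendsto_inv_succ : Tendsto (fun N : ℕ => (1 / (N + 1) : ℝ)) atTop (𝓝 0) :=
  tendsto_one_div_add_atTop_nhds_zero_nat

lemma PhiN_tendsto_gen {a : ι → ℝ} {k : ι → ℕ} (ha : ∀ i, 0 < a i ∧ a i ≤ 1) (hk : ∀ i, 0 < k i)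
    (c : ι → ℝ) {ζ : ℂ} (hζ : ∀ i, (a i * ζ / π : ℂ) ∈ Complex.integerComplement) :
    Tendsto (fun N => PhiN a k c N ζ) atTop (𝓝
      ((∏ i, (a i * ζ / Complex.sin (a i * ζ)) ^ k i) *
        cexp (∑ i, c i * (1 - a i * ζ * (Complex.cos (a i * ζ) / Complex.sin (a i * ζ)))))) := by
  simp_rw [PhiN_eq hk]
  have h0 : Tendsto (fun N : ℕ => cexp (((1 / (N + 1) : ℝ) : ℂ) * ζ ^ 2 / 2)) atTop (𝓝 1) := by
    have : Tendsto (fun N : ℕ => ((1 / (N + 1) : ℝ) : ℂ)) atTop (𝓝 ((0:ℝ):ℂ)) :=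
      (Complex.continuous_ofReal.tendsto 0).comp tendsto_inv_succ
    have := ((this.mul_const (ζ ^ 2)).div_const 2).cexp
    simpa using this
  have h1 := tendsto_finsetProd (f := fun i (N : ℕ) => (∏ m ∈ range N, ((bb (a i) m : ℂ) ^ 2 / (bb (a i) m ^ 2 - ζ ^ 2))) ^ k i)
    (Finset.univ) fun i _ => (lim_prod (ha i).1 (hζ i)).pow (k i)
  have h2 := tendsto_finsetSum (f := fun i (N : ℕ) => (c i : ℂ) * ∑ m ∈ range N, (2 * ζ ^ 2 / ((bb (a i) m : ℂ) ^ 2 - ζ ^ 2)))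
    (Finset.univ) fun i _ => (lim_sum (ha i).1 (hζ i)).const_mul (c i : ℂ)
  have := h0.mul (h1.mul h2.cexp)
  rw [one_mul] at this
  exact this

lemma PhiN_tendsto_imag {a : ι → ℝ} {k : ι → ℕ} (ha : ∀ i, 0 < a i ∧ a i ≤ 1) (hk : ∀ i, 0 < k i)
    (c : ι → ℝ) {x : ℝ} (hx : x ≠ 0) :
    Tendsto (fun N => PhiN a k c N (I * x)) atTop (𝓝 (FI a k c x)) := by
  have h := PhiN_tendsto_gen ha hk c (ζ := I * x) fun i => mem_ic_imag (ha i).1 hx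
  have e : ((FI a k c x : ℝ) : ℂ) = ((∏ i, (a i * (I * x) / Complex.sin (a i * (I * x))) ^ k i) *
        cexp (∑ i, c i * (1 - a i * (I * x) * (Complex.cos (a i * (I * x)) / Complex.sin (a i * (I * x)))))) := by
    unfold FI
    have hs : ∀ i, Complex.sin (a i * (I * x)) = Complex.sinh (a i * x) * I := fun i => by
      rw [← Complex.sin_mul_I]; ring_nf
    have hc : ∀ i, Complex.cos (a i * (I * x)) = Complex.cosh (a i * x) := fun i => by
      rw [← Complex.cos_mul_I]; ring_nf
    have hsn : ∀ i, Complex.sinh (a i * x) ≠ 0 := fun i => by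
      rw [← Complex.ofReal_mul, ← Complex.ofReal_sinh]
      norm_cast
      rw [Real.sinh_eq_zero]
      exact mul_ne_zero (ha i).1.ne' hx
    push_cast
    congr 1
    · refine Finset.prod_congr rfl fun i _ => ?_
      rw [hs]
      have := hsn i
      congr 1
      field_simp [Complex.I_ne_zero]
    · congr 1
      refine Finset.sum_congr rfl fun i _ => ?_
      rw [hs, hc]
      have := hsn i
      field_simp [Complex.I_ne_zero]
  rw [e]
  exact h

/-- the limit of the Laplace transform on the real axis -/
def EE (a : ι → ℝ) (k : ι → ℕ) (c : ι → ℝ) (θ : ℝ) : ℝ :=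
  (∏ i, ((a i * θ) / Real.sin (a i * θ)) ^ k i) *
    Real.exp (∑ i, c i * (1 - a i * θ * (Real.cos (a i * θ) / Real.sin (a i * θ))))

/-- the limit of the derivative of the log Laplace transform -/
def MM (a : ι → ℝ) (k : ι → ℕ) (c : ι → ℝ) (θ : ℝ) : ℝ :=
  ∑ i, (k i * (1 / θ - a i * (Real.cos (a i * θ) / Real.sin (a i * θ))) + c i * (a i * mm (a i * θ)))

lemma LN_tendsto {a : ι → ℝ} {k : ι → ℕ} (ha : ∀ i, 0 < a i ∧ a i ≤ 1) (hk : ∀ i, 0 < k i)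
    (c : ι → ℝ) {θ : ℝ} (h0 : 0 < θ) (h1 : θ < π) :
    Tendsto (fun N => Real.exp (LN a k c N θ)) atTop (𝓝 (EE a k c θ)) := by
  have h := PhiN_tendsto_gen ha hk c (ζ := θ) fun i => mem_ic_real (ha i).1 (ha i).2 h0 h1
  have hθ : |θ| < π := by rwa [abs_of_pos h0]
  simp_rw [PhiN_real ha hk c _ hθ] at h
  have := (Complex.continuous_re.tendsto _).comp h
  have e : ((∏ i, ((a i:ℂ) * θ / Complex.sin (a i * θ)) ^ k i) *
        cexp (∑ i, c i * (1 - a i * θ * (Complex.cos (a i * θ) / Complex.sin (a i * θ))))) = ((EE a k c θ : ℝ) : ℂ) := by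
    unfold EE
    push_cast
    rfl
  rw [e] at this
  exact this

lemma LN1_tendsto {a : ι → ℝ} {k : ι → ℕ} (ha : ∀ i, 0 < a i ∧ a i ≤ 1)
    (c : ι → ℝ) {θ : ℝ} (h0 : 0 < θ) (h1 : θ < π) :
    Tendsto (fun N => LN1 a k c N θ) atTop (𝓝 (MM a k c θ)) := by
  unfold LN1 MM
  have hz := tendsto_inv_succ.mul_const θ
  have h2 : Tendsto (fun N => ∑ i, ∑ m ∈ range N, lf1 (k i) (c i) (bb (a i) m) θ) atTop (𝓝 (MM a k c θ)) := by
    refine tendsto_finsetSum _ fun i _ => ?_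
    have := ((lim_k1 (ha i).1 (ha i).2 h0 h1).const_mul (k i : ℝ)).add ((lim_c1 (ha i).1 (ha i).2 h0 h1).const_mul (c i))
    refine this.congr fun N => ?_
    rw [Finset.mul_sum, Finset.mul_sum, ← Finset.sum_add_distrib]
    rfl
  have := hz.add h2
  rw [zero_mul, zero_add] at this
  exact this

lemma norm_hfac_le {b c x : ℝ} (hb : 0 < b) (hc : 0 ≤ c) : ‖hfac b c (I * x)‖ ≤ b ^ 2 / (b ^ 2 + x ^ 2) := by
  have e : hfac b c (I * x) = ((b ^ 2 / (b ^ 2 + x ^ 2) * Real.exp (-(2 * c * x ^ 2 / (b ^ 2 + x ^ 2))) : ℝ) : ℂ) := by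
    unfold hfac
    push_cast
    rw [mul_pow, Complex.I_sq]
    ring_nf
  rw [e, Complex.norm_real, Real.norm_eq_abs, abs_of_nonneg (by positivity)]
  refine mul_le_of_le_one_right (by positivity) ?_
  rw [Real.exp_le_one_iff]
  have : 0 ≤ 2 * c * x ^ 2 / (b ^ 2 + x ^ 2) := by positivity
  linarith

lemma norm_hfac_le_one {b c x : ℝ} (hb : 0 < b) (hc : 0 ≤ c) : ‖hfac b c (I * x)‖ ≤ 1 := by
  refine (norm_hfac_le hb hc).trans ?_
  rw [div_le_one (by positivity)]
  nlinarith [sq_nonneg x]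

lemma PhiN_norm_le {a : ι → ℝ} {k : ι → ℕ} (ha : ∀ i, 0 < a i ∧ a i ≤ 1) (hk : ∀ i, 0 < k i)
    {c : ι → ℝ} (hc : ∀ i, 0 ≤ c i) {N : ℕ} (hN : 1 ≤ N) (i0 : ι) (x : ℝ) :
    ‖PhiN a k c N (I * x)‖ ≤ (π / a i0) ^ 2 * (1 + x ^ 2)⁻¹ := by
  unfold PhiN
  rw [norm_mul]
  have h1 : ‖cexp (((1 / (N + 1) : ℝ) : ℂ) * (I * x) ^ 2 / 2)‖ ≤ 1 := by
    rw [Complex.norm_exp, Real.exp_le_one_iff]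
    have : ((((1 / (N + 1) : ℝ) : ℂ) * (I * x) ^ 2 / 2)) = ((-((1 / (N + 1) : ℝ) * x ^ 2 / 2) : ℝ) : ℂ) := by
      rw [mul_pow, Complex.I_sq]
      push_cast
      ring
    rw [this, Complex.ofReal_re]
    have : 0 ≤ (1 / (N + 1) : ℝ) * x ^ 2 / 2 := by positivity
    linarith
  have hci : ∀ i, 0 ≤ c i / k i := fun i => by have := hc i; positivity
  have hf1 : ∀ i m, ‖(hfac (bb (a i) m) (c i / k i) (I * x)) ^ k i‖ ≤ 1 := fun i m => by
    rw [norm_pow]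
    exact pow_le_one₀ (norm_nonneg _) (norm_hfac_le_one (bb_pos (ha i).1 m) (hci i))
  refine (mul_le_of_le_one_left (norm_nonneg _) h1).trans ?_
  rw [norm_prod]
  classical
  rw [← Finset.mul_prod_erase _ _ (Finset.mem_univ i0)]
  have hrest : ∏ i ∈ Finset.univ.erase i0, ‖∏ m ∈ range N, (hfac (bb (a i) m) (c i / k i) (I * x)) ^ k i‖ ≤ 1 := by
    refine Finset.prod_le_one (fun _ _ => norm_nonneg _) fun i _ => ?_
    rw [norm_prod]
    exact Finset.prod_le_one (fun _ _ => norm_nonneg _) fun m _ => hf1 i m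
  refine (mul_le_of_le_one_right (norm_nonneg _) hrest).trans ?_
  rw [norm_prod, ← Finset.mul_prod_erase _ _ (Finset.mem_range.2 hN)]
  have hrest2 : ∏ m ∈ (range N).erase 0, ‖(hfac (bb (a i0) m) (c i0 / k i0) (I * x)) ^ k i0‖ ≤ 1 :=
    Finset.prod_le_one (fun _ _ => norm_nonneg _) fun m _ => hf1 i0 m
  refine (mul_le_of_le_one_right (norm_nonneg _) hrest2).trans ?_
  rw [norm_pow]
  have hb := bb_pos (ha i0).1 0
  refine (pow_le_of_le_one (norm_nonneg _) (norm_hfac_le_one hb (hci i0)) (hk i0).ne').trans ?_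
  refine (norm_hfac_le hb (hci i0)).trans ?_
  have hb0 : bb (a i0) 0 = π / a i0 := by unfold bb; simp
  have hb1 := bb_ge_pi (ha i0).1 (ha i0).2 0
  have := Real.pi_gt_three
  rw [← hb0, div_eq_mul_inv]
  gcongr
  nlinarith

lemma FI_continuous (a : ι → ℝ) (k : ι → ℕ) (c : ι → ℝ) : Measurable (FI a k c) := by
  unfold FI
  have := Real.measurable_sinh
  have := Real.measurable_cosh
  fun_prop

lemma PhiN_meas (a : ι → ℝ) (k : ι → ℕ) (c : ι → ℝ) (N : ℕ) :
    Measurable (fun x : ℝ => PhiN a k c N (I * x)) := by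
  unfold PhiN hfac
  fun_prop

lemma PhiN_int [Nonempty ι] {a : ι → ℝ} {k : ι → ℕ} (ha : ∀ i, 0 < a i ∧ a i ≤ 1) (hk : ∀ i, 0 < k i)
    {c : ι → ℝ} (hc : ∀ i, 0 ≤ c i) {N : ℕ} (hN : 1 ≤ N) :
    Integrable (fun x : ℝ => PhiN a k c N (I * x)) := by
  obtain ⟨i0⟩ := ‹Nonempty ι›
  refine Integrable.mono' (integrable_inv_one_add_sq.const_mul ((π / a i0) ^ 2))
    (PhiN_meas a k c N).aestronglyMeasurable (Eventually.of_forall fun x => ?_)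
  exact PhiN_norm_le ha hk hc hN i0 x

lemma fN_tendsto [Nonempty ι] {a : ι → ℝ} {k : ι → ℕ} (ha : ∀ i, 0 < a i ∧ a i ≤ 1) (hk : ∀ i, 0 < k i)
    {c : ι → ℝ} (hc : ∀ i, 0 ≤ c i) {f : ℕ → ℝ → ℝ} (hf : ∀ N, Good (f N) (PhiN a k c N))
    {τ : ℕ → ℝ} {τ0 : ℝ} (hτ : Tendsto τ atTop (𝓝 τ0)) :
    Tendsto (fun N => f N (τ N)) atTop (𝓝 (FF a k c τ0)) := by
  obtain ⟨i0⟩ := id ‹Nonempty ι›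
  have hlim : Tendsto (fun N => ∫ x : ℝ, PhiN a k c N (I * x) * cexp (-(I * x * τ N))) atTop
      (𝓝 (∫ x : ℝ, (FI a k c x : ℂ) * cexp (-(I * x * τ0)))) := by
    refine tendsto_integral_filter_of_dominated_convergence (fun x => (π / a i0) ^ 2 * (1 + x ^ 2)⁻¹) ?_ ?_
      (integrable_inv_one_add_sq.const_mul ((π / a i0) ^ 2)) ?_
    · refine Eventually.of_forall fun N => ((PhiN_meas a k c N).mul ?_).aestronglyMeasurable
      fun_prop
    · filter_upwards [eventually_ge_atTop 1] with N hN
      refine Eventually.of_forall fun x => ?_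
      rw [norm_mul]
      have : ‖cexp (-(I * x * τ N))‖ = 1 := by
        have : -(I * x * τ N) = ((-(x * τ N) : ℝ) : ℂ) * I := by push_cast; ring
        rw [this, Complex.norm_exp_ofReal_mul_I]
      rw [this, mul_one]
      exact PhiN_norm_le ha hk hc hN i0 x
    · have : ∀ᵐ x : ℝ, x ≠ 0 := by simp [ae_iff]
      filter_upwards [this] with x hx
      refine (PhiN_tendsto_imag ha hk c hx).mul ?_
      refine Tendsto.cexp (Tendsto.neg (Tendsto.const_mul _ ?_))
      exact (Complex.continuous_ofReal.tendsto _).comp hτ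
  have h2 : Tendsto (fun N => (f N (τ N) : ℂ)) atTop (𝓝 ((1 / (2 * π) : ℝ) * ∫ x : ℝ, (FI a k c x : ℂ) * cexp (-(I * x * τ0)))) := by
    refine (hlim.const_mul ((1 / (2 * π) : ℝ) : ℂ)).congr' ?_
    filter_upwards [eventually_ge_atTop 1] with N hN
    exact (fourier_pc (hf N) (PhiN_int ha hk hc hN) (τ N)).symm
  have h3 := (Complex.continuous_re.tendsto _).comp h2
  rw [Complex.re_ofReal_mul] at h3
  have e : (∫ x : ℝ, (FI a k c x : ℂ) * cexp (-(I * x * τ0))) = ∫ x : ℝ, (FI a k c x : ℂ) * cexp (I * x * τ0) := by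
    rw [← integral_neg_eq_self]
    simp [FI_even]
  rw [e] at h3
  exact h3

theorem abs_bounds [Nonempty ι] {a : ι → ℝ} {k : ι → ℕ} (ha : ∀ i, 0 < a i ∧ a i ≤ 1) (hk : ∀ i, 0 < k i) :
    ∃ K > 0, ∀ (c : ι → ℝ), (∀ i, 0 ≤ c i) →
      (∀ τ, 0 ≤ FF a k c τ) ∧ ∀ θ, 0 < θ → θ < π →
      (∀ τ, FF a k c τ ≤ 144 * (EE a k c θ * Real.exp (-(θ * τ))) / √(Vb a c θ)) ∧
      EE a k c θ * Real.exp (-(θ * MM a k c θ)) ≤ K * √(Vb a c θ) * FF a k c (MM a k c θ) := by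
  obtain ⟨K, hK, hV⟩ := LN2_upper k ha
  refine ⟨32 * √K, by positivity, fun c hc => ?_⟩
  choose f hf using fun N => exists_good (k := k) ha hc N
  refine ⟨fun τ => ?_, fun θ h0 h1 => ?_⟩
  · exact ge_of_tendsto' (fN_tendsto ha hk hc hf (tendsto_const_nhds (x := τ))) fun N => (hf N).pf.1 τ
  have hθ : |θ| < π := by rwa [abs_of_pos h0]
  have hVb : 0 < Vb a c θ := by
    unfold Vb
    refine Finset.sum_pos (fun i _ => ?_) Finset.univ_nonempty
    have h3 := hc i
    have h2 : 0 < π / a i - θ := by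
      have : π ≤ π / a i := by rw [le_div_iff₀ (ha i).1]; nlinarith [Real.pi_pos, (ha i).2]
      linarith
    positivity
  have hs : ∀ N, 1 ≤ N → _ := fun N hN => (hf N).saddle (fun θ hθ => PhiN_real ha hk c N hθ)
    (fun θ hθ => LN_deriv ha c N hθ) hθ (LN1_deriv ha c N hθ) (hVb.trans_le (LN2_lower ha hk hc hN hθ))
  have hE := LN_tendsto ha hk c h0 h1
  constructor
  · intro τ
    have hl : Tendsto (fun N => 144 * (Real.exp (LN a k c N θ) * Real.exp (-(θ * τ))) / √(Vb a c θ)) atTop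
        (𝓝 (144 * (EE a k c θ * Real.exp (-(θ * τ))) / √(Vb a c θ))) :=
      ((hE.mul_const _).const_mul _).div_const _
    refine le_of_tendsto_of_tendsto (fN_tendsto ha hk hc hf (tendsto_const_nhds (x := τ))) hl ?_
    filter_upwards [eventually_ge_atTop 1] with N hN
    refine ((hs N hN).1 τ).trans ?_
    rw [← Real.exp_add, ← sub_eq_add_neg]
    gcongr
    exact LN2_lower ha hk hc hN hθ
  · have hM := LN1_tendsto (k := k) ha c h0 h1
    have hl : Tendsto (fun N => Real.exp (LN a k c N θ) * Real.exp (-(θ * LN1 a k c N θ))) atTop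
        (𝓝 (EE a k c θ * Real.exp (-(θ * MM a k c θ)))) :=
      hE.mul ((hM.const_mul θ).neg.rexp)
    have hr := (fN_tendsto ha hk hc hf hM).const_mul (32 * √K * √(Vb a c θ))
    refine le_of_tendsto_of_tendsto hl hr ?_
    filter_upwards [eventually_ge_atTop 1] with N hN
    rw [← Real.exp_add, ← sub_eq_add_neg]
    refine ((hs N hN).2).trans ?_
    have hp := (hf N).pf.1 (LN1 a k c N θ)
    refine mul_le_mul_of_nonneg_right ?_ hp
    rw [mul_assoc, ← Real.sqrt_mul hK.le]
    gcongr
    exact hV c hc N θ h0.le h1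

end abs

def hkC (l : ℕ) (k : Fin (l + 1) → ℕ) : ℝ := (2 * (4 * π) ^ ((∑ i, k i) + 1))⁻¹ * (2 * π)

lemma hkC_pos (l : ℕ) (k : Fin (l + 1) → ℕ) : 0 < hkC l k := by
  unfold hkC
  have := Real.pi_pos
  positivity

lemma heat_eq (l : ℕ) (k : Fin (l + 1) → ℕ) (a : Fin (l + 1) → ℝ) (g : Heis l k) :
    heatKernel l k a 1 g = hkC l k * (Real.exp (-∑ j, zNormSq l k g.1 j / 4) *
      FF a k (fun j => zNormSq l k g.1 j / 4) (g.2 / 4)) := by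
  unfold heatKernel heatKernelC FF hkC
  have e : ∀ x : ℝ, ((∏ j, ((a j * x) / Real.sinh (a j * x)) ^ (k j) : ℝ) : ℂ) *
        Complex.exp ((4 * ((1:ℝ) : ℂ))⁻¹ *
          (Complex.I * (x : ℂ) * (g.2 : ℂ) -
            ∑ j, ((zNormSq l k g.1 j : ℝ) : ℂ) *
              ((a j * x * (Real.cosh (a j * x) / Real.sinh (a j * x)) : ℝ) : ℂ)))
      = ((Real.exp (-∑ j, zNormSq l k g.1 j / 4) : ℝ) : ℂ) *
        ((FI a k (fun j => zNormSq l k g.1 j / 4) x : ℂ) * cexp (I * x * ((g.2 / 4 : ℝ) : ℂ))) := by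
    intro x
    unfold FI
    rw [Complex.ofReal_mul, Complex.ofReal_exp, Complex.ofReal_exp]
    have : ∀ A B C D : ℂ, A * (B * C * D) = B * (A * C * D) := fun A B C D => by ring
    rw [this, ← Complex.exp_add, ← Complex.exp_add]
    congr 2
    push_cast
    have h1 : ∀ y : ℂ, (4 * (1:ℂ))⁻¹ * y = y / 4 := fun y => by ring
    rw [h1, sub_div, Finset.sum_div, ← Finset.sum_neg_distrib, ← Finset.sum_add_distrib]
    rw [sub_eq_add_neg, ← Finset.sum_neg_distrib, add_comm]
    congr 1
    · refine Finset.sum_congr rfl fun i _ => ?_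
      ring
    · ring
  simp_rw [e]
  rw [integral_const_mul]
  have h2 : (2 * (4 * (π:ℂ) * ((1:ℝ):ℂ)) ^ ((∑ i, k i) + 1))⁻¹ = (((2 * (4 * π) ^ ((∑ i, k i) + 1))⁻¹ : ℝ) : ℂ) := by
    push_cast
    rw [mul_one]
  rw [h2, Complex.re_ofReal_mul, Complex.re_ofReal_mul]
  have := Real.pi_pos
  generalize (∫ x : ℝ, (FI a k (fun j => zNormSq l k g.1 j / 4) x : ℂ) * cexp (I * x * ((g.2 / 4 : ℝ) : ℂ))).re = R
  field_simp

section schur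
variable {M : Type*} [AddCommGroup M] [Module ℝ M] [Module.Finite ℝ M]

lemma transv_det {V : Type*} [AddCommGroup V] [Module ℝ V] [Module.Finite ℝ V]
    (f : Module.Dual ℝ V) (v : V) (h : f v = 0) : LinearMap.det (LinearMap.transvection f v) = 1 := by
  have := LinearEquiv.transvection.det_eq_one (R := ℝ) (V := V) (f := f) (v := v) h
  have h2 : ((LinearEquiv.transvection h : V ≃ₗ[ℝ] V) : V →ₗ[ℝ] V) = LinearMap.transvection f v := by
    ext x
    rfl
  rw [← h2, ← LinearEquiv.coe_det, this]
  simp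

lemma det_schur (A : M →ₗ[ℝ] M) (B : M →ₗ[ℝ] M) (hAB : A ∘ₗ B = LinearMap.id) (hBA : B ∘ₗ A = LinearMap.id)
    (φ : M →ₗ[ℝ] ℝ) (b : M) (d : ℝ) (T : (M × ℝ) →ₗ[ℝ] (M × ℝ))
    (hT : ∀ h s, T (h, s) = (A h + s • b, φ h + s * d)) :
    LinearMap.det T = LinearMap.det A * (d - φ (B b)) := by
  have hf : T = (LinearMap.transvection (φ ∘ₗ B ∘ₗ LinearMap.fst ℝ M ℝ) ((0:M), (1:ℝ))) ∘ₗ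
      (LinearMap.prodMap A (LinearMap.mulLeft ℝ (d - φ (B b)))) ∘ₗ
      (LinearMap.transvection (LinearMap.snd ℝ M ℝ) ((B b : M), (0:ℝ))) := by
    refine LinearMap.ext fun q => ?_
    obtain ⟨h, s⟩ := q
    rw [hT]
    have h1 : ∀ x, A (B x) = x := fun x => LinearMap.congr_fun hAB x
    have h2 : ∀ x, B (A x) = x := fun x => LinearMap.congr_fun hBA x
    ext
    · simp [LinearMap.transvection.apply, h1]
    · simp [LinearMap.transvection.apply, h1, h2]
      ring
  rw [hf, LinearMap.det_comp, LinearMap.det_comp, transv_det _ _ (by simp), transv_det _ _ (by simp),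
    LinearMap.det_prodMap, LinearMap.det_mulLeft]
  ring
end schur

section diag
variable {l : ℕ} {k : Fin (l + 1) → ℕ}

def dgC (k : Fin (l + 1) → ℕ) (E : Fin (l + 1) → ℂ) :
    ((i : Fin (l + 1)) → Fin (k i) → ℂ) →ₗ[ℂ] ((i : Fin (l + 1)) → Fin (k i) → ℂ) where
  toFun h := fun i j => E i * h i j
  map_add' x y := by ext; simp [mul_add]
  map_smul' c x := by ext; simp; ring

def dg (k : Fin (l + 1) → ℕ) (E : Fin (l + 1) → ℂ) :
    ((i : Fin (l + 1)) → Fin (k i) → ℂ) →ₗ[ℝ] ((i : Fin (l + 1)) → Fin (k i) → ℂ) :=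
  (dgC k E).restrictScalars ℝ

lemma dg_apply (E : Fin (l + 1) → ℂ) (h i j) : dg k E h i j = E i * h i j := rfl

lemma det_dgC (E : Fin (l + 1) → ℂ) : LinearMap.det (dgC k E) = ∏ i, E i ^ k i := by
  classical
  let B := Pi.basis (fun i => Pi.basisFun ℂ (Fin (k i)))
  rw [← LinearMap.det_toMatrix B]
  have : LinearMap.toMatrix B B (dgC k E) = Matrix.diagonal (fun q : (i : Fin (l + 1)) × Fin (k i) => E q.1) := by
    ext ⟨i, j⟩ ⟨i', j'⟩
    rw [LinearMap.toMatrix_apply]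
    simp only [B, Pi.basis_repr, Pi.basisFun_repr, Pi.basis_apply, dgC, LinearMap.coe_mk, AddHom.coe_mk, Matrix.diagonal_apply,
      Pi.basisFun_apply]
    by_cases hi : i = i'
    · subst hi
      by_cases hj : j = j'
      · subst hj
        simp
      · have : (⟨i, j⟩ : (i : Fin (l + 1)) × Fin (k i)) ≠ ⟨i, j'⟩ := by simpa using hj
        simp [this, hj]
    · have : (⟨i, j⟩ : (i : Fin (l + 1)) × Fin (k i)) ≠ ⟨i', j'⟩ := by
        intro h
        exact hi (congrArg Sigma.fst h)
      simp [this, hi]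
  rw [this, Matrix.det_diagonal, Fintype.prod_sigma]
  simp

lemma det_dg (E : Fin (l + 1) → ℂ) : LinearMap.det (dg k E) = ∏ i, (Complex.normSq (E i)) ^ k i := by
  unfold dg
  rw [LinearMap.det_restrictScalars, det_dgC, Algebra.norm_complex_eq]
  simp
end diag

def EX (a η : ℝ) : ℂ := 1 - Complex.exp (-(2 * Complex.I * (a : ℂ) * (η : ℂ)))
def EX' (a η : ℝ) : ℂ := 2 * Complex.I * a * Complex.exp (-(2 * Complex.I * (a : ℂ) * (η : ℂ)))

lemma EX_deriv (a η : ℝ) : HasDerivAt (EX a) (EX' a η) η := by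
  have h1 : HasDerivAt (fun η : ℝ => -(2 * Complex.I * (a : ℂ) * (η : ℂ))) (-(2 * I * a)) η := by
    have := ((Complex.ofRealCLM.hasDerivAt (x := η)).const_mul (2 * I * (a:ℂ))).neg
    exact HasDerivAt.congr_deriv this (by simp)
  have := h1.cexp.const_sub 1
  refine HasDerivAt.congr_deriv this ?_
  unfold EX'
  ring

lemma EX_eq (a η : ℝ) : EX a η = 2 * I * Real.sin (a * η) * (Real.cos (a * η) - I * Real.sin (a * η)) := by
  unfold EX
  have : -(2 * Complex.I * (a : ℂ) * (η : ℂ)) = ((-(2 * (a * η)) : ℝ) : ℂ) * I := by push_cast; ring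
  rw [this, Complex.exp_mul_I, ← Complex.ofReal_cos, ← Complex.ofReal_sin, Real.cos_neg, Real.sin_neg,
    Real.cos_two_mul, Real.sin_two_mul]
  have hsc := Real.sin_sq_add_cos_sq (a * η)
  generalize Real.sin (a * η) = S at *
  generalize Real.cos (a * η) = C at *
  apply Complex.ext
  · simp [← Complex.ofReal_pow]
    nlinarith
  · simp [← Complex.ofReal_pow]

lemma EX'_eq (a η : ℝ) : EX' a η = 2 * I * a * (Real.cos (a * η) - I * Real.sin (a * η)) ^ 2 := by
  unfold EX'
  have : -(2 * Complex.I * (a : ℂ) * (η : ℂ)) = (2:ℕ) * (((-(a * η) : ℝ) : ℂ) * I) := by push_cast; ring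
  rw [this, Complex.exp_nat_mul, Complex.exp_mul_I, ← Complex.ofReal_cos, ← Complex.ofReal_sin, Real.cos_neg, Real.sin_neg]
  push_cast
  ring

lemma EX_normSq (a η : ℝ) : Complex.normSq (EX a η) = 4 * Real.sin (a * η) ^ 2 := by
  rw [EX_eq, Complex.normSq_mul, Complex.normSq_mul, Complex.normSq_mul]
  have : Complex.normSq (Real.cos (a * η) - I * Real.sin (a * η)) = 1 := by
    have hsc := Real.sin_sq_add_cos_sq (a * η)
    generalize Real.sin (a * η) = S at *
    generalize Real.cos (a * η) = C at *
    rw [Complex.normSq_apply]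
    simp
    nlinarith
  rw [this, Complex.normSq_ofReal]
  simp [Complex.normSq_ofNat]
  ring

lemma EX_ratio_re {a η : ℝ} (hs : Real.sin (a * η) ≠ 0) :
    (EX' a η / EX a η).re = a * (Real.cos (a * η) / Real.sin (a * η)) := by
  have hE : (Real.cos (a * η) - I * Real.sin (a * η) : ℂ) ≠ 0 := by
    intro h
    generalize Real.sin (a * η) = S at *
    generalize Real.cos (a * η) = C at *
    have := congrArg Complex.im h
    simp at this
    exact hs this
  have hs' : (Real.sin (a * η) : ℂ) ≠ 0 := by exact_mod_cast hs
  have : EX' a η / EX a η = ((a / Real.sin (a * η) : ℝ) : ℂ) * (Real.cos (a * η) - I * Real.sin (a * η)) := by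
    rw [EX_eq, EX'_eq]
    push_cast at hs' hE ⊢
    field_simp [Complex.I_ne_zero]
  rw [this, Complex.re_ofReal_mul]
  generalize Real.sin (a * η) = S at *
  generalize Real.cos (a * η) = C at *
  simp
  ring

section jac
variable (l : ℕ) (k : Fin (l + 1) → ℕ) (a : Fin (l + 1) → ℝ)

lemma zNormSq_Psi (u : (i : Fin (l + 1)) → Fin (k i) → ℂ) (η : ℝ) (j : Fin (l + 1)) :
    zNormSq l k (Psi l k a u η).1 j = 4 * Real.sin (a j * η) ^ 2 * zNormSq l k u j := by
  unfold zNormSq Psi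
  rw [Finset.mul_sum]
  refine Finset.sum_congr rfl fun i _ => ?_
  rw [Complex.normSq_mul, ← EX_normSq]
  rfl

lemma heat_Psi (u : (i : Fin (l + 1)) → Fin (k i) → ℂ) (η : ℝ) :
    heatKernel l k a 1 (Psi l k a u η) = hkC l k * (Real.exp (-∑ j, Real.sin (a j * η) ^ 2 * zNormSq l k u j) *
      FF a k (fun j => Real.sin (a j * η) ^ 2 * zNormSq l k u j)
        (∑ j, a j * zNormSq l k u j * (a j * η - Real.sin (a j * η) * Real.cos (a j * η)))) := by
  rw [heat_eq]
  have h1 : ∀ j, zNormSq l k (Psi l k a u η).1 j / 4 = Real.sin (a j * η) ^ 2 * zNormSq l k u j := fun j => by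
    rw [zNormSq_Psi]; ring
  simp_rw [h1]
  congr 3
  unfold Psi
  simp only
  rw [Finset.sum_div]
  refine Finset.sum_congr rfl fun j _ => ?_
  have : 2 * a j * η = 2 * (a j * η) := by ring
  rw [this, Real.sin_two_mul]
  ring

/-- the derivative of the last component of `Psi` in the direction `h` -/
def phiL (u : (i : Fin (l + 1)) → Fin (k i) → ℂ) (η : ℝ) :
    ((i : Fin (l + 1)) → Fin (k i) → ℂ) →ₗ[ℝ] ℝ where
  toFun h := ∑ i, 2 * a i * (2 * a i * η - Real.sin (2 * a i * η)) *
    ∑ j, 2 * ((u i j).re * (h i j).re + (u i j).im * (h i j).im)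
  map_add' x y := by
    rw [← Finset.sum_add_distrib]
    refine Finset.sum_congr rfl fun i _ => ?_
    rw [← mul_add, ← Finset.sum_add_distrib]
    congr 1
    refine Finset.sum_congr rfl fun j _ => ?_
    simp
    ring
  map_smul' c x := by
    simp only [RingHom.id_apply, smul_eq_mul, Finset.mul_sum]
    refine Finset.sum_congr rfl fun i _ => Finset.sum_congr rfl fun j _ => ?_
    simp
    ring

lemma Psi_diff (u : (i : Fin (l + 1)) → Fin (k i) → ℂ) (η : ℝ) :
    DifferentiableAt ℝ (fun q : Heis l k => Psi l k a q.1 q.2) (u, η) := by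
  unfold Psi zNormSq
  simp only [Complex.normSq_apply]
  have hre : ∀ i j, Differentiable ℝ (fun q : Heis l k => (q.1 i j).re) := fun i j =>
    Complex.reCLM.differentiable.comp (by fun_prop)
  have him : ∀ i j, Differentiable ℝ (fun q : Heis l k => (q.1 i j).im) := fun i j =>
    Complex.imCLM.differentiable.comp (by fun_prop)
  have hof : Differentiable ℝ (fun q : Heis l k => (q.2 : ℂ)) :=
    Complex.ofRealCLM.differentiable.comp (by fun_prop)
  fun_prop

lemma Psi_fderiv (u : (i : Fin (l + 1)) → Fin (k i) → ℂ) (η : ℝ) (h : (i : Fin (l + 1)) → Fin (k i) → ℂ) (s : ℝ) :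
    fderiv ℝ (fun q : Heis l k => Psi l k a q.1 q.2) (u, η) (h, s) =
      (dg k (fun i => EX (a i) η) h + s • (fun i j => EX' (a i) η * u i j),
        phiL l k a u η h + s * ∑ i, 8 * (a i) ^ 2 * zNormSq l k u i * Real.sin (a i * η) ^ 2) := by
  have hd := (Psi_diff l k a u η).hasFDerivAt
  have hline : HasDerivAt (fun t : ℝ => ((u, η) : Heis l k) + t • ((h, s) : Heis l k)) (h, s) 0 := by
    have := ((hasDerivAt_id (0:ℝ)).smul_const ((h, s) : Heis l k)).const_add ((u, η) : Heis l k)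
    simpa using this
  have hc := HasFDerivAt.comp_hasDerivAt_of_eq (0:ℝ) hd hline (by simp)
  refine hc.unique ?_
  have hx : HasDerivAt (fun t : ℝ => η + t * s) s 0 := by
    have := ((hasDerivAt_id (0:ℝ)).mul_const s).const_add η
    simpa using this
  refine HasDerivAt.prodMk ?_ ?_
  · refine hasDerivAt_pi.2 fun i => hasDerivAt_pi.2 fun j => ?_
    have h1 : HasDerivAt (fun t : ℝ => EX (a i) (η + t * s)) (s • EX' (a i) η) 0 := by
      have := (EX_deriv (a i) (η + 0 * s)).scomp (0:ℝ) hx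
      exact HasDerivAt.congr_deriv this (by simp)
    have h2 : HasDerivAt (fun t : ℝ => u i j + t • h i j) (h i j) 0 := by
      have := ((hasDerivAt_id (0:ℝ)).smul_const (h i j)).const_add (u i j)
      simpa using this
    have := h1.mul h2
    refine HasDerivAt.congr_deriv this ?_
    simp [dg_apply]
    ring
  · have h1 : HasDerivAt (fun t : ℝ => ∑ i, 2 * a i * (∑ j, Complex.normSq (u i j + t • h i j)) *
        (2 * a i * (η + t * s) - Real.sin (2 * a i * (η + t * s))))
        (∑ i, (2 * a i * (∑ j, 2 * ((u i j).re * (h i j).re + (u i j).im * (h i j).im)) *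
          (2 * a i * η - Real.sin (2 * a i * η)) +
          2 * a i * zNormSq l k u i * (2 * a i * s - Real.cos (2 * a i * η) * (2 * a i * s)))) 0 := by
      refine HasDerivAt.fun_sum fun i _ => ?_
      have hn : HasDerivAt (fun t : ℝ => ∑ j, Complex.normSq (u i j + t • h i j))
          (∑ j, 2 * ((u i j).re * (h i j).re + (u i j).im * (h i j).im)) 0 := by
        refine HasDerivAt.fun_sum fun j _ => ?_
        have e : (fun t : ℝ => Complex.normSq (u i j + t • h i j)) = fun t : ℝ =>
            ((u i j).re + t * (h i j).re) ^ 2 + ((u i j).im + t * (h i j).im) ^ 2 := by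
          funext t
          rw [Complex.normSq_apply]
          simp
          ring
        rw [e]
        have r1 : HasDerivAt (fun t : ℝ => (u i j).re + t * (h i j).re) (h i j).re 0 := by
          simpa using ((hasDerivAt_id (0:ℝ)).mul_const (h i j).re).const_add (u i j).re
        have r2 : HasDerivAt (fun t : ℝ => (u i j).im + t * (h i j).im) (h i j).im 0 := by
          simpa using ((hasDerivAt_id (0:ℝ)).mul_const (h i j).im).const_add (u i j).im
        refine HasDerivAt.congr_deriv ((r1.pow 2).add (r2.pow 2)) ?_
        simp
        ring
      have hx2 := hx.const_mul (2 * a i)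
      refine HasDerivAt.congr_deriv ((hn.const_mul (2 * a i)).mul (hx2.sub hx2.sin)) ?_
      simp [zNormSq]
    refine HasDerivAt.congr_deriv h1 ?_
    unfold phiL
    simp only [LinearMap.coe_mk, AddHom.coe_mk]
    rw [Finset.mul_sum, ← Finset.sum_add_distrib]
    refine Finset.sum_congr rfl fun i _ => ?_
    have : 2 * a i * η = 2 * (a i * η) := by ring
    rw [this, Real.cos_two_mul, Real.sin_sq]
    ring

theorem jac_eq (u : (i : Fin (l + 1)) → Fin (k i) → ℂ) (η : ℝ) (hs : ∀ i, Real.sin (a i * η) ≠ 0) :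
    jacPsi l k a u η = (∏ i, (4 * Real.sin (a i * η) ^ 2) ^ k i) *
      ∑ i, 8 * (a i) ^ 2 * zNormSq l k u i * (1 - a i * η * (Real.cos (a i * η) / Real.sin (a i * η))) := by
  unfold jacPsi
  have hE : ∀ i, EX (a i) η ≠ 0 := fun i h => by
    have := EX_normSq (a i) η
    rw [h] at this
    simp at this
    exact hs i this
  rw [det_schur (dg k (fun i => EX (a i) η)) (dg k (fun i => (EX (a i) η)⁻¹)) ?_ ?_ (phiL l k a u η)
    (fun i j => EX' (a i) η * u i j) _ _ (fun h s => Psi_fderiv l k a u η h s), det_dg]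
  · congr 1
    · exact Finset.prod_congr rfl fun i _ => by rw [EX_normSq]
    · unfold phiL
      simp only [LinearMap.coe_mk, AddHom.coe_mk]
      rw [← Finset.sum_sub_distrib]
      refine Finset.sum_congr rfl fun i _ => ?_
      have h1 : ∑ j, 2 * ((u i j).re * (dg k (fun i => (EX (a i) η)⁻¹) (fun i j => EX' (a i) η * u i j) i j).re +
          (u i j).im * (dg k (fun i => (EX (a i) η)⁻¹) (fun i j => EX' (a i) η * u i j) i j).im) =
          2 * (a i * (Real.cos (a i * η) / Real.sin (a i * η))) * zNormSq l k u i := by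
        unfold zNormSq
        rw [Finset.mul_sum]
        refine Finset.sum_congr rfl fun j _ => ?_
        rw [← EX_ratio_re (hs i), dg_apply, ← mul_assoc, ← div_eq_inv_mul, Complex.normSq_apply, Complex.mul_re, Complex.mul_im]
        ring
      rw [h1]
      have : 2 * a i * η = 2 * (a i * η) := by ring
      rw [this, Real.sin_two_mul]
      have := hs i
      field_simp
      linear_combination (8 * (a i) ^ 2 * zNormSq l k u i * Real.sin (a i * η)) * Real.sin_sq_add_cos_sq (a i * η)
  · ext h i j
    simp [dg_apply, hE]
  · ext h i j
    simp [dg_apply, hE]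
end jac

lemma sin_lower {x : ℝ} (h0 : 0 ≤ x) (h1 : x ≤ π) : 2 / π ^ 2 * (x * (π - x)) ≤ Real.sin x := by
  have hp := Real.pi_pos
  have key : ∀ y, 0 ≤ y → y ≤ π / 2 → 2 / π ^ 2 * (y * (π - y)) ≤ Real.sin y := fun y hy hy2 => by
    refine le_trans ?_ (Real.mul_le_sin hy hy2)
    have : 2 / π * y = 2 / π ^ 2 * (y * π) := by field_simp
    rw [this]
    gcongr
    linarith
  rcases le_total x (π / 2) with h | h
  · exact key x h0 h
  · have := key (π - x) (by linarith) (by linarith)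
    rw [Real.sin_pi_sub] at this
    refine le_trans (le_of_eq ?_) this
    ring

lemma sin_upper {x : ℝ} (h0 : 0 ≤ x) (h1 : x ≤ π) : Real.sin x ≤ 2 / π * (x * (π - x)) := by
  have hp := Real.pi_pos
  have key : ∀ y, 0 ≤ y → y ≤ π / 2 → Real.sin y ≤ 2 / π * (y * (π - y)) := fun y hy hy2 => by
    refine (Real.sin_le hy).trans ?_
    have : y = 2 / π * (y * (π / 2)) := by field_simp
    conv_lhs => rw [this]
    gcongr
    linarith
  rcases le_total x (π / 2) with h | h
  · exact key x h0 h
  · have := key (π - x) (by linarith) (by linarith)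
    rw [Real.sin_pi_sub] at this
    refine this.trans (le_of_eq ?_)
    ring

/-- `sin x - x cos x` -/
def SS (x : ℝ) : ℝ := Real.sin x - x * Real.cos x

lemma SS_deriv (x : ℝ) : HasDerivAt SS (x * Real.sin x) x := by
  have := (Real.hasDerivAt_sin x).sub ((hasDerivAt_id x).mul (Real.hasDerivAt_cos x))
  refine HasDerivAt.congr_deriv this ?_
  simp

lemma SS_upper {x : ℝ} (h0 : 0 ≤ x) : SS x ≤ x ^ 3 / 3 := by
  have hd : ∀ y : ℝ, HasDerivAt (fun y => y ^ 3 / 3 - SS y) (y ^ 2 - y * Real.sin y) y := fun y => by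
    have := (((hasDerivAt_id y).pow 3).div_const 3).sub (SS_deriv y)
    refine HasDerivAt.congr_deriv this ?_
    simp
  have hm : MonotoneOn (fun y => y ^ 3 / 3 - SS y) (Set.Ici 0) := by
    refine monotoneOn_of_hasDerivWithinAt_nonneg (convex_Ici 0) (fun y _ => (hd y).continuousAt.continuousWithinAt)
      (fun y _ => (hd y).hasDerivWithinAt) fun y hy => ?_
    rw [interior_Ici] at hy
    have hy' : 0 < y := hy
    nlinarith [Real.sin_le hy'.le]
  have := hm (Set.self_mem_Ici) (Set.mem_Ici.2 h0) h0
  simp [SS] at this ⊢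
  linarith

lemma SS_lower {x : ℝ} (h0 : 0 ≤ x) (h1 : x ≤ π) : x ^ 3 / (6 * π) ≤ SS x := by
  have hp := Real.pi_pos
  have hd : ∀ y : ℝ, HasDerivAt (fun y => SS y - 2 / π ^ 2 * (π * y ^ 3 / 3 - y ^ 4 / 4)) (y * Real.sin y - 2 / π ^ 2 * (π * y ^ 2 - y ^ 3)) y := fun y => by
    have := (SS_deriv y).sub ((((((hasDerivAt_id y).pow 3).const_mul π).div_const 3).sub (((hasDerivAt_id y).pow 4).div_const 4)).const_mul (2 / π ^ 2))
    refine HasDerivAt.congr_deriv this ?_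
    simp
    ring
  have hm : MonotoneOn (fun y => SS y - 2 / π ^ 2 * (π * y ^ 3 / 3 - y ^ 4 / 4)) (Set.Icc 0 π) := by
    refine monotoneOn_of_hasDerivWithinAt_nonneg (convex_Icc 0 π) (fun y _ => (hd y).continuousAt.continuousWithinAt)
      (fun y _ => (hd y).hasDerivWithinAt) fun y hy => ?_
    rw [interior_Icc] at hy
    have := sin_lower hy.1.le hy.2.le
    have h2 := mul_le_mul_of_nonneg_left this hy.1.le
    have e : 2 / π ^ 2 * (π * y ^ 2 - y ^ 3) = y * (2 / π ^ 2 * (y * (π - y))) := by ring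
    linarith
  have := hm (Set.left_mem_Icc.2 hp.le) (Set.mem_Icc.2 ⟨h0, h1⟩) h0
  simp only at this
  have z : SS 0 - 2 / π ^ 2 * (π * 0 ^ 3 / 3 - 0 ^ 4 / 4) = 0 := by simp [SS]
  rw [z] at this
  have e : x ^ 3 / (6 * π) ≤ 2 / π ^ 2 * (π * x ^ 3 / 3 - x ^ 4 / 4) := by
    have : 2 / π ^ 2 * (π * x ^ 3 / 3 - x ^ 4 / 4) - x ^ 3 / (6 * π) = x ^ 3 * (π - x) / (2 * π ^ 2) := by
      field_simp
      ring
    have h : 0 ≤ x ^ 3 * (π - x) / (2 * π ^ 2) := by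
      have : 0 ≤ π - x := by linarith
      positivity
    linarith
  linarith

lemma SS_nonneg {x : ℝ} (h0 : 0 ≤ x) (h1 : x ≤ π) : 0 ≤ SS x :=
  le_trans (by have := Real.pi_pos; positivity) (SS_lower h0 h1)

lemma one_sub_cot {x : ℝ} (hs : Real.sin x ≠ 0) : 1 - x * (Real.cos x / Real.sin x) = SS x / Real.sin x := by
  unfold SS
  field_simp

lemma mm_deriv {x : ℝ} (hs : Real.sin x ≠ 0) : HasDerivAt mm (2 * SS x / Real.sin x ^ 3) x := by
  have h1 := (hasDerivAt_id x).sub ((Real.hasDerivAt_sin x).mul (Real.hasDerivAt_cos x))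
  have := h1.div ((Real.hasDerivAt_sin x).pow 2) (pow_ne_zero 2 hs)
  refine HasDerivAt.congr_deriv this ?_
  unfold SS
  simp
  field_simp
  have := Real.sin_sq_add_cos_sq x
  linear_combination (Real.sin x) * this

lemma mm_mono : MonotoneOn mm (Set.Ioo 0 π) := by
  refine monotoneOn_of_hasDerivWithinAt_nonneg (f' := fun x => 2 * SS x / Real.sin x ^ 3) (convex_Ioo 0 π)
    (fun y hy => (mm_deriv (Real.sin_pos_of_pos_of_lt_pi hy.1 hy.2).ne').continuousAt.continuousWithinAt)
      (fun y hy => ?_) fun y hy => ?_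
  · rw [interior_Ioo] at hy
    exact (mm_deriv (Real.sin_pos_of_pos_of_lt_pi hy.1 hy.2).ne').hasDerivWithinAt
  · rw [interior_Ioo] at hy
    have := (Real.sin_pos_of_pos_of_lt_pi hy.1 hy.2)
    have := SS_nonneg hy.1.le hy.2.le
    positivity

lemma mm_half {y : ℝ} (h0 : 0 < y) (h1 : y < π) :
    Real.sin y ^ 2 * (mm y - mm (y / 2)) = SS y := by
  have hs := (Real.sin_pos_of_pos_of_lt_pi h0 h1).ne'
  have hs2 : Real.sin (y / 2) ≠ 0 := (Real.sin_pos_of_pos_of_lt_pi (by linarith) (by linarith)).ne'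
  unfold mm SS
  have e1 : Real.sin y = 2 * Real.sin (y / 2) * Real.cos (y / 2) := by
    rw [← Real.sin_two_mul]; ring_nf
  have e2 : Real.cos y = 2 * Real.cos (y / 2) ^ 2 - 1 := by
    rw [← Real.cos_two_mul]; ring_nf
  have hc2 : Real.cos (y / 2) ≠ 0 := by
    intro h
    rw [e1, h, mul_zero] at hs
    exact hs rfl
  rw [e1, e2]
  field_simp
  ring

lemma mm_le {x : ℝ} (h0 : 0 < x) (h1 : x ≤ π / 2) : mm x ≤ x := by
  have hp := Real.pi_pos
  have hs := (Real.sin_pos_of_pos_of_lt_pi h0 (by linarith))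
  have hc : 0 ≤ Real.cos x := Real.cos_nonneg_of_mem_Icc ⟨by linarith, h1⟩
  have := SS_nonneg h0.le (by linarith : x ≤ π)
  unfold mm
  unfold SS at this
  rw [div_le_iff₀ (by positivity)]
  have h2 := mul_nonneg hc this
  have h3 : x * Real.sin x ^ 2 = x - x * Real.cos x ^ 2 := by rw [Real.sin_sq]; ring
  rw [h3]
  nlinarith

/-- exponent function -/
def gg (y x : ℝ) : ℝ := Real.sin y ^ 2 * (x * (Real.cos x / Real.sin x)) + x * (y - Real.sin y * Real.cos y)

lemma gg_half {y : ℝ} (h0 : 0 < y) (h1 : y < π) : y ^ 2 / 2 ≤ gg y (y / 2) := by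
  have hs := (Real.sin_pos_of_pos_of_lt_pi h0 h1)
  have hs2 : Real.sin (y / 2) ≠ 0 := (Real.sin_pos_of_pos_of_lt_pi (by linarith) (by linarith)).ne'
  have e1 : Real.sin y = 2 * Real.sin (y / 2) * Real.cos (y / 2) := by
    rw [← Real.sin_two_mul]; ring_nf
  have e2 : Real.cos y = 2 * Real.cos (y / 2) ^ 2 - 1 := by
    rw [← Real.cos_two_mul]; ring_nf
  have : gg y (y / 2) = y ^ 2 / 2 + y / 2 * Real.sin y := by
    unfold gg
    rw [e2, e1]
    field_simp
    ring
  rw [this]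
  have : 0 ≤ y / 2 * Real.sin y := by positivity
  linarith

lemma gg_le {y x : ℝ} (h0 : 0 < x) (h1 : x ≤ y / 2) (h2 : y < π) : gg y x ≤ 3 * y ^ 2 := by
  have hp := Real.pi_pos
  have hy : 0 < y := by linarith
  have hs := (Real.sin_pos_of_pos_of_lt_pi hy h2)
  have hsx := (Real.sin_pos_of_pos_of_lt_pi h0 (by linarith))
  unfold gg
  have e1 : x * (Real.cos x / Real.sin x) ≤ 1 := by
    have := one_sub_cot hsx.ne'
    have h3 : 0 ≤ SS x / Real.sin x := div_nonneg (SS_nonneg h0.le (by linarith)) hsx.le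
    linarith
  have e2 : Real.sin y ^ 2 ≤ y ^ 2 := pow_le_pow_left₀ hs.le (Real.sin_le hy.le) 2
  have e3 : y - Real.sin y * Real.cos y ≤ 2 * y := by
    have := Real.sin_le hy.le
    have := Real.neg_one_le_cos y
    nlinarith
  have e4 : Real.sin y ^ 2 * (x * (Real.cos x / Real.sin x)) ≤ y ^ 2 := by
    nlinarith [sq_nonneg (Real.sin y)]
  have e5 : x * (y - Real.sin y * Real.cos y) ≤ x * (2 * y) := mul_le_mul_of_nonneg_left e3 h0.le
  nlinarith

lemma gg_deriv {d x : ℝ} (hs : Real.sin x ≠ 0) :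
    HasDerivAt (fun x => gg (x + d) x) (2 * x + d + Real.sin d * Real.cos d - Real.sin d ^ 2 * mm x) x := by
  have e : ∀ y, Real.sin y ≠ 0 → gg (y + d) y = y * (y + d) + y * (Real.sin d * Real.cos d) + Real.sin d ^ 2 * (y * (Real.cos y / Real.sin y)) := by
    intro y hy
    unfold gg
    rw [Real.sin_add, Real.cos_add]
    field_simp
    have h1 := Real.sin_sq_add_cos_sq y
    have h2 := Real.sin_sq_add_cos_sq d
    have e1 : Real.cos y ^ 2 = 1 - Real.sin y ^ 2 := by linarith
    have e2 : Real.cos d ^ 2 = 1 - Real.sin d ^ 2 := by linarith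
    linear_combination (y * (Real.sin y * Real.cos d + Real.cos y * Real.sin d) * Real.sin d) * h1
  have h1 : HasDerivAt (fun y => y * (y + d) + y * (Real.sin d * Real.cos d) + Real.sin d ^ 2 * (y * (Real.cos y / Real.sin y)))
      (2 * x + d + Real.sin d * Real.cos d - Real.sin d ^ 2 * mm x) x := by
    have i := hasDerivAt_id x
    have := ((i.mul (i.add_const d)).add (i.mul_const (Real.sin d * Real.cos d))).add
      ((i.mul ((Real.hasDerivAt_cos x).div (Real.hasDerivAt_sin x) hs)).const_mul (Real.sin d ^ 2))
    refine HasDerivAt.congr_deriv this ?_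
    unfold mm
    simp
    field_simp
    have h2 := Real.sin_sq_add_cos_sq x
    linear_combination (-(x * Real.sin d ^ 2)) * h2
  refine h1.congr_of_eventuallyEq ?_
  have : ∀ᶠ y in 𝓝 x, Real.sin y ≠ 0 := (Real.continuous_sin.tendsto x).eventually_ne hs
  filter_upwards [this] with y hy using e y hy

lemma gg_deriv_lower {d x : ℝ} (hd : 0 ≤ d) (hx : d ≤ x) (hx0 : 0 < x) (h : x + d < π) :
    (x + d) / 3 ≤ 2 * x + d + Real.sin d * Real.cos d - Real.sin d ^ 2 * mm x := by
  have hp := Real.pi_pos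
  have hs := (Real.sin_pos_of_pos_of_lt_pi hx0 (by linarith))
  have hsd : Real.sin d ≤ Real.sin x := by
    rcases le_total x (π / 2) with h1 | h1
    · exact Real.sin_le_sin_of_le_of_le_pi_div_two (by linarith) h1 hx
    · rw [← Real.sin_pi_sub x]
      exact Real.sin_le_sin_of_le_of_le_pi_div_two (by linarith) (by linarith) (by linarith)
  have hsd0 : 0 ≤ Real.sin d := Real.sin_nonneg_of_nonneg_of_le_pi hd (by linarith)
  have hnum : 0 ≤ x - Real.sin x * Real.cos x := by
    have h1 := Real.sin_le hx0.le
    have h2 := Real.cos_le_one x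
    nlinarith
  have h1 : Real.sin d ^ 2 * mm x ≤ x - Real.sin x * Real.cos x := by
    unfold mm
    rw [mul_div_assoc', div_le_iff₀ (by positivity), mul_comm]
    exact mul_le_mul_of_nonneg_left (pow_le_pow_left₀ hsd0 hsd 2) hnum
  have h2 : Real.sin d * Real.cos d + Real.sin x * Real.cos x = Real.sin (x + d) * Real.cos (x - d) := by
    rw [Real.sin_add, Real.cos_sub]
    have h1 := Real.sin_sq_add_cos_sq x
    have h2 := Real.sin_sq_add_cos_sq d
    linear_combination (-(Real.sin d * Real.cos d)) * h1 - (Real.sin x * Real.cos x) * h2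
  have h3 : -(2 / 3 * (x + d)) ≤ Real.sin (x + d) * Real.cos (x - d) := by
    have hsX : 0 ≤ Real.sin (x + d) := Real.sin_nonneg_of_nonneg_of_le_pi (by linarith) h.le
    rcases le_total (x - d) (π / 2) with h4 | h4
    · have := Real.cos_nonneg_of_mem_Icc ⟨by linarith, h4⟩
      have := mul_nonneg hsX this
      linarith
    · have h5 := Real.sin_le_one (x + d)
      have h6 := Real.neg_one_le_cos (x - d)
      have := Real.pi_gt_three
      nlinarith
  linarith

lemma gg_incr {d x1 x2 : ℝ} (hd : 0 ≤ d) (hx : d ≤ x1) (hx0 : 0 < x1) (h12 : x1 ≤ x2) (h : x2 + d < π) :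
    gg (x1 + d) x1 + (x1 + d) / 3 * (x2 - x1) ≤ gg (x2 + d) x2 := by
  have hder : ∀ y ∈ Set.Icc x1 x2, HasDerivAt (fun x => gg (x + d) x - (x1 + d) / 3 * x)
      (2 * y + d + Real.sin d * Real.cos d - Real.sin d ^ 2 * mm y - (x1 + d) / 3) y := fun y hy => by
    have hs := (Real.sin_pos_of_pos_of_lt_pi (hx0.trans_le hy.1) (by linarith [hy.2]))
    have := (gg_deriv (d := d) hs.ne').sub ((hasDerivAt_id y).const_mul ((x1 + d) / 3))
    refine HasDerivAt.congr_deriv this ?_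
    simp
  have hm : MonotoneOn (fun x => gg (x + d) x - (x1 + d) / 3 * x) (Set.Icc x1 x2) := by
    refine monotoneOn_of_hasDerivWithinAt_nonneg (convex_Icc x1 x2) (fun y hy => (hder y hy).continuousAt.continuousWithinAt)
      (fun y hy => (hder y (interior_subset hy)).hasDerivWithinAt) fun y hy => ?_
    have hy' := interior_subset hy
    have := gg_deriv_lower (d := d) (x := y) hd (hx.trans hy'.1) (hx0.trans_le hy'.1) (by linarith [hy'.2])
    linarith [hy'.1]
  have := hm (Set.left_mem_Icc.2 h12) (Set.right_mem_Icc.2 h12) h12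
  simp only at this
  linarith

section cmp
variable {ι : Type*} [Fintype ι]

/-- transported weights -/
def cw (a w : ι → ℝ) (ω : ℝ) : ι → ℝ := fun i => Real.sin (a i * ω) ^ 2 * w i
/-- transported central variable -/
def tw (a w : ι → ℝ) (ω : ℝ) : ℝ := ∑ i, a i * w i * (a i * ω - Real.sin (a i * ω) * Real.cos (a i * ω))
/-- prefactor -/
def AA (a : ι → ℝ) (k : ι → ℕ) (θ : ℝ) : ℝ := ∏ i, ((a i * θ) / Real.sin (a i * θ)) ^ k i
/-- exponent -/
def GG (a w : ι → ℝ) (ω θ : ℝ) : ℝ := ∑ i, w i * gg (a i * ω) (a i * θ)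
/-- heat kernel part -/
def HH (a : ι → ℝ) (k : ι → ℕ) (w : ι → ℝ) (ω : ℝ) : ℝ :=
  Real.exp (-∑ i, cw a w ω i) * FF a k (cw a w ω) (tw a w ω)
/-- jacobian part -/
def JJ (a : ι → ℝ) (k : ι → ℕ) (w : ι → ℝ) (ω : ℝ) : ℝ :=
  (∏ i, (4 * Real.sin (a i * ω) ^ 2) ^ k i) *
    ∑ i, 8 * (a i) ^ 2 * w i * (1 - a i * ω * (Real.cos (a i * ω) / Real.sin (a i * ω)))

lemma exp_EE (a : ι → ℝ) (k : ι → ℕ) (w : ι → ℝ) (ω θ : ℝ) :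
    Real.exp (-∑ i, cw a w ω i) * (EE a k (cw a w ω) θ * Real.exp (-(θ * tw a w ω))) =
      AA a k θ * Real.exp (-GG a w ω θ) := by
  unfold EE AA GG tw
  have : ∀ A x y z : ℝ, Real.exp x * (A * Real.exp y * Real.exp z) = A * Real.exp (x + y + z) := by
    intro A x y z
    rw [Real.exp_add, Real.exp_add]; ring
  rw [this]
  congr 2
  rw [Finset.mul_sum, ← Finset.sum_neg_distrib, ← Finset.sum_neg_distrib, ← Finset.sum_neg_distrib,
    ← Finset.sum_add_distrib, ← Finset.sum_add_distrib]
  refine Finset.sum_congr rfl fun i _ => ?_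
  unfold cw gg
  ring

lemma cw_nonneg {a w : ι → ℝ} (hw : ∀ i, 0 ≤ w i) (ω : ℝ) (i : ι) : 0 ≤ cw a w ω i :=
  mul_nonneg (sq_nonneg _) (hw i)

lemma axr {a : ℝ} (h : 0 < a ∧ a ≤ 1) {ω : ℝ} (h0 : 0 < ω) (h1 : ω < π) : 0 < a * ω ∧ a * ω < π :=
  ⟨mul_pos h.1 h0, by nlinarith⟩

lemma eps_pos {a : ℝ} (h : 0 < a ∧ a ≤ 1) {ω : ℝ} (h1 : ω < π) : 0 < π / a - ω := by
  have : π ≤ π / a := by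
    rw [le_div_iff₀ h.1]
    nlinarith [Real.pi_pos, h.2]
  linarith

lemma eps_mul {a : ℝ} (h : 0 < a) (ω : ℝ) : π - a * ω = a * (π / a - ω) := by
  field_simp

lemma JJ_nonneg {a : ι → ℝ} (k : ι → ℕ) {w : ι → ℝ} (ha : ∀ i, 0 < a i ∧ a i ≤ 1) (hw : ∀ i, 0 ≤ w i)
    {ω : ℝ} (h0 : 0 < ω) (h1 : ω < π) : 0 ≤ JJ a k w ω := by
  unfold JJ
  refine mul_nonneg (Finset.prod_nonneg fun i _ => by positivity) (Finset.sum_nonneg fun i _ => ?_)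
  obtain ⟨h2, h3⟩ := axr (ha i) h0 h1
  have hs := Real.sin_pos_of_pos_of_lt_pi h2 h3
  rw [one_sub_cot hs.ne']
  have := SS_nonneg h2.le h3.le
  have := hw i
  positivity

/-- ratio of sines -/
lemma sin_ratio {a : ℝ} (h : 0 < a ∧ a ≤ 1) {η ω : ℝ} (h0 : 0 < η) (h1 : η < π) (h2 : 0 < ω) (h3 : ω < π) :
    Real.sin (a * ω) ≤ π * (ω / η) * ((π / a - ω) / (π / a - η)) * Real.sin (a * η) := by
  have hp := Real.pi_pos
  obtain ⟨a1, a2⟩ := axr h h0 h1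
  obtain ⟨b1, b2⟩ := axr h h2 h3
  have e1 := eps_pos h h1
  have e2 := eps_pos h h3
  have u := sin_upper b1.le b2.le
  have d := sin_lower a1.le a2.le
  rw [eps_mul h.1] at u d
  refine u.trans ?_
  have h4 : 0 ≤ π * (ω / η) * ((π / a - ω) / (π / a - η)) := by positivity
  refine le_trans (le_of_eq ?_) (mul_le_mul_of_nonneg_left d h4)
  have := h.1
  generalize (π / a - ω) = x at *
  generalize (π / a - η) = y at *
  field_simp

lemma cot_upper {a : ℝ} (h : 0 < a ∧ a ≤ 1) {ω : ℝ} (h2 : 0 < ω) (h3 : ω < π) :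
    1 - a * ω * (Real.cos (a * ω) / Real.sin (a * ω)) ≤ π ^ 2 * a * ω ^ 2 / (6 * (π / a - ω)) := by
  have hp := Real.pi_pos
  obtain ⟨b1, b2⟩ := axr h h2 h3
  have e2 := eps_pos h h3
  have hs := Real.sin_pos_of_pos_of_lt_pi b1 b2
  rw [one_sub_cot hs.ne']
  have d := sin_lower b1.le b2.le
  rw [eps_mul h.1] at d
  have u := SS_upper b1.le
  rw [div_le_iff₀ hs]
  refine u.trans ?_
  have := h.1
  refine le_trans (le_of_eq ?_) (mul_le_mul_of_nonneg_left d (by positivity))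
  generalize (π / a - ω) = x at *
  field_simp
  norm_num

lemma cot_lower {a : ℝ} (h : 0 < a ∧ a ≤ 1) {ω : ℝ} (h2 : 0 < ω) (h3 : ω < π) :
    a * ω ^ 2 / (12 * (π / a - ω)) ≤ 1 - a * ω * (Real.cos (a * ω) / Real.sin (a * ω)) := by
  have hp := Real.pi_pos
  obtain ⟨b1, b2⟩ := axr h h2 h3
  have e2 := eps_pos h h3
  have hs := Real.sin_pos_of_pos_of_lt_pi b1 b2
  rw [one_sub_cot hs.ne']
  have d := sin_upper b1.le b2.le
  rw [eps_mul h.1] at d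
  have u := SS_lower b1.le b2.le
  rw [le_div_iff₀ hs]
  refine le_trans ?_ u
  have := h.1
  refine le_trans (mul_le_mul_of_nonneg_left d (by positivity)) (le_of_eq ?_)
  generalize (π / a - ω) = x at *
  field_simp
  norm_num

lemma xs_upper {a : ℝ} (h : 0 < a ∧ a ≤ 1) {ω : ℝ} (h2 : 0 < ω) (h3 : ω < π) :
    (a * ω) / Real.sin (a * ω) ≤ π ^ 2 / (2 * a * (π / a - ω)) := by
  have hp := Real.pi_pos
  obtain ⟨b1, b2⟩ := axr h h2 h3
  have e2 := eps_pos h h3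
  have hs := Real.sin_pos_of_pos_of_lt_pi b1 b2
  have d := sin_lower b1.le b2.le
  rw [eps_mul h.1] at d
  rw [div_le_iff₀ hs]
  have := h.1
  refine le_trans (le_of_eq ?_) (mul_le_mul_of_nonneg_left d (by positivity))
  generalize (π / a - ω) = x at *
  field_simp

lemma xs_lower {a : ℝ} (h : 0 < a ∧ a ≤ 1) {ω : ℝ} (h2 : 0 < ω) (h3 : ω < π) :
    π / (2 * a * (π / a - ω)) ≤ (a * ω) / Real.sin (a * ω) := by
  have hp := Real.pi_pos
  obtain ⟨b1, b2⟩ := axr h h2 h3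
  have e2 := eps_pos h h3
  have hs := Real.sin_pos_of_pos_of_lt_pi b1 b2
  have d := sin_upper b1.le b2.le
  rw [eps_mul h.1] at d
  rw [le_div_iff₀ hs]
  have := h.1
  refine le_trans (mul_le_mul_of_nonneg_left d (by positivity)) (le_of_eq ?_)
  generalize (π / a - ω) = x at *
  field_simp

/-- combination -/
lemma combine {a : ι → ℝ} {k : ι → ℕ} {w : ι → ℝ} {K : ℝ} (hK : 0 < K) {η ω θ θ' RA RV RJ X : ℝ}
    (hup : HH a k w ω ≤ 144 * (AA a k θ' * Real.exp (-GG a w ω θ')) / √(Vb a (cw a w ω) θ'))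
    (hlo : AA a k θ * Real.exp (-GG a w η θ) ≤ K * √(Vb a (cw a w η) θ) * HH a k w η)
    (hA : AA a k θ' ≤ RA * AA a k θ) (hG : GG a w η θ + X ≤ GG a w ω θ')
    (hRA : 0 ≤ RA) (hAA : 0 ≤ AA a k θ) (hRV : 0 ≤ RV) (hRJ : 0 ≤ RJ) (hVp : 0 < Vb a (cw a w ω) θ')
    (hV : Vb a (cw a w η) θ ≤ RV ^ 2 * Vb a (cw a w ω) θ')
    (hJ : JJ a k w ω ≤ RJ * JJ a k w η) (hJ0 : 0 ≤ JJ a k w ω) (hJ1 : 0 ≤ JJ a k w η) (hH : 0 ≤ HH a k w η) :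
    HH a k w ω * JJ a k w ω ≤ 144 * K * (RA * RV * RJ) * Real.exp (-X) * (HH a k w η * JJ a k w η) := by
  have hsq : 0 < √(Vb a (cw a w ω) θ') := Real.sqrt_pos.2 hVp
  have hV' : √(Vb a (cw a w η) θ) ≤ RV * √(Vb a (cw a w ω) θ') := by
    rw [← Real.sqrt_sq hRV, ← Real.sqrt_mul (sq_nonneg _)]
    exact Real.sqrt_le_sqrt hV
  have hE : Real.exp (-GG a w ω θ') ≤ Real.exp (-X) * Real.exp (-GG a w η θ) := by
    rw [← Real.exp_add]
    exact Real.exp_le_exp.2 (by linarith)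
  have h1 : AA a k θ' * Real.exp (-GG a w ω θ') ≤ RA * AA a k θ * (Real.exp (-X) * Real.exp (-GG a w η θ)) :=
    mul_le_mul hA hE (Real.exp_pos _).le (mul_nonneg hRA hAA)
  have h2 : RA * AA a k θ * (Real.exp (-X) * Real.exp (-GG a w η θ)) ≤
      RA * Real.exp (-X) * (K * (RV * √(Vb a (cw a w ω) θ')) * HH a k w η) := by
    have : RA * AA a k θ * (Real.exp (-X) * Real.exp (-GG a w η θ)) =
      RA * Real.exp (-X) * (AA a k θ * Real.exp (-GG a w η θ)) := by ring
    rw [this]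
    refine mul_le_mul_of_nonneg_left (hlo.trans ?_) (by positivity)
    gcongr
  have h3 : HH a k w ω ≤ 144 * K * (RA * RV) * Real.exp (-X) * HH a k w η := by
    refine hup.trans ?_
    rw [div_le_iff₀ hsq]
    nlinarith [h1.trans h2]
  calc _ ≤ (144 * K * (RA * RV) * Real.exp (-X) * HH a k w η) * (RJ * JJ a k w η) :=
        mul_le_mul h3 hJ hJ0 (by positivity)
    _ = _ := by ring

end cmp

section cmpA
variable {ι : Type*} [Fintype ι]

/-- ratio of distances to the pole -/
def rr (a η ω : ℝ) : ℝ := (π / a - ω) / (π / a - η)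

lemma rr_pos {a : ℝ} (h : 0 < a ∧ a ≤ 1) {η ω : ℝ} (h1 : η < π) (h3 : ω < π) : 0 < rr a η ω :=
  div_pos (eps_pos h h3) (eps_pos h h1)

lemma rr_le_one {a : ℝ} (h : 0 < a ∧ a ≤ 1) {η ω : ℝ} (h1 : η ≤ ω) (h3 : ω < π) : rr a η ω ≤ 1 := by
  unfold rr
  rw [div_le_one (eps_pos h (by linarith))]
  linarith

lemma rr_one_le {a : ℝ} (h : 0 < a ∧ a ≤ 1) {η ω : ℝ} (h1 : η ≤ ω) (h3 : ω < π) : rr 1 η ω ≤ rr a η ω := by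
  unfold rr
  have e1 : 0 < π / a - η := eps_pos h (by linarith)
  have e2 : π ≤ π / a := by
    rw [le_div_iff₀ h.1]
    nlinarith [Real.pi_pos, h.2]
  rw [div_one, div_le_div_iff₀ (by linarith) e1]
  nlinarith

lemma rr_shift {a : ℝ} (h : 0 < a ∧ a ≤ 1) {η ω δ : ℝ} (hd : 0 ≤ δ) (h1 : η ≤ ω) (h3 : ω < π) :
    rr a η ω ≤ rr a (η - δ) (ω - δ) := by
  unfold rr
  have e1 : 0 < π / a - η := eps_pos h (by linarith)
  rw [div_le_div_iff₀ e1 (by linarith)]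
  nlinarith

lemma rr_quot {a : ℝ} (h : 0 < a ∧ a ≤ 1) {η ω δ : ℝ} (hd : 0 ≤ δ) (h1 : η ≤ ω) (h3 : ω < π) :
    rr a (η - δ) (ω - δ) / rr a η ω ≤ rr 1 (η - δ) (ω - δ) / rr 1 η ω := by
  have key : ∀ b, π ≤ b → (b - (ω - δ)) / (b - (η - δ)) / ((b - ω) / (b - η)) =
      1 + (ω - η) * δ / ((b - ω) * (b - (η - δ))) := by
    intro b hb
    have e1 : b - (η - δ) ≠ 0 := by linarith
    have e2 : b - ω ≠ 0 := by linarith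
    have e3 : b - η ≠ 0 := by linarith
    field_simp
    ring
  have e2 : π ≤ π / a := by
    rw [le_div_iff₀ h.1]
    nlinarith [Real.pi_pos, h.2]
  unfold rr
  rw [key _ e2, key (π / 1) (by simp)]
  have e3 : 0 ≤ ω - η := by linarith
  rw [div_one]
  have e4 : 0 < π - ω := by linarith
  have e5 : 0 < π - (η - δ) := by linarith
  have e6 : 0 ≤ π / a - ω := by linarith
  gcongr

lemma JJ_ratio {a : ι → ℝ} (k : ι → ℕ) {w : ι → ℝ} (ha : ∀ i, 0 < a i ∧ a i ≤ 1) (hw : ∀ i, 0 ≤ w i)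
    {η ω : ℝ} (h0 : 0 < η) (h1 : η ≤ ω) (h3 : ω < π) :
    JJ a k w ω ≤ ((∏ i, (π * (ω / η) * rr (a i) η ω) ^ (2 * k i)) * (2 * π ^ 2 * (ω / η) ^ 2 / rr 1 η ω)) *
      JJ a k w η := by
  have hp := Real.pi_pos
  have hω : 0 < ω := by linarith
  have hη : η < π := by linarith
  have r1 : 0 < rr 1 η ω := rr_pos ⟨one_pos, le_rfl⟩ hη h3
  have hP : ∏ i, (4 * Real.sin (a i * ω) ^ 2) ^ k i ≤
      (∏ i, (π * (ω / η) * rr (a i) η ω) ^ (2 * k i)) * ∏ i, (4 * Real.sin (a i * η) ^ 2) ^ k i := by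
    rw [← Finset.prod_mul_distrib]
    refine Finset.prod_le_prod (fun i _ => by positivity) fun i _ => ?_
    rw [pow_mul, ← mul_pow]
    refine pow_le_pow_left₀ (by positivity) ?_ _
    obtain ⟨b1, b2⟩ := axr (ha i) hω h3
    have hs := Real.sin_pos_of_pos_of_lt_pi b1 b2
    have := pow_le_pow_left₀ hs.le (sin_ratio (ha i) h0 hη hω h3) 2
    unfold rr
    rw [mul_pow] at this
    linarith
  have hS : ∑ i, 8 * (a i) ^ 2 * w i * (1 - a i * ω * (Real.cos (a i * ω) / Real.sin (a i * ω))) ≤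
      (2 * π ^ 2 * (ω / η) ^ 2 / rr 1 η ω) *
      ∑ i, 8 * (a i) ^ 2 * w i * (1 - a i * η * (Real.cos (a i * η) / Real.sin (a i * η))) := by
    rw [Finset.mul_sum]
    refine Finset.sum_le_sum fun i _ => ?_
    have u := cot_upper (ha i) hω h3
    have d := cot_lower (ha i) h0 hη
    have hwi := hw i
    have r2 := rr_pos (ha i) hη h3
    have r3 := rr_one_le (ha i) h1 h3
    have e1 := eps_pos (ha i) hη
    have e2 := eps_pos (ha i) h3
    have ai := (ha i).1
    have hq : 1 - a i * ω * (Real.cos (a i * ω) / Real.sin (a i * ω)) ≤ (2 * π ^ 2 * (ω / η) ^ 2 / rr 1 η ω) * (1 - a i * η * (Real.cos (a i * η) / Real.sin (a i * η))) := by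
      refine u.trans ?_
      refine le_trans ?_ (mul_le_mul_of_nonneg_left d (by positivity))
      have : π ^ 2 * a i * ω ^ 2 / (6 * (π / a i - ω)) = (2 * π ^ 2 * (ω / η) ^ 2 / rr (a i) η ω) * (a i * η ^ 2 / (12 * (π / a i - η))) := by
        unfold rr
        generalize (π / a i - ω) = x at *
        generalize (π / a i - η) = y at *
        field_simp
        norm_num
      rw [this]
      gcongr
    have := mul_le_mul_of_nonneg_left hq (by positivity : 0 ≤ 8 * (a i) ^ 2 * w i)
    linarith
  unfold JJ
  have hS0 : 0 ≤ ∑ i, 8 * (a i) ^ 2 * w i * (1 - a i * ω * (Real.cos (a i * ω) / Real.sin (a i * ω))) := by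
    refine Finset.sum_nonneg fun i _ => ?_
    have d := cot_lower (ha i) hω h3
    have e2 := eps_pos (ha i) h3
    have ai := (ha i).1
    have hwi := hw i
    have : 0 ≤ 1 - a i * ω * (Real.cos (a i * ω) / Real.sin (a i * ω)) := le_trans (by positivity) d
    positivity
  refine (mul_le_mul hP hS hS0 ?_).trans (le_of_eq (by ring))
  refine mul_nonneg (Finset.prod_nonneg fun i _ => ?_) (Finset.prod_nonneg fun i _ => by positivity)
  have r2 := rr_pos (ha i) hη h3
  positivity

lemma AA_nonneg {a : ι → ℝ} (k : ι → ℕ) (ha : ∀ i, 0 < a i ∧ a i ≤ 1) {θ : ℝ} (h0 : 0 < θ) (h1 : θ < π) :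
    0 ≤ AA a k θ := by
  refine Finset.prod_nonneg fun i _ => ?_
  obtain ⟨b1, b2⟩ := axr (ha i) h0 h1
  have hs := Real.sin_pos_of_pos_of_lt_pi b1 b2
  positivity

lemma AA_ratio {a : ι → ℝ} (k : ι → ℕ) (ha : ∀ i, 0 < a i ∧ a i ≤ 1) {θ θ' : ℝ} (h0 : 0 < θ) (h1 : θ < π)
    (h2 : 0 < θ') (h3 : θ' < π) : AA a k θ' ≤ (∏ i, (π / rr (a i) θ θ') ^ k i) * AA a k θ := by
  have hp := Real.pi_pos
  unfold AA
  rw [← Finset.prod_mul_distrib]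
  refine Finset.prod_le_prod (fun i _ => ?_) fun i _ => ?_
  · obtain ⟨b1, b2⟩ := axr (ha i) h2 h3
    have hs := Real.sin_pos_of_pos_of_lt_pi b1 b2
    positivity
  · obtain ⟨b1, b2⟩ := axr (ha i) h2 h3
    have hs := Real.sin_pos_of_pos_of_lt_pi b1 b2
    rw [← mul_pow]
    refine pow_le_pow_left₀ (by positivity) ?_ _
    have u := xs_upper (ha i) h2 h3
    have d := xs_lower (ha i) h0 h1
    have r2 := rr_pos (ha i) h1 h3
    refine u.trans (le_trans (le_of_eq ?_) (mul_le_mul_of_nonneg_left d (by positivity)))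
    have e1 := eps_pos (ha i) h1
    have e2 := eps_pos (ha i) h3
    have ai := (ha i).1
    unfold rr
    generalize (π / a i - θ) = x at *
    generalize (π / a i - θ') = y at *
    field_simp

lemma Vb_pos [Nonempty ι] {a : ι → ℝ} (ha : ∀ i, 0 < a i ∧ a i ≤ 1) {c : ι → ℝ} (hc : ∀ i, 0 ≤ c i) {θ : ℝ} (h1 : θ < π) :
    0 < Vb a c θ := by
  unfold Vb
  refine Finset.sum_pos (fun i _ => ?_) Finset.univ_nonempty
  have e1 := eps_pos (ha i) h1
  have := hc i
  positivity

lemma Vb_ratio {a : ι → ℝ} {w : ι → ℝ} (ha : ∀ i, 0 < a i ∧ a i ≤ 1) (hw : ∀ i, 0 ≤ w i)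
    {η ω δ : ℝ} (hd : 0 ≤ δ) (h0 : 0 < η) (h1 : η ≤ ω) (h3 : ω < π) :
    Vb a (cw a w η) (η - δ) ≤ (π * (rr 1 (η - δ) (ω - δ) / rr 1 η ω)) ^ 2 * Vb a (cw a w ω) (ω - δ) := by
  have hp := Real.pi_gt_three
  have hω : 0 < ω := by linarith
  have hη : η < π := by linarith
  unfold Vb
  rw [Finset.mul_sum]
  refine Finset.sum_le_sum fun i _ => ?_
  have hq := rr_quot (ha i) hd h1 h3
  have e1 := eps_pos (ha i) hη
  have e2 := eps_pos (ha i) h3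
  have e3 : 0 < π / a i - (η - δ) := by linarith
  have e4 : 0 < π / a i - (ω - δ) := by linarith
  have hr := rr_pos (ha i) hη h3
  have hs := rr_pos (ha i) (by linarith : η - δ < π) (by linarith : ω - δ < π)
  have hrs := rr_shift (ha i) hd h1 h3
  have hs1 := rr_le_one (ha i) (by linarith : η - δ ≤ ω - δ) (by linarith : ω - δ < π)
  have hwi := hw i
  obtain ⟨b1, b2⟩ := axr (ha i) h0 hη
  obtain ⟨c1, c2⟩ := axr (ha i) hω h3
  have hsi := Real.sin_pos_of_pos_of_lt_pi b1 b2
  have hsw := Real.sin_pos_of_pos_of_lt_pi c1 c2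
  have hsr : Real.sin (a i * η) ≤ π / rr (a i) η ω * Real.sin (a i * ω) := by
    refine (sin_ratio (ha i) hω h3 h0 hη).trans ?_
    refine mul_le_mul_of_nonneg_right ?_ hsw.le
    have : π * (η / ω) * ((π / a i - η) / (π / a i - ω)) = π / rr (a i) η ω * (η / ω) := by
      unfold rr
      generalize (π / a i - ω) = x at *
      generalize (π / a i - η) = y at *
      field_simp
    rw [this]
    have : η / ω ≤ 1 := by rw [div_le_one hω]; exact h1
    have h4 : 0 ≤ π / rr (a i) η ω := by positivity
    nlinarith
  have hsr2 := pow_le_pow_left₀ hsi.le hsr 2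
  have hE : π / a i - (ω - δ) = rr (a i) (η - δ) (ω - δ) * (π / a i - (η - δ)) := by
    unfold rr
    rw [div_mul_cancel₀ _ e3.ne']
  have hmain : 1 / (π / a i - (η - δ)) ^ 2 + cw a w η i / (π / a i - (η - δ)) ^ 3 ≤
      (π * (rr (a i) (η - δ) (ω - δ) / rr (a i) η ω)) ^ 2 *
        (1 / (π / a i - (ω - δ)) ^ 2 + cw a w ω i / (π / a i - (ω - δ)) ^ 3) := by
    rw [hE]
    unfold cw
    generalize rr (a i) (η - δ) (ω - δ) = s at *
    generalize rr (a i) η ω = r at *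
    generalize π / a i - (η - δ) = x at *
    generalize Real.sin (a i * η) = S at *
    generalize Real.sin (a i * ω) = T at *
    have t1 : 1 / x ^ 2 ≤ (π * (s / r)) ^ 2 * (1 / (s * x) ^ 2) := by
      have : (π * (s / r)) ^ 2 * (1 / (s * x) ^ 2) = (π / r) ^ 2 * (1 / x ^ 2) := by
        field_simp
      rw [this]
      have h5 : 1 ≤ π / r := by
        rw [le_div_iff₀ hr]; linarith
      have h6 : 1 ≤ (π / r) ^ 2 := one_le_pow₀ h5
      have h7 : 0 ≤ 1 / x ^ 2 := by positivity
      nlinarith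
    have t2 : S ^ 2 * w i / x ^ 3 ≤ (π * (s / r)) ^ 2 * (T ^ 2 * w i / (s * x) ^ 3) := by
      have : (π * (s / r)) ^ 2 * (T ^ 2 * w i / (s * x) ^ 3) = (π / r * T) ^ 2 * w i / x ^ 3 * (1 / s) := by
        field_simp
      rw [this]
      have h5 : 1 ≤ 1 / s := by
        rw [le_div_iff₀ hs]; linarith
      have h6 : S ^ 2 * w i / x ^ 3 ≤ (π / r * T) ^ 2 * w i / x ^ 3 := by gcongr
      have h7 : 0 ≤ (π / r * T) ^ 2 * w i / x ^ 3 := by positivity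
      nlinarith
    linarith
  refine hmain.trans ?_
  have : 0 ≤ cw a w ω i := cw_nonneg hw ω i
  gcongr

lemma prod_le_single {f : ι → ℝ} {o : ι} {y : ℝ} (h0 : ∀ i, 0 ≤ f i) (h1 : ∀ i, f i ≤ 1) (hy : f o ≤ y) :
    ∏ i, f i ≤ y := by
  classical
  rw [← Finset.mul_prod_erase Finset.univ f (Finset.mem_univ o)]
  have : ∏ x ∈ Finset.univ.erase o, f x ≤ 1 := Finset.prod_le_one (fun i _ => h0 i) fun i _ => h1 i
  nlinarith [h0 o]

lemma caseA_factor {a : ι → ℝ} {k : ι → ℕ} (ha : ∀ i, 0 < a i ∧ a i ≤ 1) {o : ι} (ho : a o = 1) (hk : 0 < k o)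
    {η ω δ : ℝ} (hd : 0 ≤ δ) (h0 : 0 < η) (h1 : η ≤ ω) (h3 : ω < π) :
    (∏ i, (π / rr (a i) (η - δ) (ω - δ)) ^ k i) * (π * (rr 1 (η - δ) (ω - δ) / rr 1 η ω)) *
      ((∏ i, (π * (ω / η) * rr (a i) η ω) ^ (2 * k i)) * (2 * π ^ 2 * (ω / η) ^ 2 / rr 1 η ω)) ≤
    2 * π ^ 3 * (π ^ 3) ^ (∑ i, k i) * (ω / η) ^ (2 * (∑ i, k i) + 2) := by
  have hp := Real.pi_pos
  have hω : 0 < ω := by linarith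
  have hη : η < π := by linarith
  have hr := rr_pos ⟨one_pos, le_rfl⟩ hη h3
  have hs := rr_pos ⟨one_pos, le_rfl⟩ (by linarith : η - δ < π) (by linarith : ω - δ < π)
  have e1 : (∏ i, (π / rr (a i) (η - δ) (ω - δ)) ^ k i) * (∏ i, (π * (ω / η) * rr (a i) η ω) ^ (2 * k i)) =
      (π ^ 3 * (ω / η) ^ 2) ^ (∑ i, k i) * ∏ i, (rr (a i) η ω ^ 2 / rr (a i) (η - δ) (ω - δ)) ^ k i := by
    rw [← Finset.prod_mul_distrib, ← Finset.prod_pow_eq_pow_sum, ← Finset.prod_mul_distrib]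
    refine Finset.prod_congr rfl fun i _ => ?_
    rw [pow_mul, ← mul_pow, ← mul_pow]
    congr 1
    have hs := rr_pos (ha i) (by linarith : η - δ < π) (by linarith : ω - δ < π)
    field_simp
  have e2 : ∏ i, (rr (a i) η ω ^ 2 / rr (a i) (η - δ) (ω - δ)) ^ k i ≤ rr 1 η ω ^ 2 / rr 1 (η - δ) (ω - δ) := by
    have hle : ∀ i, rr (a i) η ω ^ 2 / rr (a i) (η - δ) (ω - δ) ≤ 1 := fun i => by
      have hs := rr_pos (ha i) (by linarith : η - δ < π) (by linarith : ω - δ < π)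
      have hr := rr_pos (ha i) hη h3
      have h4 := rr_shift (ha i) hd h1 h3
      have h5 := rr_le_one (ha i) h1 h3
      rw [div_le_one hs]
      nlinarith
    have hge : ∀ i, 0 ≤ rr (a i) η ω ^ 2 / rr (a i) (η - δ) (ω - δ) := fun i => by
      have hs := rr_pos (ha i) (by linarith : η - δ < π) (by linarith : ω - δ < π)
      positivity
    refine prod_le_single (o := o) (fun i => pow_nonneg (hge i) _) (fun i => pow_le_one₀ (hge i) (hle i)) ?_
    have h6 := pow_le_of_le_one (hge o) (hle o) hk.ne'
    rw [ho] at h6 ⊢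
    exact h6
  calc _ = ((∏ i, (π / rr (a i) (η - δ) (ω - δ)) ^ k i) * (∏ i, (π * (ω / η) * rr (a i) η ω) ^ (2 * k i))) *
      (2 * π ^ 3 * (ω / η) ^ 2 * (rr 1 (η - δ) (ω - δ) / rr 1 η ω ^ 2)) := by
        generalize (∏ i, (π / rr (a i) (η - δ) (ω - δ)) ^ k i) = A
        generalize (∏ i, (π * (ω / η) * rr (a i) η ω) ^ (2 * k i)) = B
        field_simp
    _ ≤ ((π ^ 3 * (ω / η) ^ 2) ^ (∑ i, k i) * (rr 1 η ω ^ 2 / rr 1 (η - δ) (ω - δ))) *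
      (2 * π ^ 3 * (ω / η) ^ 2 * (rr 1 (η - δ) (ω - δ) / rr 1 η ω ^ 2)) := by
        rw [e1]
        gcongr
    _ = _ := by
        rw [mul_pow, ← pow_mul (ω / η), pow_add]
        field_simp

end cmpA

section cmpB
variable {ι : Type*} [Fintype ι]

lemma GG_incr {a w : ι → ℝ} (ha : ∀ i, 0 < a i ∧ a i ≤ 1) (hw : ∀ i, 0 ≤ w i)
    {η ω δ : ℝ} (hd : 0 ≤ δ) (hδ : δ ≤ η / 2) (h0 : 0 < η) (h1 : η ≤ ω) (h3 : ω < π) :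
    GG a w η (η - δ) + (4 * ∑ i, a i ^ 2 * w i) * η ^ 2 * (ω / η - 1) / 12 ≤ GG a w ω (ω - δ) := by
  unfold GG
  have e : (4 * ∑ i, a i ^ 2 * w i) * η ^ 2 * (ω / η - 1) / 12 = ∑ i, w i * (a i * η / 3 * (a i * (ω - η))) := by
    rw [Finset.mul_sum, Finset.sum_mul, Finset.sum_mul, Finset.sum_div]
    refine Finset.sum_congr rfl fun i _ => ?_
    field_simp
    ring
  rw [e, ← Finset.sum_add_distrib]
  refine Finset.sum_le_sum fun i _ => ?_
  rw [← mul_add]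
  refine mul_le_mul_of_nonneg_left ?_ (hw i)
  have ai := (ha i).1
  have hb := (axr (ha i) (by linarith : 0 < ω) h3).2
  have := gg_incr (d := a i * δ) (x1 := a i * (η - δ)) (x2 := a i * (ω - δ)) (by positivity)
    (mul_le_mul_of_nonneg_left (by linarith) ai.le) (mul_pos ai (by linarith))
    (mul_le_mul_of_nonneg_left (by linarith) ai.le) (by linarith)
  have e1 : a i * (η - δ) + a i * δ = a i * η := by ring
  have e2 : a i * (ω - δ) + a i * δ = a i * ω := by ring
  have e3 : a i * (ω - δ) - a i * (η - δ) = a i * (ω - η) := by ring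
  rw [e1, e2, e3] at this
  exact this

lemma MM_bound_small {a : ι → ℝ} {k : ι → ℕ} {c : ι → ℝ} (ha : ∀ i, 0 < a i ∧ a i ≤ 1) (hc : ∀ i, 0 ≤ c i) {θ : ℝ}
    (h0 : 0 < θ) (h1 : θ ≤ π / 2) : MM a k c θ ≤ θ * ∑ i, (2 * k i + 2 * c i) := by
  have hp := Real.pi_gt_three
  have hp4 := Real.pi_le_four
  unfold MM
  rw [Finset.mul_sum]
  refine Finset.sum_le_sum fun i _ => ?_
  have ai := (ha i).1
  have ai1 := (ha i).2
  have ci := hc i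
  have e1 : 1 / θ - a i * (Real.cos (a i * θ) / Real.sin (a i * θ)) ≤ 2 * θ := by
    have u := cot_upper (ha i) h0 (by linarith : θ < π)
    have : 1 / θ - a i * (Real.cos (a i * θ) / Real.sin (a i * θ)) =
      (1 - a i * θ * (Real.cos (a i * θ) / Real.sin (a i * θ))) / θ := by
      generalize Real.cos (a i * θ) / Real.sin (a i * θ) = q
      field_simp
    rw [this, div_le_iff₀ h0]
    refine u.trans ?_
    have e : π / 2 ≤ π / a i - θ := by
      have : π ≤ π / a i := by
        rw [le_div_iff₀ ai]; nlinarith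
      linarith
    rw [div_le_iff₀ (by linarith)]
    have h6 : 2 * θ * θ * (6 * (π / 2)) ≤ 2 * θ * θ * (6 * (π / a i - θ)) := by gcongr
    refine le_trans ?_ h6
    have h7 : π * a i ≤ 6 := by nlinarith
    have h8 : 0 ≤ π * θ ^ 2 := by positivity
    nlinarith
  have e2 : a i * mm (a i * θ) ≤ 2 * θ := by
    have := mm_le (x := a i * θ) (by positivity) (by nlinarith)
    nlinarith [mul_le_mul_of_nonneg_left this ai.le, mul_pos ai h0]
  have h9 : (k i : ℝ) * (1 / θ - a i * (Real.cos (a i * θ) / Real.sin (a i * θ))) ≤ k i * (2 * θ) :=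
    mul_le_mul_of_nonneg_left e1 (Nat.cast_nonneg _)
  have h10 : c i * (a i * mm (a i * θ)) ≤ c i * (2 * θ) := mul_le_mul_of_nonneg_left e2 ci
  linarith

lemma tw_eq {a w : ι → ℝ} (ha : ∀ i, 0 < a i ∧ a i ≤ 1) {η : ℝ} (h0 : 0 < η) (h1 : η < π) :
    tw a w η = ∑ i, cw a w η i * (a i * mm (a i * η)) := by
  unfold tw
  refine Finset.sum_congr rfl fun i _ => ?_
  obtain ⟨b1, b2⟩ := axr (ha i) h0 h1
  have hs := Real.sin_pos_of_pos_of_lt_pi b1 b2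
  unfold cw mm
  field_simp

lemma exists_theta {a w : ι → ℝ} {k : ι → ℕ} (ha : ∀ i, 0 < a i ∧ a i ≤ 1) (hw : ∀ i, 0 ≤ w i)
    {η : ℝ} (h0 : 0 < η) (h1 : η < π) (ht : 0 < tw a w η) :
    ∃ θ, 0 < θ ∧ θ ≤ η ∧ MM a k (cw a w η) θ = tw a w η := by
  have hp := Real.pi_pos
  set S := ∑ i, (2 * k i + 2 * cw a w η i) with hS
  have hS0 : 0 ≤ S := Finset.sum_nonneg fun i _ => by
    have := cw_nonneg (a := a) hw η i
    positivity
  set e := min (η / 2) (tw a w η / (S + 1)) with he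
  have he0 : 0 < e := lt_min (by linarith) (by positivity)
  have heη : e ≤ η / 2 := min_le_left _ _
  have hlow : MM a k (cw a w η) e ≤ tw a w η := by
    refine (MM_bound_small ha (cw_nonneg hw η) he0 (by linarith)).trans ?_
    rw [← hS]
    have h2 : e ≤ tw a w η / (S + 1) := min_le_right _ _
    rw [le_div_iff₀ (by positivity)] at h2
    nlinarith
  have hhigh : tw a w η ≤ MM a k (cw a w η) η := by
    rw [tw_eq ha h0 h1]
    unfold MM
    refine Finset.sum_le_sum fun i _ => ?_
    have d := cot_lower (ha i) h0 h1
    have e1 := eps_pos (ha i) h1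
    have ai := (ha i).1
    have : 0 ≤ 1 - a i * η * (Real.cos (a i * η) / Real.sin (a i * η)) := le_trans (by positivity) d
    have h3 : 1 / η - a i * (Real.cos (a i * η) / Real.sin (a i * η)) =
      (1 - a i * η * (Real.cos (a i * η) / Real.sin (a i * η))) / η := by
      generalize Real.cos (a i * η) / Real.sin (a i * η) = q
      field_simp
    rw [h3]
    have : 0 ≤ (k i : ℝ) * ((1 - a i * η * (Real.cos (a i * η) / Real.sin (a i * η))) / η) := by positivity
    linarith
  have hcont : ContinuousOn (MM a k (cw a w η)) (Set.Icc e η) := by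
    unfold MM
    refine continuousOn_finsetSum _ fun i _ => ?_
    have hsin : ∀ x ∈ Set.Icc e η, Real.sin (a i * x) ≠ 0 := fun x hx => by
      obtain ⟨b1, b2⟩ := axr (ha i) (he0.trans_le hx.1) (hx.2.trans_lt h1)
      exact (Real.sin_pos_of_pos_of_lt_pi b1 b2).ne'
    have c1 : ContinuousOn (fun x : ℝ => Real.sin (a i * x)) (Set.Icc e η) := by fun_prop
    have c2 : ContinuousOn (fun x : ℝ => Real.cos (a i * x)) (Set.Icc e η) := by fun_prop
    have c3 : ContinuousOn (fun x : ℝ => 1 / x) (Set.Icc e η) :=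
      continuousOn_const.div continuousOn_id fun x hx => (he0.trans_le hx.1).ne'
    refine ContinuousOn.add (continuousOn_const.mul (c3.sub (continuousOn_const.mul (c2.div c1 hsin))))
      (continuousOn_const.mul (continuousOn_const.mul ?_))
    unfold mm
    exact ContinuousOn.div (by fun_prop) (by fun_prop) fun x hx => pow_ne_zero 2 (hsin x hx)
  obtain ⟨θ, hθ, hθ2⟩ := intermediate_value_Icc (by linarith : e ≤ η) hcont ⟨hlow, hhigh⟩
  exact ⟨θ, he0.trans_le hθ.1, hθ.2, hθ2⟩

lemma D_bound {a w : ι → ℝ} {k : ι → ℕ} {α : ℝ} (hα : 0 < α) (haα : ∀ i, α ≤ a i) (ha : ∀ i, 0 < a i ∧ a i ≤ 1) (hw : ∀ i, 0 ≤ w i)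
    {η θ : ℝ} (h1 : η < π) (hθ : 0 < θ) (hθη : θ ≤ η / 2)
    (hM : MM a k (cw a w η) θ = tw a w η) :
    (4 * ∑ i, a i ^ 2 * w i) * η ^ 2 ≤ 24 * π * (∑ i, (k i : ℝ)) / α ^ 2 := by
  have hp := Real.pi_pos
  have h0 : 0 < η := by linarith
  have hz := MM_bound_small (k := k) (c := fun _ => 0) ha (fun _ => le_rfl) hθ (by linarith)
  rw [tw_eq ha h0 h1] at hM
  have e1 : MM a k (cw a w η) θ = MM a k (fun _ => 0) θ + ∑ i, cw a w η i * (a i * mm (a i * θ)) := by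
    unfold MM
    rw [← Finset.sum_add_distrib]
    refine Finset.sum_congr rfl fun i _ => by ring
  have e2 : ∑ i, cw a w η i * (a i * mm (a i * θ)) + ∑ i, a i ^ 4 * w i * η ^ 3 / (6 * π) ≤ ∑ i, cw a w η i * (a i * mm (a i * η)) := by
    rw [← Finset.sum_add_distrib]
    refine Finset.sum_le_sum fun i _ => ?_
    obtain ⟨b1, b2⟩ := axr (ha i) h0 h1
    have ai := (ha i).1
    have m1 : mm (a i * θ) ≤ mm (a i * η / 2) := by
      refine mm_mono ⟨by positivity, ?_⟩ ⟨by positivity, by linarith⟩ ?_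
      · nlinarith
      · nlinarith
    have m2 := mm_half b1 b2
    have m3 := SS_lower b1.le b2.le
    have wi := hw i
    have m4 : cw a w η i * (a i * mm (a i * θ)) ≤ cw a w η i * (a i * mm (a i * η / 2)) := by
      have := cw_nonneg (a := a) hw η i
      gcongr
    have m5 : cw a w η i * (a i * mm (a i * η / 2)) + a i * w i * SS (a i * η) = cw a w η i * (a i * mm (a i * η)) := by
      rw [← m2]
      unfold cw
      ring
    have m6 : a i ^ 4 * w i * η ^ 3 / (6 * π) ≤ a i * w i * SS (a i * η) := by
      refine le_trans (le_of_eq ?_) (mul_le_mul_of_nonneg_left m3 (by positivity))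
      ring
    linarith
  have e3 : ∑ i, a i ^ 4 * w i * η ^ 3 / (6 * π) ≤ η * ∑ i, (k i : ℝ) := by
    have : θ * ∑ i, (2 * (k i : ℝ) + 2 * 0) = 2 * θ * ∑ i, (k i : ℝ) := by
      simp only [mul_zero, add_zero, ← Finset.mul_sum]
      ring
    rw [this] at hz
    have hk0 : 0 ≤ ∑ i, (k i : ℝ) := Finset.sum_nonneg fun i _ => Nat.cast_nonneg _
    have : 2 * θ * ∑ i, (k i : ℝ) ≤ η * ∑ i, (k i : ℝ) := mul_le_mul_of_nonneg_right (by linarith) hk0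
    linarith
  have e4 : α ^ 2 * (∑ i, a i ^ 2 * w i) * (η ^ 3 / (6 * π)) ≤ ∑ i, a i ^ 4 * w i * η ^ 3 / (6 * π) := by
    rw [Finset.mul_sum, Finset.sum_mul]
    refine Finset.sum_le_sum fun i _ => ?_
    have wi := hw i
    have : α ^ 2 ≤ a i ^ 2 := pow_le_pow_left₀ hα.le (haα i) 2
    calc α ^ 2 * (a i ^ 2 * w i) * (η ^ 3 / (6 * π)) ≤ a i ^ 2 * (a i ^ 2 * w i) * (η ^ 3 / (6 * π)) := by gcongr
      _ = _ := by ring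
  have e5 := e4.trans e3
  rw [le_div_iff₀ (by positivity)]
  have e6 : α ^ 2 * (∑ i, a i ^ 2 * w i) * (η ^ 3 / (6 * π)) * (24 * π / η) ≤ η * (∑ i, (k i : ℝ)) * (24 * π / η) :=
    mul_le_mul_of_nonneg_right e5 (by positivity)
  have e7 : α ^ 2 * (∑ i, a i ^ 2 * w i) * (η ^ 3 / (6 * π)) * (24 * π / η) = 4 * (∑ i, a i ^ 2 * w i) * η ^ 2 * α ^ 2 := by
    generalize ∑ i, a i ^ 2 * w i = q
    field_simp
    ring
  have e8 : η * (∑ i, (k i : ℝ)) * (24 * π / η) = 24 * π * (∑ i, (k i : ℝ)) := by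
    generalize ∑ i, (k i : ℝ) = q
    field_simp
  rw [e7, e8] at e6
  exact e6

end cmpB

section cmpC
variable {ι : Type*} [Fintype ι]

lemma tw_pos {a w : ι → ℝ} (ha : ∀ i, 0 < a i ∧ a i ≤ 1) (hw : ∀ i, 0 ≤ w i)
    {η : ℝ} (h0 : 0 < η) (hD : 1 ≤ (4 * ∑ i, a i ^ 2 * w i) * η ^ 2) : 0 < tw a w η := by
  have hx : ∀ i, 0 < a i * η - Real.sin (a i * η) * Real.cos (a i * η) := fun i => by
    have h1 : 0 < a i * η := mul_pos (ha i).1 h0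
    have := Real.sin_lt (x := 2 * (a i * η)) (by positivity)
    rw [Real.sin_two_mul] at this
    linarith
  unfold tw
  refine Finset.sum_pos' (fun i _ => mul_nonneg (mul_nonneg (ha i).1.le (hw i)) (hx i).le) ?_
  by_contra hcon
  push Not at hcon
  have hz : ∀ i, w i = 0 := fun i => by
    by_contra hne
    have hwi : 0 < w i := lt_of_le_of_ne (hw i) (Ne.symm hne)
    have := hcon i (Finset.mem_univ i)
    have h2 := mul_pos (mul_pos (ha i).1 hwi) (hx i)
    linarith
  simp [hz] at hD
  linarith

lemma poly_exp (N : ℕ) : ∃ C > 0, ∀ v D : ℝ, 1 ≤ v → 1 ≤ D →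
    v ^ N * Real.exp (-(D * (v - 1) / 12)) ≤ C * Real.exp (-(D * (v - 1) / 24)) := by
  refine ⟨24 ^ N * N.factorial * Real.exp (1 / 24), by positivity, fun v D hv hD => ?_⟩
  have h1 := Real.pow_div_factorial_le_exp (v / 24) (by linarith) N
  rw [div_le_iff₀ (by positivity), div_pow, div_le_iff₀ (by positivity)] at h1
  have h2 : v ^ N ≤ 24 ^ N * N.factorial * Real.exp (1 / 24) * Real.exp (D * (v - 1) / 24) := by
    have : Real.exp (v / 24) ≤ Real.exp (1 / 24) * Real.exp (D * (v - 1) / 24) := by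
      rw [← Real.exp_add]
      refine Real.exp_le_exp.2 ?_
      nlinarith
    calc v ^ N ≤ Real.exp (v / 24) * N.factorial * 24 ^ N := h1
      _ ≤ (Real.exp (1 / 24) * Real.exp (D * (v - 1) / 24)) * N.factorial * 24 ^ N := by gcongr
      _ = _ := by ring
  have h3 : Real.exp (-(D * (v - 1) / 24)) = Real.exp (D * (v - 1) / 24) * Real.exp (-(D * (v - 1) / 12)) := by
    rw [← Real.exp_add]; ring_nf
  rw [h3, ← mul_assoc]
  exact mul_le_mul_of_nonneg_right h2 (Real.exp_pos _).le

lemma caseB_J {a : ι → ℝ} {k : ι → ℕ} (ha : ∀ i, 0 < a i ∧ a i ≤ 1) {o : ι} (ho : a o = 1) (hk : 0 < k o)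
    {η ω : ℝ} (h0 : 0 < η) (h1 : η ≤ ω) (h3 : ω < π) :
      ((∏ i, (π * (ω / η) * rr (a i) η ω) ^ (2 * k i)) * (2 * π ^ 2 * (ω / η) ^ 2 / rr 1 η ω)) ≤
    2 * π ^ 2 * (π ^ 2) ^ (∑ i, k i) * (ω / η) ^ (2 * (∑ i, k i) + 2) := by
  have hp := Real.pi_pos
  have hω : 0 < ω := by linarith
  have hη : η < π := by linarith
  have hr := rr_pos ⟨one_pos, le_rfl⟩ hη h3
  have e1 : (∏ i, (π * (ω / η) * rr (a i) η ω) ^ (2 * k i)) =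
      (π ^ 2 * (ω / η) ^ 2) ^ (∑ i, k i) * ∏ i, (rr (a i) η ω) ^ (2 * k i) := by
    rw [← Finset.prod_pow_eq_pow_sum, ← Finset.prod_mul_distrib]
    refine Finset.prod_congr rfl fun i _ => ?_
    rw [pow_mul, pow_mul, ← mul_pow]
    congr 1
    ring
  have e2 : ∏ i, (rr (a i) η ω) ^ (2 * k i) ≤ rr 1 η ω := by
    refine prod_le_single (o := o) (fun i => pow_nonneg (rr_pos (ha i) hη h3).le _)
      (fun i => pow_le_one₀ (rr_pos (ha i) hη h3).le (rr_le_one (ha i) h1 h3)) ?_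
    have h6 := pow_le_of_le_one (rr_pos (ha o) hη h3).le (rr_le_one (ha o) h1 h3) (by omega : 2 * k o ≠ 0)
    rw [ho] at h6 ⊢
    exact h6
  rw [e1]
  calc _ ≤ (π ^ 2 * (ω / η) ^ 2) ^ (∑ i, k i) * rr 1 η ω * (2 * π ^ 2 * (ω / η) ^ 2 / rr 1 η ω) := by gcongr
    _ = _ := by
        rw [mul_pow, ← pow_mul (ω / η), pow_add]
        field_simp

lemma caseB_A {a : ι → ℝ} (k : ι → ℕ) (ha : ∀ i, 0 < a i ∧ a i ≤ 1)
    {θ ω : ℝ} (hθ : 0 < θ) (hθ1 : θ < π) (h0 : 0 < ω) (h3 : ω < π) :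
    AA a k (ω / 2) ≤ (π / 2) ^ (∑ i, k i) * AA a k θ := by
  have hp := Real.pi_pos
  have u : AA a k (ω / 2) ≤ (π / 2) ^ (∑ i, k i) := by
    unfold AA
    rw [← Finset.prod_pow_eq_pow_sum]
    refine Finset.prod_le_prod (fun i _ => ?_) fun i _ => ?_
    · obtain ⟨b1, b2⟩ := axr (ha i) (by linarith : 0 < ω / 2) (by linarith)
      have hs := Real.sin_pos_of_pos_of_lt_pi b1 b2
      positivity
    · obtain ⟨b1, b2⟩ := axr (ha i) (by linarith : 0 < ω / 2) (by linarith)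
      obtain ⟨b3, b4⟩ := axr (ha i) h0 h3
      have hs := Real.sin_pos_of_pos_of_lt_pi b1 b2
      refine pow_le_pow_left₀ (by positivity) ?_ _
      rw [div_le_iff₀ hs]
      have := Real.mul_le_sin b1.le (by linarith)
      have h5 := mul_le_mul_of_nonneg_left this (by positivity : 0 ≤ π / 2)
      refine le_trans (le_of_eq ?_) h5
      field_simp
  have d : 1 ≤ AA a k θ := by
    unfold AA
    rw [← Finset.prod_const_one (s := (Finset.univ : Finset ι))]
    refine Finset.prod_le_prod (fun i _ => zero_le_one) fun i _ => ?_
    obtain ⟨b1, b2⟩ := axr (ha i) hθ hθ1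
    have hs := Real.sin_pos_of_pos_of_lt_pi b1 b2
    refine one_le_pow₀ ?_
    rw [le_div_iff₀ hs, one_mul]
    exact Real.sin_le b1.le
  have : 0 ≤ (π / 2) ^ (∑ i, k i) := by positivity
  nlinarith

lemma caseB_V {a w : ι → ℝ} (ha : ∀ i, 0 < a i ∧ a i ≤ 1) (hw : ∀ i, 0 ≤ w i) {o : ι} (ho : a o = 1)
    {η θ ω Q : ℝ} (h0 : 0 < η) (h1 : η < π) (hθη : θ ≤ η / 2) (h2 : 0 < ω) (h3 : ω < π)
    (hQ1 : 1 ≤ Q) (hQ : Fintype.card ι + (4 * ∑ i, a i ^ 2 * w i) * η ^ 2 ≤ Q) :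
    Vb a (cw a w η) θ ≤ (π * Q) ^ 2 * Vb a (cw a w ω) (ω / 2) := by
  have hp := Real.pi_gt_three
  have u : Vb a (cw a w η) θ ≤ Q := by
    refine le_trans ?_ hQ
    unfold Vb
    have : (Fintype.card ι : ℝ) + (4 * ∑ i, a i ^ 2 * w i) * η ^ 2 = ∑ i, (1 + 4 * (a i ^ 2 * w i) * η ^ 2) := by
      rw [Finset.sum_add_distrib, ← Finset.sum_mul, ← Finset.mul_sum]
      simp
    rw [this]
    refine Finset.sum_le_sum fun i _ => ?_
    have ai := (ha i).1
    have e : 1 ≤ π / a i - θ := by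
      have : π ≤ π / a i := by
        rw [le_div_iff₀ ai]; nlinarith [(ha i).2]
      linarith
    obtain ⟨b1, b2⟩ := axr (ha i) h0 h1
    have hs := Real.sin_pos_of_pos_of_lt_pi b1 b2
    have hwi := hw i
    refine add_le_add ?_ ?_
    · rw [div_le_one (by positivity)]
      exact one_le_pow₀ e
    · refine (div_le_self (cw_nonneg hw η i) (one_le_pow₀ e)).trans ?_
      have h5 := pow_le_pow_left₀ hs.le (Real.sin_le b1.le) 2
      unfold cw
      have h6 := mul_le_mul_of_nonneg_right h5 hwi
      have h7 : 0 ≤ (a i * η) ^ 2 * w i := by positivity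
      nlinarith
  have d : 1 / π ^ 2 ≤ Vb a (cw a w ω) (ω / 2) := by
    unfold Vb
    have hnn : ∀ i ∈ Finset.univ, 0 ≤ 1 / (π / a i - ω / 2) ^ 2 + cw a w ω i / (π / a i - ω / 2) ^ 3 := fun i _ => by
      have := eps_pos (ha i) (by linarith : ω / 2 < π)
      have := cw_nonneg (a := a) hw ω i
      positivity
    refine le_trans ?_ (Finset.single_le_sum hnn (Finset.mem_univ o))
    have h5 := eps_pos (ha o) (by linarith : ω / 2 < π)
    have h6 := cw_nonneg (a := a) hw ω o
    have h7 : 0 ≤ cw a w ω o / (π / a o - ω / 2) ^ 3 := by positivity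
    have h8 : 1 / π ^ 2 ≤ 1 / (π / a o - ω / 2) ^ 2 := by
      refine one_div_le_one_div_of_le (by positivity) (pow_le_pow_left₀ h5.le ?_ 2)
      rw [ho, div_one]
      linarith
    linarith
  have h9 := mul_le_mul_of_nonneg_left d (by positivity : 0 ≤ (π * Q) ^ 2)
  have h10 : (π * Q) ^ 2 * (1 / π ^ 2) = Q ^ 2 := by field_simp
  rw [h10] at h9
  nlinarith

lemma caseB_G {a w : ι → ℝ} (ha : ∀ i, 0 < a i ∧ a i ≤ 1) (hw : ∀ i, 0 ≤ w i)
    {η θ ω : ℝ} (h0 : 0 < η) (h1 : η ≤ ω) (hθ : 0 < θ) (hθη : θ ≤ η / 2) (h3 : ω < π) {D0 : ℝ}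
    (hD0 : (4 * ∑ i, a i ^ 2 * w i) * η ^ 2 ≤ D0) :
    GG a w η θ + ((4 * ∑ i, a i ^ 2 * w i) * η ^ 2 * (ω / η - 1) / 12 - D0) ≤ GG a w ω (ω / 2) := by
  have u : GG a w η θ ≤ 3 / 4 * ((4 * ∑ i, a i ^ 2 * w i) * η ^ 2) := by
    have : 3 / 4 * ((4 * ∑ i, a i ^ 2 * w i) * η ^ 2) = ∑ i, w i * (3 * (a i * η) ^ 2) := by
      rw [Finset.mul_sum, Finset.sum_mul, Finset.mul_sum]
      exact Finset.sum_congr rfl fun i _ => by ring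
    rw [this]
    unfold GG
    refine Finset.sum_le_sum fun i _ => mul_le_mul_of_nonneg_left ?_ (hw i)
    have ai := (ha i).1
    exact gg_le (mul_pos ai hθ) (by nlinarith) (axr (ha i) h0 (by linarith)).2
  have d : (4 * ∑ i, a i ^ 2 * w i) * η ^ 2 * (ω / η) ^ 2 / 8 ≤ GG a w ω (ω / 2) := by
    have : (4 * ∑ i, a i ^ 2 * w i) * η ^ 2 * (ω / η) ^ 2 / 8 = ∑ i, w i * ((a i * ω) ^ 2 / 2) := by
      rw [Finset.mul_sum, Finset.sum_mul, Finset.sum_mul, Finset.sum_div]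
      refine Finset.sum_congr rfl fun i _ => ?_
      field_simp
      ring
    rw [this]
    unfold GG
    refine Finset.sum_le_sum fun i _ => mul_le_mul_of_nonneg_left ?_ (hw i)
    have ai := (ha i).1
    have := axr (ha i) (by linarith : 0 < ω) h3
    have h5 := gg_half this.1 this.2
    rw [← mul_div_assoc]
    exact h5
  have hD : 0 ≤ (4 * ∑ i, a i ^ 2 * w i) * η ^ 2 := by
    have : 0 ≤ ∑ i, a i ^ 2 * w i := Finset.sum_nonneg fun i _ => mul_nonneg (sq_nonneg _) (hw i)
    positivity
  have hv : 1 ≤ ω / η := by rw [le_div_iff₀ h0]; linarith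
  generalize (4 * ∑ i, a i ^ 2 * w i) * η ^ 2 = D at *
  generalize ω / η = v at *
  have h6 : D * (v - 1) / 12 ≤ D * v ^ 2 / 8 := by
    have : (v - 1) / 12 ≤ v ^ 2 / 8 := by nlinarith
    have := mul_le_mul_of_nonneg_left this hD
    linarith
  linarith

theorem compare {a : ι → ℝ} {k : ι → ℕ} (ha : ∀ i, 0 < a i ∧ a i ≤ 1) (hk : ∀ i, 0 < k i) {o : ι} (ho : a o = 1)
    {α : ℝ} (hα : 0 < α) (haα : ∀ i, α ≤ a i) :
    ∃ C > 0, ∀ w : ι → ℝ, (∀ i, 0 ≤ w i) → ∀ η, 0 < η → 1 ≤ (4 * ∑ i, a i ^ 2 * w i) * η ^ 2 →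
      ∀ ω, η ≤ ω → ω < π → 0 ≤ HH a k w ω * JJ a k w ω ∧ HH a k w ω * JJ a k w ω ≤
        C * Real.exp (-((4 * ∑ i, a i ^ 2 * w i) * η ^ 2 * (ω / η - 1) / 24)) * (HH a k w η * JJ a k w η) := by
  have hp := Real.pi_pos
  have : Nonempty ι := ⟨o⟩
  obtain ⟨K, hK, hmain⟩ := abs_bounds ha hk
  obtain ⟨CN, hCN, hpoly⟩ := poly_exp (2 * (∑ i, k i) + 2)
  set D0 := 24 * π * (∑ i, (k i : ℝ)) / α ^ 2 with hD0
  have hk0 : 0 ≤ ∑ i, (k i : ℝ) := Finset.sum_nonneg fun i _ => Nat.cast_nonneg _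
  have hD00 : 0 ≤ D0 := by positivity
  set Q := Fintype.card ι + D0 with hQ
  have hQ1 : 1 ≤ Q := by
    have : (1 : ℝ) ≤ Fintype.card ι := by exact_mod_cast Fintype.card_pos
    linarith
  set CA := 2 * π ^ 3 * (π ^ 3) ^ (∑ i, k i) with hCA
  set CB := (π / 2) ^ (∑ i, k i) * (π * Q) * (2 * π ^ 2 * (π ^ 2) ^ (∑ i, k i)) * Real.exp D0 with hCB
  have hCA0 : 0 < CA := by positivity
  have hCB0 : 0 < CB := by positivity
  refine ⟨144 * K * (CA + CB) * CN, by positivity, fun w hw η h0 hD ω h1 h3 => ?_⟩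
  have hη : η < π := by linarith
  have hω : 0 < ω := by linarith
  have hH : ∀ x, 0 ≤ HH a k w x := fun x => by
    unfold HH
    exact mul_nonneg (Real.exp_pos _).le ((hmain (cw a w x) (cw_nonneg hw x)).1 _)
  have hJω := JJ_nonneg k ha hw hω h3
  have hJη := JJ_nonneg k ha hw h0 hη
  refine ⟨mul_nonneg (hH ω) hJω, ?_⟩
  have hv : 1 ≤ ω / η := by rw [le_div_iff₀ h0]; linarith
  have hup : ∀ θ', 0 < θ' → θ' < π → HH a k w ω ≤ 144 * (AA a k θ' * Real.exp (-GG a w ω θ')) / √(Vb a (cw a w ω) θ') := by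
    intro θ' t0 t1
    rw [← exp_EE]
    unfold HH
    have := ((hmain (cw a w ω) (cw_nonneg hw ω)).2 θ' t0 t1).1 (tw a w ω)
    refine (mul_le_mul_of_nonneg_left this (Real.exp_pos _).le).trans (le_of_eq (by ring))
  obtain ⟨θ, t0, t1, ht⟩ := exists_theta (k := k) ha hw h0 hη (tw_pos ha hw h0 hD)
  have hθπ : θ < π := by linarith
  have hlo : AA a k θ * Real.exp (-GG a w η θ) ≤ K * √(Vb a (cw a w η) θ) * HH a k w η := by
    rw [← exp_EE]
    unfold HH
    have := ((hmain (cw a w η) (cw_nonneg hw η)).2 θ t0 hθπ).2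
    rw [ht] at this
    refine (mul_le_mul_of_nonneg_left this (Real.exp_pos _).le).trans (le_of_eq (by ring))
  have hJr := JJ_ratio k ha hw h0 h1 h3
  have hAAθ := AA_nonneg k ha t0 hθπ
  have hr1 : 0 < rr 1 η ω := rr_pos ⟨one_pos, le_rfl⟩ hη h3
  have hRJ0 : 0 ≤ ((∏ i, (π * (ω / η) * rr (a i) η ω) ^ (2 * k i)) * (2 * π ^ 2 * (ω / η) ^ 2 / rr 1 η ω)) := by
    refine mul_nonneg (Finset.prod_nonneg fun i _ => ?_) (by positivity)
    have := rr_pos (ha i) hη h3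
    positivity
  have hHJ : 0 ≤ HH a k w η * JJ a k w η := mul_nonneg (hH η) hJη
  have hpo := hpoly (ω / η) ((4 * ∑ i, a i ^ 2 * w i) * η ^ 2) hv hD
  -- final assembly
  have fin : ∀ c, 0 ≤ c → c ≤ CA + CB →
      144 * K * (c * (ω / η) ^ (2 * (∑ i, k i) + 2)) * Real.exp (-((4 * ∑ i, a i ^ 2 * w i) * η ^ 2 * (ω / η - 1) / 12)) * (HH a k w η * JJ a k w η) ≤
      144 * K * (CA + CB) * CN * Real.exp (-((4 * ∑ i, a i ^ 2 * w i) * η ^ 2 * (ω / η - 1) / 24)) * (HH a k w η * JJ a k w η) := by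
    intro c hc hc2
    refine mul_le_mul_of_nonneg_right ?_ hHJ
    calc _ = 144 * K * c * ((ω / η) ^ (2 * (∑ i, k i) + 2) * Real.exp (-((4 * ∑ i, a i ^ 2 * w i) * η ^ 2 * (ω / η - 1) / 12))) := by ring
      _ ≤ 144 * K * (CA + CB) * (CN * Real.exp (-((4 * ∑ i, a i ^ 2 * w i) * η ^ 2 * (ω / η - 1) / 24))) := by gcongr
      _ = _ := by ring
  rcases le_total (η / 2) θ with hc | hc
  · -- case A
    obtain ⟨δ, hδ⟩ : ∃ δ, δ = η - θ := ⟨_, rfl⟩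
    have hθ : θ = η - δ := by linarith
    subst hθ
    have hd0 : 0 ≤ δ := by linarith
    have hd1 : δ ≤ η / 2 := by linarith
    have hc1 := combine hK (hup (ω - δ) (by linarith) (by linarith)) hlo
      (AA_ratio k ha t0 hθπ (by linarith : 0 < ω - δ) (by linarith))
      (GG_incr ha hw hd0 hd1 h0 h1 h3)
      (Finset.prod_nonneg fun i _ => by
        have := rr_pos (ha i) hθπ (by linarith : ω - δ < π)
        positivity) hAAθ
      (by
        have := rr_pos (a := 1) ⟨one_pos, le_rfl⟩ hθπ (by linarith : ω - δ < π)
        positivity)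
      hRJ0 (Vb_pos ha (cw_nonneg hw ω) (by linarith)) (Vb_ratio ha hw hd0 h0 h1 h3) hJr hJω hJη (hH η)
    refine hc1.trans (le_trans ?_ (fin CA hCA0.le (by linarith)))
    have hfac := caseA_factor ha ho (hk o) hd0 h0 h1 h3
    gcongr
  · -- case B
    have hDb := D_bound hα haα ha hw hη t0 hc ht
    rw [← hD0] at hDb
    have hc1 := combine hK (hup (ω / 2) (by linarith) (by linarith)) hlo
      (caseB_A k ha t0 hθπ hω h3) (caseB_G ha hw h0 h1 t0 hc h3 hDb) (by positivity) hAAθ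
      (by positivity) hRJ0 (Vb_pos ha (cw_nonneg hw ω) (by linarith))
      (caseB_V ha hw ho h0 hη hc hω h3 hQ1 (by rw [hQ]; linarith)) hJr hJω hJη (hH η)
    refine hc1.trans (le_trans ?_ (fin CB hCB0.le (by linarith)))
    have hfac := caseB_J ha ho (hk o) h0 h1 h3
    refine mul_le_mul_of_nonneg_right ?_ hHJ
    have e : Real.exp (-((4 * ∑ i, a i ^ 2 * w i) * η ^ 2 * (ω / η - 1) / 12 - D0)) =
        Real.exp D0 * Real.exp (-((4 * ∑ i, a i ^ 2 * w i) * η ^ 2 * (ω / η - 1) / 12)) := by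
      rw [← Real.exp_add]; ring_nf
    rw [e]
    calc _ ≤ 144 * K * ((π / 2) ^ (∑ i, k i) * (π * Q) * (2 * π ^ 2 * (π ^ 2) ^ (∑ i, k i) * (ω / η) ^ (2 * (∑ i, k i) + 2))) *
        (Real.exp D0 * Real.exp (-((4 * ∑ i, a i ^ 2 * w i) * η ^ 2 * (ω / η - 1) / 12))) := by gcongr
      _ = _ := by rw [hCB]; ring

end cmpC

lemma HH_even {ι : Type*} [Fintype ι] (a : ι → ℝ) (k : ι → ℕ) (w : ι → ℝ) (ω : ℝ) : HH a k w (-ω) = HH a k w ω := by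
  unfold HH
  have h1 : cw a w (-ω) = cw a w ω := by
    funext i
    unfold cw
    rw [mul_neg, Real.sin_neg, neg_sq]
  have h2 : tw a w (-ω) = - tw a w ω := by
    unfold tw
    rw [← Finset.sum_neg_distrib]
    refine Finset.sum_congr rfl fun i _ => ?_
    rw [mul_neg, Real.sin_neg, Real.cos_neg]
    ring
  rw [h1, h2, FF_even]

lemma JJ_even {ι : Type*} [Fintype ι] (a : ι → ℝ) (k : ι → ℕ) (w : ι → ℝ) (ω : ℝ) : JJ a k w (-ω) = JJ a k w ω := by
  unfold JJ
  congr 1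
  · refine Finset.prod_congr rfl fun i _ => ?_
    rw [mul_neg, Real.sin_neg, neg_sq]
  · refine Finset.sum_congr rfl fun i _ => ?_
    rw [mul_neg, Real.sin_neg, Real.cos_neg, div_neg, neg_mul_neg]

lemma heat_jac {l : ℕ} {k : Fin (l + 1) → ℕ} {a : Fin (l + 1) → ℝ} (ha : ∀ i, 0 < a i ∧ a i ≤ 1)
    (u : (i : Fin (l + 1)) → Fin (k i) → ℂ) {η : ℝ} (h0 : 0 < |η|) (h1 : |η| < π) :
    heatKernel l k a 1 (Psi l k a u η) * jacPsi l k a u η =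
      hkC l k * (HH a k (zNormSq l k u) |η| * JJ a k (zNormSq l k u) |η|) := by
  have hE : HH a k (zNormSq l k u) |η| = HH a k (zNormSq l k u) η := by
    rcases abs_choice η with h | h <;> rw [h]
    rw [HH_even]
  have hJ : JJ a k (zNormSq l k u) |η| = JJ a k (zNormSq l k u) η := by
    rcases abs_choice η with h | h <;> rw [h]
    rw [JJ_even]
  have hs : ∀ i, Real.sin (a i * η) ≠ 0 := fun i => by
    obtain ⟨b1, b2⟩ := axr (ha i) h0 h1
    have := (Real.sin_pos_of_pos_of_lt_pi b1 b2).ne'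
    rcases abs_choice η with h | h
    · rwa [h] at this
    · rw [h, mul_neg, Real.sin_neg] at this
      exact neg_ne_zero.1 this
  rw [hE, hJ, heat_Psi, jac_eq _ _ _ _ _ hs]
  unfold HH JJ cw tw
  ring

lemma final_bound {l : ℕ} {k : Fin (l + 1) → ℕ} (hk : ∀ i, 0 < k i)
    {a : Fin (l + 1) → ℝ} (ha0 : 0 < a 0) (haMono : StrictMono a)
    (haLast : a (Fin.last l) = 1) :
    ∃ C > (0 : ℝ), ∀ (u : (i : Fin (l + 1)) → Fin (k i) → ℂ) (η : ℝ),
      0 < |η| → |η| < Real.pi → 1 ≤ Ufun l k a u * |η| →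
      (∫ v in Set.Ioc (1 : ℝ) (Real.pi / |η|),
          heatKernel l k a 1 (Psi l k a u (v * η)) * jacPsi l k a u (v * η)) ≤
        C / ((∑ i, zNormSq l k u i) * η ^ 2) *
          (heatKernel l k a 1 (Psi l k a u η) * jacPsi l k a u η) := by
  have ha : ∀ i, 0 < a i ∧ a i ≤ 1 := fun i =>
    ⟨ha0.trans_le (haMono.monotone (Fin.zero_le i)), haLast ▸ haMono.monotone (Fin.le_last i)⟩
  have haα : ∀ i, a 0 ≤ a i := fun i => haMono.monotone (Fin.zero_le i)
  obtain ⟨C, hC, hcmp⟩ := compare ha hk haLast ha0 haα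
  refine ⟨C * 24 / (4 * a 0 ^ 2), by positivity, fun u η h0 h1 hU => ?_⟩
  set w := zNormSq l k u with hw
  have hw0 : ∀ i, 0 ≤ w i := fun i => Finset.sum_nonneg fun j _ => Complex.normSq_nonneg _
  set D := (4 * ∑ i, a i ^ 2 * w i) * |η| ^ 2 with hD
  have hS0 : 0 ≤ 4 * ∑ i, a i ^ 2 * w i := by
    have : 0 ≤ ∑ i, a i ^ 2 * w i := Finset.sum_nonneg fun i _ => mul_nonneg (sq_nonneg _) (hw0 i)
    positivity
  have hD1 : 1 ≤ D := by
    have h2 : (Ufun l k a u * |η|) ^ 2 = D := by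
      unfold Ufun
      rw [mul_pow, Real.sq_sqrt hS0]
    rw [← h2]
    exact one_le_pow₀ hU
  set P := HH a k w |η| * JJ a k w |η| with hP
  have hc := hcmp w hw0 |η| h0 hD1
  have hP0 : 0 ≤ P := (hc |η| le_rfl h1).1
  have hkc := hkC_pos l k
  have hneg : -(D / 24) < 0 := by
    have : 0 < D / 24 := by positivity
    linarith
  have hIntg : IntegrableOn (fun v : ℝ => hkC l k * C * P * Real.exp (D / 24) * Real.exp (-(D / 24) * v)) (Set.Ioi 1) :=
    (integrableOn_exp_mul_Ioi hneg 1).const_mul _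
  have hst : (∫ v in Set.Ioc (1 : ℝ) (Real.pi / |η|),
          heatKernel l k a 1 (Psi l k a u (v * η)) * jacPsi l k a u (v * η)) ≤
      ∫ v in Set.Ioi (1 : ℝ), hkC l k * C * P * Real.exp (D / 24) * Real.exp (-(D / 24) * v) := by
    rw [integral_Ioc_eq_integral_Ioo]
    have hsub : Set.Ioo (1 : ℝ) (π / |η|) ⊆ Set.Ioi 1 := fun x hx => hx.1
    have hpt : ∀ v ∈ Set.Ioo (1 : ℝ) (π / |η|),
        0 ≤ heatKernel l k a 1 (Psi l k a u (v * η)) * jacPsi l k a u (v * η) ∧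
        heatKernel l k a 1 (Psi l k a u (v * η)) * jacPsi l k a u (v * η) ≤
          hkC l k * C * P * Real.exp (D / 24) * Real.exp (-(D / 24) * v) := by
      intro v hv
      have hv0 : 0 < v := by linarith [hv.1]
      have hab : |v * η| = v * |η| := by rw [abs_mul, abs_of_pos hv0]
      have hlt : v * |η| < π := (lt_div_iff₀ h0).1 hv.2
      have h3 : |v * η| < π := by rw [hab]; exact hlt
      have h4 : 0 < |v * η| := by rw [hab]; positivity
      rw [heat_jac ha u h4 h3, hab]
      obtain ⟨q1, q2⟩ := hc (v * |η|) (by nlinarith [hv.1]) hlt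
      refine ⟨mul_nonneg hkc.le q1, ?_⟩
      refine (mul_le_mul_of_nonneg_left q2 hkc.le).trans (le_of_eq ?_)
      rw [mul_div_cancel_right₀ _ h0.ne']
      have e : Real.exp (-(D * (v - 1) / 24)) = Real.exp (D / 24) * Real.exp (-(D / 24) * v) := by
        rw [← Real.exp_add]; ring_nf
      rw [← hD, e]
      ring
    have m1 : (∫ v in Set.Ioo (1 : ℝ) (Real.pi / |η|),
          heatKernel l k a 1 (Psi l k a u (v * η)) * jacPsi l k a u (v * η)) ≤
        ∫ v in Set.Ioo (1 : ℝ) (Real.pi / |η|), hkC l k * C * P * Real.exp (D / 24) * Real.exp (-(D / 24) * v) := by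
      refine integral_mono_of_nonneg ?_ (hIntg.mono_set hsub) ?_
      · exact (ae_restrict_iff' measurableSet_Ioo).2 (Filter.Eventually.of_forall fun v hv => (hpt v hv).1)
      · exact (ae_restrict_iff' measurableSet_Ioo).2 (Filter.Eventually.of_forall fun v hv => (hpt v hv).2)
    refine m1.trans (setIntegral_mono_set hIntg ?_ (Filter.Eventually.of_forall hsub))
    exact Filter.Eventually.of_forall fun v => by
      simp only [Pi.zero_apply]
      positivity
  refine hst.trans ?_
  rw [integral_const_mul, integral_exp_mul_Ioi hneg, heat_jac ha u h0 h1]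
  rw [← hP]
  have e1 : hkC l k * C * P * Real.exp (D / 24) * (-Real.exp (-(D / 24) * 1) / -(D / 24)) = C * 24 / D * (hkC l k * P) := by
    have : Real.exp (-(D / 24) * 1) = (Real.exp (D / 24))⁻¹ := by rw [← Real.exp_neg]; ring_nf
    rw [this]
    have := (Real.exp_pos (D / 24)).ne'
    generalize Real.exp (D / 24) = q at *
    have hDp : D ≠ 0 := by linarith
    field_simp
  rw [e1]
  refine mul_le_mul_of_nonneg_right ?_ (mul_nonneg hkc.le hP0)
  have hle : (∑ i, w i) * η ^ 2 * (4 * a 0 ^ 2) ≤ D := by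
    rw [hD, sq_abs]
    have : a 0 ^ 2 * ∑ i, w i ≤ ∑ i, a i ^ 2 * w i := by
      rw [Finset.mul_sum]
      refine Finset.sum_le_sum fun i _ => mul_le_mul_of_nonneg_right (pow_le_pow_left₀ ha0.le (haα i) 2) (hw0 i)
    nlinarith [mul_le_mul_of_nonneg_right this (sq_nonneg η)]
  have hη2 : 0 < η ^ 2 := by rw [← sq_abs]; positivity
  have hW : 0 < ∑ i, w i := by
    rcases (Finset.sum_nonneg fun i (_ : i ∈ Finset.univ) => hw0 i).eq_or_lt with h | h
    · exfalso
      have hz := (Finset.sum_eq_zero_iff_of_nonneg fun i _ => hw0 i).1 h.symm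
      have : D = 0 := by
        rw [hD, Finset.sum_eq_zero fun i hi => by rw [hz i hi, mul_zero]]
        ring
      linarith
    · exact h
  rw [div_div, mul_comm (4 * a 0 ^ 2)]
  exact div_le_div_of_nonneg_left (by positivity) (by positivity) hle

/-- For every `(u,η)` with `u_l ≠ 0`, `0 < |η| < π` and `U|η| ≥ 1`
(i.e. `Ψ(u,η)` lies outside the CC unit ball, up to measure zero), one has
`∫_1^{π/|η|} p(u,vη) J(u,vη) dv ≲ (|u|²η²)⁻¹ p(u,η) J(u,η)`,
with implied constant depending only on `(𝒦,𝒜)`. Here `p(u,η) = p₁(Ψ(u,η))` and `J` is the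
Jacobian determinant of `Ψ`. -/
theorem statement6 (l : ℕ) (k : Fin (l + 1) → ℕ) (hk : ∀ i, 0 < k i)
    (a : Fin (l + 1) → ℝ) (ha0 : 0 < a 0) (haMono : StrictMono a)
    (haLast : a (Fin.last l) = 1) :
    ∃ C > (0 : ℝ), ∀ (u : (i : Fin (l + 1)) → Fin (k i) → ℂ) (η : ℝ),
      u (Fin.last l) ≠ 0 → 0 < |η| → |η| < Real.pi → 1 ≤ Ufun l k a u * |η| →
      (∫ v in Set.Ioc (1 : ℝ) (Real.pi / |η|),
          heatKernel l k a 1 (Psi l k a u (v * η)) * jacPsi l k a u (v * η)) ≤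
        C / ((∑ i, zNormSq l k u i) * η ^ 2) *
          (heatKernel l k a 1 (Psi l k a u η) * jacPsi l k a u η) := by
  obtain ⟨C, hC, h⟩ := final_bound hk ha0 haMono haLast
  exact ⟨C, hC, fun u η _ h0 h1 hU => h u η h0 h1 hU⟩

end
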